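/- arXiv:0712.2601 — 2 statements merged into one kernel-verified Lean document; each statement's English description precedes it below -/
import Mathlib

section
/- Every polycyclic-by-finite group is strongly twisted conjugacy separable; that is, if G is polycyclic-by-finite then G is φ-conjugacy separable for every automorphism φ of G. -/
/-- `x` and `y` are `φ`-conjugate (twisted conjugate): `y = g * x * φ(g)⁻¹` for some `g`. -/
def TwistedConj {G : Type*} [Group G] (φ : MulAut G) (x y : G) : Prop :=
  ∃ g : G, y = g * x * (φ g)⁻¹

/-- A finite quotient of `G` respecting `φ` that separates the elements `x` and `y`. -/
inductive SepWitness {G : Type*} [Group G] (φ : MulAut G) (x y : G) : Prop where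
  | intro (K : Type) [grp : Group K] [fin : Finite K] (φK : MulAut K) (F : G →* K)
      (surj : Function.Surjective F) (comm : ∀ g : G, F (φ g) = φK (F g))
      (sep : ¬ TwistedConj φK (F x) (F y)) : SepWitness φ x y

/-- `G` is `φ`-conjugacy separable. -/
def PhiConjSep {G : Type*} [Group G] (φ : MulAut G) : Prop :=
  ∀ x y : G, ¬ TwistedConj φ x y → SepWitness φ x y

/-- A group is polycyclic if it admits a subnormal series with cyclic factor groups. -/
def IsPolycyclic (G : Type*) [Group G] : Prop :=
  ∃ (n : ℕ) (s : Fin (n + 1) → Subgroup G),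
    s 0 = ⊥ ∧ s (Fin.last n) = ⊤ ∧
    ∀ i : Fin n,
      s i.castSucc ≤ s i.succ ∧
      (∀ x ∈ s i.succ, ∀ h ∈ s i.castSucc, x * h * x⁻¹ ∈ s i.castSucc) ∧
      ∃ g ∈ s i.succ, ∀ x ∈ s i.succ, ∃ k : ℤ, ∃ h ∈ s i.castSucc, x = g ^ k * h

/-- A group is polycyclic-by-finite if it contains a polycyclic normal subgroup of
finite index. -/
def PolycyclicByFinite (G : Type*) [Group G] : Prop :=
  ∃ H : Subgroup G, H.Normal ∧ IsPolycyclic H ∧ H.FiniteIndex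


namespace TCS

open Filter Topology NumberField
open scoped NumberField

section Zeta

/-- Weight of an ideal. -/
noncomputable def wt {R : Type*} [CommRing R] [IsDedekindDomain R] [Module.Free ℤ R] (s : ℝ)
    (I : Ideal R) : ENNReal :=
  ENNReal.ofReal ((Ideal.absNorm I : ℝ) ^ (-s))

variable {R : Type*} [CommRing R] [IsDedekindDomain R] [Module.Free ℤ R]

lemma wt_one (s : ℝ) : wt s (1 : Ideal R) = 1 := by simp [wt]

lemma wt_mul (s : ℝ) (I J : Ideal R) : wt s (I * J) = wt s I * wt s J := by
  unfold wt
  rw [map_mul, Nat.cast_mul, Real.mul_rpow (by positivity) (by positivity),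
    ENNReal.ofReal_mul (by positivity)]

lemma wt_prod (s : ℝ) (m : Multiset (Ideal R)) : wt s m.prod = (m.map (wt s)).prod := by
  induction m using Multiset.induction_on with
  | empty => simpa using wt_one (R := R) s
  | cons a m ih => simp [wt_mul, ih]

/-- The zeta series of a number field, summed in `ENNReal`. -/
noncomputable def ZZ (K : Type*) [Field K] [NumberField K] (s : ℝ) : ENNReal :=
  ∑' I : {I : Ideal (𝓞 K) // I ≠ ⊥}, wt s I.1

lemma ZZ_eq (K : Type*) [Field K] [NumberField K] {s : ℝ} (_hs : 1 < s)
    (h0 : dedekindZeta K s ≠ 0) : ZZ K s = ENNReal.ofReal ((dedekindZeta K s).re) := by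
  let f : ℕ → ℂ := fun n ↦ (Nat.card {I : Ideal (𝓞 K) // Ideal.absNorm I = n} : ℂ)
  let a : ℕ → ℝ := fun n ↦ if n = 0 then 0 else
    (Nat.card {I : Ideal (𝓞 K) // Ideal.absNorm I = n} : ℝ) * (n : ℝ) ^ (-s)
  have hterm : ∀ n, LSeries.term f s n = ((a n : ℝ) : ℂ) := by
    intro n
    by_cases hn : n = 0
    · simp [hn, a]
    · simp only [LSeries.term_of_ne_zero hn, a, hn, if_false, f]
      rw [Complex.ofReal_mul, Complex.ofReal_cpow (by positivity)]
      push_cast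
      rw [Complex.cpow_neg, div_eq_mul_inv]
  have hz : dedekindZeta K s = ∑' n, ((a n : ℝ) : ℂ) := by
    unfold dedekindZeta LSeries
    exact tsum_congr hterm
  have hsum : Summable (fun n ↦ ((a n : ℝ) : ℂ)) := by
    by_contra hns
    rw [hz, tsum_eq_zero_of_not_summable hns] at h0
    exact h0 rfl
  have hsum' : Summable a := by exact_mod_cast hsum
  have ha : ∀ n, 0 ≤ a n := by
    intro n; simp only [a]; split_ifs <;> positivity
  rw [hz, ← Complex.ofReal_tsum, Complex.ofReal_re, ENNReal.ofReal_tsum_of_nonneg ha hsum']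
  unfold ZZ
  rw [← (Equiv.sigmaFiberEquiv
    (fun I : {I : Ideal (𝓞 K) // I ≠ ⊥} ↦ Ideal.absNorm I.1)).tsum_eq, ENNReal.tsum_sigma']
  refine tsum_congr fun n ↦ ?_
  by_cases hn : n = 0
  · subst hn
    have : IsEmpty {I : {I : Ideal (𝓞 K) // I ≠ ⊥} // Ideal.absNorm I.1 = 0} := by
      refine ⟨fun I ↦ I.1.2 ?_⟩
      exact Ideal.absNorm_eq_zero_iff.1 I.2
    simp [a]
  · let e : {I : {I : Ideal (𝓞 K) // I ≠ ⊥} // Ideal.absNorm I.1 = n} ≃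
        {I : Ideal (𝓞 K) // Ideal.absNorm I = n} :=
      { toFun := fun I ↦ ⟨I.1.1, I.2⟩
        invFun := fun I ↦ ⟨⟨I.1, by
          intro h; apply hn; rw [← I.2, h]; simp⟩, I.2⟩
        left_inv := fun I ↦ rfl
        right_inv := fun I ↦ rfl }
    have hfin : Finite {I : Ideal (𝓞 K) // Ideal.absNorm I = n} :=
      Ideal.finite_setOfPred_absNorm_eq n
    rw [← e.symm.tsum_eq]
    have : Fintype {I : Ideal (𝓞 K) // Ideal.absNorm I = n} := Fintype.ofFinite _
    rw [tsum_fintype]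
    have hc : ∀ I : {I : Ideal (𝓞 K) // Ideal.absNorm I = n},
        wt s ((Equiv.sigmaFiberEquiv
          (fun I : {I : Ideal (𝓞 K) // I ≠ ⊥} ↦ Ideal.absNorm I.1)) ⟨n, e.symm I⟩).1
          = ENNReal.ofReal ((n : ℝ) ^ (-s)) := by
      intro I
      show wt s I.1 = _
      rw [wt, I.2]
    rw [Finset.sum_congr rfl (fun I _ ↦ hc I)]
    simp only [Finset.sum_const, nsmul_eq_mul, a, hn, if_false]
    rw [ENNReal.ofReal_mul (by positivity), Finset.card_univ, ← Nat.card_eq_fintype_card,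
      ENNReal.ofReal_natCast]

/-- Two-sided bounds for the zeta series close to `1`. -/
lemma ZZ_bounds (K : Type*) [Field K] [NumberField K] :
    ∃ b B : ℝ, 0 < b ∧ 0 < B ∧ ∀ᶠ s : ℝ in 𝓝[>] 1,
      ENNReal.ofReal b ≤ ENNReal.ofReal (s - 1) * ZZ K s ∧
      ENNReal.ofReal (s - 1) * ZZ K s ≤ ENNReal.ofReal B := by
  have hpos := dedekindZeta_residue_pos K
  set ρ := dedekindZeta_residue K
  have h := tendsto_sub_one_mul_dedekindZeta_nhdsGT K
  have hre : Tendsto (fun s : ℝ ↦ ((s - 1) * dedekindZeta K s).re) (𝓝[>] 1) (𝓝 ρ) := by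
    have := (Complex.continuous_re.tendsto _).comp h
    exact this
  refine ⟨ρ / 2, 2 * ρ, by positivity, by positivity, ?_⟩
  filter_upwards [hre.eventually (lt_mem_nhds (show ρ / 2 < ρ by linarith)),
    hre.eventually (gt_mem_nhds (show ρ < 2 * ρ by linarith)), self_mem_nhdsWithin] with s h1 h2 hs
  have hs' : (1 : ℝ) < s := hs
  have h0 : dedekindZeta K s ≠ 0 := by
    intro h0
    rw [h0] at h1
    simp at h1
    linarith
  rw [ZZ_eq K hs' h0, ← ENNReal.ofReal_mul (by linarith)]
  have : ((s - 1) * dedekindZeta K s).re = (s - 1) * (dedekindZeta K s).re := by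
    have : ((s : ℂ) - 1) = ((s - 1 : ℝ) : ℂ) := by push_cast; rfl
    rw [this, Complex.re_ofReal_mul]
  rw [this] at h1 h2
  exact ⟨ENNReal.ofReal_le_ofReal h1.le, ENNReal.ofReal_le_ofReal h2.le⟩

/-- Sum over multisets supported in `T`. -/
noncomputable def WW (T : Set (Ideal R)) (s : ℝ) : ENNReal :=
  ∑' m : {m : Multiset (Ideal R) // ∀ x ∈ m, x ∈ T}, wt s m.1.prod

lemma WW_insert [Module.Finite ℤ R] (T : Set (Ideal R)) (P : Ideal R) (hP : P.IsPrime) (hP0 : P ≠ ⊥)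
    {s : ℝ} (hs : 1 < s) :
    WW (insert P T) s ≤ 2 * WW T s := by
  classical
  have hr : wt s P ≤ 2⁻¹ := by
    unfold wt
    have h2 : (2 : ℝ) ≤ Ideal.absNorm P := by
      have h0 : Ideal.absNorm P ≠ 0 := by
        rwa [Ne, Ideal.absNorm_eq_zero_iff]
      have h1 : Ideal.absNorm P ≠ 1 := by
        rw [Ne, Ideal.absNorm_eq_one_iff]; exact hP.ne_top
      exact_mod_cast (by omega : 2 ≤ Ideal.absNorm P)
    calc ENNReal.ofReal ((Ideal.absNorm P : ℝ) ^ (-s))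
        ≤ ENNReal.ofReal ((2 : ℝ)⁻¹) := by
          apply ENNReal.ofReal_le_ofReal
          rw [Real.rpow_neg (by linarith)]
          apply inv_anti₀ (by norm_num)
          calc (2 : ℝ) ≤ Ideal.absNorm P := h2
            _ = (Ideal.absNorm P : ℝ) ^ (1 : ℝ) := (Real.rpow_one _).symm
            _ ≤ _ := Real.rpow_le_rpow_of_exponent_le (by linarith) hs.le
      _ = 2⁻¹ := by rw [ENNReal.ofReal_inv_of_pos (by norm_num)]; simp
  let g : ℕ × {m : Multiset (Ideal R) // ∀ x ∈ m, x ∈ T} →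
      {m : Multiset (Ideal R) // ∀ x ∈ m, x ∈ insert P T} :=
    fun q ↦ ⟨Multiset.replicate q.1 P + q.2.1, by
      intro x hx
      rcases Multiset.mem_add.1 hx with h | h
      · exact Or.inl (Multiset.eq_of_mem_replicate h)
      · exact Or.inr (q.2.2 x h)⟩
  have hg : Function.Surjective g := by
    rintro ⟨m, hm⟩
    refine ⟨⟨m.count P, ⟨m.filter (fun x ↦ ¬ x = P), ?_⟩⟩, ?_⟩
    · intro x hx
      rw [Multiset.mem_filter] at hx
      exact (hm x hx.1).resolve_left hx.2
    · apply Subtype.ext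
      simp only [g]
      rw [← Multiset.filter_eq']
      exact Multiset.filter_add_not _ m
  calc WW (insert P T) s ≤ ∑' q, wt s (g q).1.prod :=
        ENNReal.tsum_le_tsum_comp_of_surjective hg _
    _ = ∑' q : ℕ × {m : Multiset (Ideal R) // ∀ x ∈ m, x ∈ T},
          (wt s P) ^ q.1 * wt s q.2.1.prod := by
        refine tsum_congr fun q ↦ ?_
        simp only [g, Multiset.prod_add, wt_mul]
        congr 1
        rw [wt_prod]; simp
    _ = (∑' n : ℕ, (wt s P) ^ n) * WW T s := by
        rw [ENNReal.tsum_prod', ← ENNReal.tsum_mul_right]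
        refine tsum_congr fun n ↦ ?_
        rw [WW, ← ENNReal.tsum_mul_left]
    _ ≤ 2 * WW T s := by
        gcongr
        rw [ENNReal.tsum_geometric]
        calc (1 - wt s P)⁻¹ ≤ (1 - 2⁻¹)⁻¹ := by gcongr
          _ = 2 := by simp

lemma WW_union [Module.Finite ℤ R] (S : Finset (Ideal R)) (T : Set (Ideal R))
    (hS : ∀ P ∈ S, P.IsPrime ∧ P ≠ ⊥) {s : ℝ} (hs : 1 < s) :
    WW (S ∪ T : Set (Ideal R)) s ≤ 2 ^ S.card * WW T s := by
  classical
  induction S using Finset.induction_on with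
  | empty => simp
  | insert P S hP ih =>
    have h1 := WW_insert (S ∪ T : Set (Ideal R)) P (hS P (by simp)).1 (hS P (by simp)).2 hs
    have h2 := ih (fun Q hQ ↦ hS Q (by simp [hQ]))
    rw [Finset.coe_insert, Set.insert_union, Finset.card_insert_of_notMem hP, pow_succ']
    calc _ ≤ _ := h1
      _ ≤ 2 * (2 ^ S.card * WW T s) := by gcongr
      _ = _ := by rw [mul_assoc]

lemma ZZ_le (K : Type*) [Field K] [NumberField K] (s : ℝ) :
    ZZ K s ≤ WW {P : Ideal (𝓞 K) | P.IsPrime ∧ P ≠ ⊥} s := by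
  let g : {I : Ideal (𝓞 K) // I ≠ ⊥} →
      {m : Multiset (Ideal (𝓞 K)) // ∀ x ∈ m, x ∈ {P : Ideal (𝓞 K) | P.IsPrime ∧ P ≠ ⊥}} :=
    fun I ↦ ⟨UniqueFactorizationMonoid.normalizedFactors I.1, by
      intro x hx
      have := UniqueFactorizationMonoid.prime_of_normalized_factor x hx
      exact ⟨Ideal.isPrime_of_prime this, this.ne_zero⟩⟩
  have hgp : ∀ I, (g I).1.prod = I.1 := fun I ↦ Ideal.prod_normalizedFactors_eq_self I.2
  have hg : Function.Injective g := by
    intro I J h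
    apply Subtype.ext
    rw [← hgp I, ← hgp J, h]
  calc ZZ K s = ∑' I, wt s (g I).1.prod := tsum_congr fun I ↦ by rw [hgp]
    _ ≤ _ := ENNReal.tsum_comp_le_tsum_of_injective hg (fun m ↦ wt s m.1.prod)

/-- If every prime outside a finite set has two distinct degree one primes above it then
contradiction. -/
theorem no_split (L M : Type*) [Field L] [NumberField L] [Field M] [NumberField M] [Algebra L M]
    (S : Set (Ideal (𝓞 L))) (hS : S.Finite)
    (h : ∀ P : Ideal (𝓞 L), P.IsPrime → P ≠ ⊥ → P ∉ S → ∃ Q₁ Q₂ : Ideal (𝓞 M),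
      Q₁.IsPrime ∧ Q₂.IsPrime ∧ Q₁ ≠ Q₂ ∧ Q₁.under (𝓞 L) = P ∧ Q₂.under (𝓞 L) = P ∧
      Ideal.absNorm Q₁ = Ideal.absNorm P ∧ Ideal.absNorm Q₂ = Ideal.absNorm P) : False := by
  classical
  set T : Set (Ideal (𝓞 L)) := {P | P.IsPrime ∧ P ≠ ⊥ ∧ P ∉ S} with hT
  have h' : ∀ P : Ideal (𝓞 L), ∃ Q : Ideal (𝓞 M) × Ideal (𝓞 M), P ∈ T →
      Q.1.IsPrime ∧ Q.2.IsPrime ∧ Q.1 ≠ Q.2 ∧ Q.1.under (𝓞 L) = P ∧ Q.2.under (𝓞 L) = P ∧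
      Ideal.absNorm Q.1 = Ideal.absNorm P ∧ Ideal.absNorm Q.2 = Ideal.absNorm P := by
    intro P
    by_cases hP : P ∈ T
    · obtain ⟨Q₁, Q₂, hQ⟩ := h P hP.1 hP.2.1 hP.2.2
      exact ⟨(Q₁, Q₂), fun _ ↦ hQ⟩
    · exact ⟨(⊥, ⊥), fun h ↦ absurd h hP⟩
  choose q hq using h'
  have hprime : ∀ P ∈ T, Prime (q P).1 ∧ Prime (q P).2 := by
    intro P hP
    obtain ⟨h1, h2, -, -, -, h3, h4⟩ := hq P hP
    have h0 : Ideal.absNorm P ≠ 0 := by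
      rw [Ne, Ideal.absNorm_eq_zero_iff]; exact hP.2.1
    constructor
    · apply Ideal.prime_of_isPrime _ h1
      intro h; rw [h] at h3; simp at h3; exact h0 h3.symm
    · apply Ideal.prime_of_isPrime _ h2
      intro h; rw [h] at h4; simp at h4; exact h0 h4.symm
  -- the injection
  let A := {m : Multiset (Ideal (𝓞 L)) // ∀ x ∈ m, x ∈ T}
  let F : A × A → Multiset (Ideal (𝓞 M)) := fun ab ↦
    ab.1.1.map (fun P ↦ (q P).1) + ab.2.1.map (fun P ↦ (q P).2)
  have hFp : ∀ ab, ∀ x ∈ F ab, Prime x := by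
    rintro ⟨a, b⟩ x hx
    rcases Multiset.mem_add.1 hx with hx | hx
    · obtain ⟨P, hP, rfl⟩ := Multiset.mem_map.1 hx
      exact (hprime P (a.2 P hP)).1
    · obtain ⟨P, hP, rfl⟩ := Multiset.mem_map.1 hx
      exact (hprime P (b.2 P hP)).2
  -- recover
  have hrec1 : ∀ ab : A × A, ((F ab).filter (fun Q ↦ (q (Q.under (𝓞 L))).1 = Q)).map
      (fun Q ↦ Q.under (𝓞 L)) = ab.1.1 := by
    rintro ⟨a, b⟩
    simp only [F, Multiset.filter_add, Multiset.map_add]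
    have e1 : (a.1.map (fun P ↦ (q P).1)).filter (fun Q ↦ (q (Q.under (𝓞 L))).1 = Q)
        = a.1.map (fun P ↦ (q P).1) := by
      rw [Multiset.filter_eq_self]
      intro Q hQ
      obtain ⟨P, hP, rfl⟩ := Multiset.mem_map.1 hQ
      rw [(hq P (a.2 P hP)).2.2.2.1]
    have e2 : (b.1.map (fun P ↦ (q P).2)).filter (fun Q ↦ (q (Q.under (𝓞 L))).1 = Q)
        = 0 := by
      rw [Multiset.filter_eq_nil]
      intro Q hQ
      obtain ⟨P, hP, rfl⟩ := Multiset.mem_map.1 hQ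
      rw [(hq P (b.2 P hP)).2.2.2.2.1]
      exact (hq P (b.2 P hP)).2.2.1
    rw [e1, e2, Multiset.map_zero, add_zero, Multiset.map_map]
    conv_rhs => rw [← Multiset.map_id a.1]
    exact Multiset.map_congr rfl fun P hP ↦ (hq P (a.2 P hP)).2.2.2.1
  have hrec2 : ∀ ab : A × A, ((F ab).filter (fun Q ↦ (q (Q.under (𝓞 L))).2 = Q)).map
      (fun Q ↦ Q.under (𝓞 L)) = ab.2.1 := by
    rintro ⟨a, b⟩
    simp only [F, Multiset.filter_add, Multiset.map_add]
    have e1 : (b.1.map (fun P ↦ (q P).2)).filter (fun Q ↦ (q (Q.under (𝓞 L))).2 = Q)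
        = b.1.map (fun P ↦ (q P).2) := by
      rw [Multiset.filter_eq_self]
      intro Q hQ
      obtain ⟨P, hP, rfl⟩ := Multiset.mem_map.1 hQ
      rw [(hq P (b.2 P hP)).2.2.2.2.1]
    have e2 : (a.1.map (fun P ↦ (q P).1)).filter (fun Q ↦ (q (Q.under (𝓞 L))).2 = Q)
        = 0 := by
      rw [Multiset.filter_eq_nil]
      intro Q hQ
      obtain ⟨P, hP, rfl⟩ := Multiset.mem_map.1 hQ
      rw [(hq P (a.2 P hP)).2.2.2.1]
      exact (hq P (a.2 P hP)).2.2.1.symm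
    rw [e1, e2, Multiset.map_zero, zero_add, Multiset.map_map]
    conv_rhs => rw [← Multiset.map_id b.1]
    exact Multiset.map_congr rfl fun P hP ↦ (hq P (b.2 P hP)).2.2.2.2.1
  have hFinj : Function.Injective F := by
    intro x y hxy
    apply Prod.ext <;> apply Subtype.ext
    · rw [← hrec1 x, hxy, hrec1 y]
    · rw [← hrec2 x, hxy, hrec2 y]
  let G : A × A → {I : Ideal (𝓞 M) // I ≠ ⊥} := fun ab ↦ ⟨(F ab).prod, by
    show (F ab).prod ≠ 0
    intro h0
    rw [Multiset.prod_eq_zero_iff] at h0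
    exact (hFp ab 0 h0).ne_zero rfl⟩
  have hGinj : Function.Injective G := by
    intro x y hxy
    apply hFinj
    have : (F x).prod = (F y).prod := congrArg Subtype.val hxy
    rw [← UniqueFactorizationMonoid.normalizedFactors_prod_of_prime (hFp x), this,
      UniqueFactorizationMonoid.normalizedFactors_prod_of_prime (hFp y)]
  have hwt : ∀ s ab, wt s (G ab).1 = wt s ab.1.1.prod * wt s ab.2.1.prod := by
    rintro s ⟨a, b⟩
    simp only [G, F, Multiset.prod_add, wt_mul]
    congr 1
    · rw [wt_prod, wt_prod, Multiset.map_map]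
      congr 1
      refine Multiset.map_congr rfl fun P hP ↦ ?_
      simp [wt, (hq P (a.2 P hP)).2.2.2.2.2.1]
    · rw [wt_prod, wt_prod, Multiset.map_map]
      congr 1
      refine Multiset.map_congr rfl fun P hP ↦ ?_
      simp [wt, (hq P (b.2 P hP)).2.2.2.2.2.2]
  have hsq : ∀ s, WW T s * WW T s ≤ ZZ M s := by
    intro s
    calc WW T s * WW T s = ∑' ab : A × A, wt s ab.1.1.prod * wt s ab.2.1.prod := by
          rw [ENNReal.tsum_prod']
          unfold WW
          rw [← ENNReal.tsum_mul_right]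
          refine tsum_congr fun a ↦ ?_
          exact ENNReal.tsum_mul_left.symm
      _ = ∑' ab, wt s (G ab).1 := tsum_congr fun ab ↦ (hwt s ab).symm
      _ ≤ _ := ENNReal.tsum_comp_le_tsum_of_injective hGinj (fun I ↦ wt s I.1)
  -- comparison
  let S' : Finset (Ideal (𝓞 L)) := hS.toFinset.filter (fun P ↦ P.IsPrime ∧ P ≠ ⊥)
  have hcover : {P : Ideal (𝓞 L) | P.IsPrime ∧ P ≠ ⊥} = (S' ∪ T : Set (Ideal (𝓞 L))) := by
    ext P
    simp only [S', T, Set.mem_ofPred_eq, Set.mem_union, Finset.mem_coe, Finset.mem_filter,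
      Set.Finite.mem_toFinset]
    tauto
  have hcmp : ∀ s : ℝ, 1 < s → ZZ L s ≤ 2 ^ S'.card * WW T s := by
    intro s hs
    refine (ZZ_le L s).trans ?_
    rw [hcover]
    exact WW_union S' T (fun P hP ↦ (Finset.mem_filter.1 hP).2) hs
  obtain ⟨b, _B0, hb, _, hbB⟩ := ZZ_bounds L
  obtain ⟨_b1, B, _, hB, hbB'⟩ := ZZ_bounds M
  set C : ENNReal := 2 ^ S'.card
  have hCtop : C ≠ ⊤ := by simp [C]
  have hev : ∀ᶠ s : ℝ in 𝓝[>] 1,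
      ENNReal.ofReal b * ENNReal.ofReal b ≤ C * C * ENNReal.ofReal B * ENNReal.ofReal (s - 1) := by
    filter_upwards [hbB, hbB', self_mem_nhdsWithin] with s h1 h2 hs
    have hs : (1 : ℝ) < s := hs
    set ε := ENNReal.ofReal (s - 1)
    calc ENNReal.ofReal b * ENNReal.ofReal b ≤ (ε * ZZ L s) * (ε * ZZ L s) :=
          mul_le_mul' h1.1 h1.1
      _ ≤ (ε * (C * WW T s)) * (ε * (C * WW T s)) := by
          gcongr <;> exact hcmp s hs
      _ = C * C * ε * (ε * (WW T s * WW T s)) := by ring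
      _ ≤ C * C * ε * (ε * ZZ M s) := by gcongr; exact hsq s
      _ ≤ C * C * ε * ENNReal.ofReal B := by gcongr; exact h2.2
      _ = _ := by ring
  have hlim : Tendsto (fun s : ℝ ↦ C * C * ENNReal.ofReal B * ENNReal.ofReal (s - 1)) (𝓝[>] 1)
      (𝓝 0) := by
    have h1 : Tendsto (fun s : ℝ ↦ ENNReal.ofReal (s - 1)) (𝓝[>] 1) (𝓝 0) := by
      have : Tendsto (fun s : ℝ ↦ ENNReal.ofReal (s - 1)) (𝓝 1) (𝓝 (ENNReal.ofReal (1 - 1))) :=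
        (ENNReal.continuous_ofReal.comp (continuous_id.sub continuous_const)).tendsto _
      simp only [sub_self, ENNReal.ofReal_zero] at this
      exact this.mono_left nhdsWithin_le_nhds
    have := ENNReal.Tendsto.const_mul (a := C * C * ENNReal.ofReal B) h1
      (Or.inr (by finiteness))
    simpa using this
  have := ge_of_tendsto hlim hev
  have hb0 : ENNReal.ofReal b ≠ 0 := by simpa using hb
  simp [hb0] at this

end Zeta

end TCS


namespace TCS

open NumberField Polynomial
open scoped NumberField Pointwise

lemma absNorm_eq_of_stab (L M : Type*) [Field L] [NumberField L] [Field M] [NumberField M]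
    [Algebra L M] [IsGalois L M] (P : Ideal (𝓞 L)) (hP : P.IsPrime) (hP0 : P ≠ ⊥)
    (Q : Ideal (𝓞 M)) (hQ : Q.IsPrime) (hQP : Q.LiesOver P)
    (hst : ∀ σ : Gal(M/L), σ • Q = Q → σ = 1) : Ideal.absNorm Q = Ideal.absNorm P := by
  have hPm : P.IsMaximal := hP.isMaximal hP0
  have hQm : Q.IsMaximal := Ideal.IsMaximal.of_liesOver_isMaximal Q P
  have h1 := Ideal.card_stabilizer_eq_card_inertia_mul_finrank (G := Gal(M/L)) P Q
  have h2 : Nat.card (MulAction.stabilizer Gal(M/L) Q) = 1 := by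
    have : MulAction.stabilizer Gal(M/L) Q = ⊥ := by
      rw [eq_bot_iff]
      intro σ hσ
      exact hst σ hσ
    rw [this]; simp
  rw [h2] at h1
  have h3 : Q.inertiaDeg (𝓞 L) = 1 := Nat.eq_one_of_mul_eq_one_left h1.symm
  rw [Ideal.absNorm_eq_pow_inertiaDeg'_of_liesOver Q P hP hP0, Ideal.inertiaDeg'_eq_inertiaDeg,
    h3, pow_one]

lemma gal_trivial (L M : Type*) [Field L] [NumberField L] [Field M] [NumberField M]
    [Algebra L M] [IsGalois L M] (S : Set (Ideal (𝓞 L))) (hS : S.Finite)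
    (h : ∀ P : Ideal (𝓞 L), P.IsPrime → P ≠ ⊥ → P ∉ S → ∀ Q : Ideal (𝓞 M), Q.IsPrime →
      Q.LiesOver P → ∀ σ : Gal(M/L), σ • Q = Q → σ = 1) (σ : Gal(M/L)) : σ = 1 := by
  by_contra hσ
  refine no_split L M S hS fun P hP hP0 hPS ↦ ?_
  obtain ⟨Q, hQ, hQP⟩ := Ideal.nonempty_primesOver (S := 𝓞 M) P
  have hQ' : (σ • Q).IsPrime := inferInstance
  have hQP' : (σ • Q).LiesOver P := inferInstance
  refine ⟨Q, σ • Q, hQ, hQ', fun he ↦ hσ (h P hP hP0 hPS Q hQ hQP σ he.symm), hQP.over.symm,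
    hQP'.over.symm, absNorm_eq_of_stab L M P hP hP0 Q hQ hQP (h P hP hP0 hPS Q hQ hQP),
    absNorm_eq_of_stab L M P hP hP0 _ hQ' hQP' (h P hP hP0 hPS _ hQ' hQP')⟩

theorem kummer_local_global (L : Type*) [Field L] [NumberField L] (m : ℕ) (hm : 0 < m) (ζ : L)
    (hζ : IsPrimitiveRoot ζ m) (y : (𝓞 L)ˣ)
    (h : ∀ P : Ideal (𝓞 L), P.IsPrime → P ≠ ⊥ → (m : 𝓞 L) ∉ P → ∃ z : 𝓞 L, (y : 𝓞 L) - z ^ m ∈ P) :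
    ∃ z : L, z ^ m = ((y : 𝓞 L) : L) := by
  classical
  set f : L[X] := X ^ m - C ((y : 𝓞 L) : L) with hf
  let M := f.SplittingField
  have hfn : f.natDegree = m := natDegree_X_pow_sub_C
  have hf0 : f ≠ 0 := X_pow_sub_C_ne_zero hm _
  have hm0 : (m : L) ≠ 0 := by exact_mod_cast hm.ne'
  have hsep : f.Separable := by
    apply separable_X_pow_sub_C _ hm0
    intro h0
    exact y.ne_zero (RingOfIntegers.ext h0)
  have : IsGalois L M := IsGalois.of_separable_splitting_field hsep
  have : NumberField M := NumberField.of_module_finite L M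
  have hroot : ∀ β : M, β ∈ f.rootSet M ↔ β ^ m = algebraMap L M ((y : 𝓞 L) : L) := by
    intro β
    rw [mem_rootSet_of_ne hf0]
    simp [hf, sub_eq_zero]
  have hdvdfin : Set.Finite {P : Ideal (𝓞 L) | P.IsPrime ∧ P ≠ ⊥ ∧ (m : 𝓞 L) ∈ P} := by
    have hI : Ideal.span {(m : 𝓞 L)} ≠ 0 := by
      rw [Ideal.zero_eq_bot, Ne, Ideal.span_singleton_eq_bot]
      exact_mod_cast hm.ne'
    refine ((Ideal.finite_factors hI).image (fun v ↦ v.asIdeal)).subset ?_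
    rintro P ⟨h1, h2, h3⟩
    refine ⟨⟨P, h1, h2⟩, ?_, rfl⟩
    show P ∣ _
    rw [Ideal.dvd_span_singleton]
    exact h3
  have key : ∀ σ : Gal(M/L), σ = 1 := by
    refine gal_trivial L M _ hdvdfin ?_
    intro P hP hP0 hPS Q hQ hQP σ hσ
    have hmP : (m : 𝓞 L) ∉ P := fun hh ↦ hPS ⟨hP, hP0, hh⟩
    have hmQ : (m : 𝓞 M) ∉ Q := by
      intro hh
      apply hmP
      rw [hQP.over, Ideal.under_def, Ideal.mem_comap]
      simpa using hh
    have hσQ : ∀ x ∈ Q, σ • x ∈ Q := by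
      intro x hx
      have := Ideal.smul_mem_pointwise_smul σ x Q hx
      rwa [hσ] at this
    obtain ⟨z, hz⟩ := h P hP hP0 hmP
    have hprim : IsPrimitiveRoot (algebraMap L M ζ) m :=
      hζ.map_of_injective (algebraMap L M).injective
    have hσζ : ∀ x : M, x ^ m = 1 → σ x = x := by
      intro x hx
      have : NeZero m := ⟨hm.ne'⟩
      obtain ⟨i, -, rfl⟩ := hprim.eq_pow_of_pow_eq_one hx
      simp
    -- root of unity close to one
    have hone : ∀ ω : 𝓞 M, ω ^ m = 1 → ω - 1 ∈ Q → ω = 1 := by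
      intro ω hω h1
      by_contra hne
      apply hmQ
      have hg : (∑ i ∈ Finset.range m, ω ^ i) * (ω - 1) = 0 := by
        rw [geom_sum_mul, hω, sub_self]
      have hg0 : ∑ i ∈ Finset.range m, ω ^ i = 0 :=
        (mul_eq_zero.1 hg).resolve_right (sub_ne_zero.2 hne)
      have : (∑ i ∈ Finset.range m, (ω ^ i - 1)) ∈ Q := by
        refine Ideal.sum_mem _ fun i _ ↦ ?_
        obtain ⟨c, hc⟩ := sub_one_dvd_pow_sub_one ω i
        rw [hc]; exact Ideal.mul_mem_right _ _ h1
      rw [Finset.sum_sub_distrib, hg0] at this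
      simpa using this
    have hfix : ∀ β : M, β ^ m = algebraMap L M ((y : 𝓞 L) : L) → σ β = β := by
      intro β hβ
      have hβi : IsIntegral ℤ β := by
        apply IsIntegral.of_pow hm
        rw [hβ]
        exact ((y : 𝓞 L).isIntegral_coe).algebraMap
      set b : 𝓞 M := ⟨β, hβi⟩ with hb
      have hbm : b ^ m = algebraMap (𝓞 L) (𝓞 M) y := by
        apply RingOfIntegers.ext
        show β ^ m = _
        rw [hβ]; rfl
      have hbu : IsUnit b := by
        have : IsUnit (b ^ m) := by rw [hbm]; exact (y.isUnit).map _
        exact (isUnit_pow_iff hm.ne').1 this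
      have hprimO : ∃ ξ : 𝓞 M, IsPrimitiveRoot ξ m := by
        refine ⟨⟨algebraMap L M ζ, hprim.isIntegral hm⟩, ?_⟩
        exact IsPrimitiveRoot.of_map_of_injective (f := algebraMap (𝓞 M) M) hprim
          RingOfIntegers.coe_injective
      obtain ⟨ξ, hξ⟩ := hprimO
      have hprod : b ^ m - (algebraMap (𝓞 L) (𝓞 M) z) ^ m ∈ Q := by
        rw [hbm, ← map_pow, ← map_sub]
        rw [hQP.over] at hz
        exact hz
      rw [hξ.pow_sub_pow_eq_prod_sub_mul _ _ hm, hQ.prod_mem_iff] at hprod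
      obtain ⟨ω, hω, hmem⟩ := hprod
      rw [mem_nthRootsFinset hm] at hω
      have hωσ : σ • ω = ω := by
        apply RingOfIntegers.ext
        show σ (ω : M) = ω
        apply hσζ
        exact_mod_cast congrArg (algebraMap (𝓞 M) M) hω
      have hzσ : σ • (algebraMap (𝓞 L) (𝓞 M) z) = algebraMap (𝓞 L) (𝓞 M) z := by
        apply RingOfIntegers.ext
        show σ (algebraMap L M z) = algebraMap L M z
        simp
      have h2 := hσQ _ hmem
      rw [smul_sub, smul_mul', hωσ, hzσ] at h2
      have h3 : σ • b - b ∈ Q := by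
        have := Q.sub_mem h2 hmem
        simpa using this
      obtain ⟨u, hu⟩ := hbu
      have hub : (u⁻¹ : (𝓞 M)ˣ) * b = 1 := by rw [← hu]; simp
      have hσm : (σ • b) ^ m = b ^ m := by
        rw [← smul_pow', hbm]
        apply RingOfIntegers.ext
        show σ (algebraMap L M _) = algebraMap L M _
        simp
      have h4 : σ • b * (u⁻¹ : (𝓞 M)ˣ) = 1 := by
        apply hone
        · rw [mul_pow, hσm, ← mul_pow, mul_comm, hub, one_pow]
        · have := Q.mul_mem_right ((u⁻¹ : (𝓞 M)ˣ) : 𝓞 M) h3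
          rwa [sub_mul, mul_comm b, hub] at this
      have h5 : σ • b = b := by
        calc σ • b = σ • b * ((u⁻¹ : (𝓞 M)ˣ) * b) := by rw [hub, mul_one]
          _ = b := by rw [← mul_assoc, h4, one_mul]
      exact congrArg (algebraMap (𝓞 M) M) h5
    have : (σ : M →ₐ[L] M) = AlgHom.id L M := by
      refine AlgHom.ext_of_adjoin_eq_top (IsSplittingField.adjoin_rootSet M f) ?_
      intro β hβ
      exact hfix β ((hroot β).1 hβ)
    ext x
    exact congrArg (fun g : M →ₐ[L] M ↦ g x) this
  obtain ⟨β, hβ⟩ : ∃ β : M, β ^ m = algebraMap L M ((y : 𝓞 L) : L) := by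
    have hs := SplittingField.splits f
    obtain ⟨β, hβ⟩ := hs.exists_eval_eq_zero (by
      rw [degree_map, degree_X_pow_sub_C hm]; exact_mod_cast hm.ne')
    refine ⟨β, ?_⟩
    rw [eval_map_algebraMap] at hβ
    simpa [hf, sub_eq_zero] using hβ
  obtain ⟨z, hz⟩ := (IsGalois.mem_range_algebraMap_iff_fixed β).2 (fun g ↦ by rw [key g]; rfl)
  refine ⟨z, (algebraMap L M).injective ?_⟩
  rw [map_pow, hz, hβ]

end TCS


namespace TCS

set_option linter.unusedSectionVars false

open NumberField Polynomial
open scoped NumberField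

/-- An infinitely divisible element of a finitely generated abelian group is zero. -/
lemma fg_div {A : Type*} [AddCommGroup A] [hA : Module.Finite ℤ A] (q : A)
    (h : ∀ m : ℕ, 0 < m → ∃ b : A, q = m • b) : q = 0 := by
  classical
  have : AddGroup.FG A := Module.Finite.iff_addGroup_fg.1 hA
  obtain ⟨n, ι, _, p, hp, e, ⟨φ⟩⟩ := AddCommGroup.equiv_free_prod_directSum_zmod A
  have hφ : ∀ m : ℕ, 0 < m → ∃ b, φ q = m • b := by
    intro m hm
    obtain ⟨b, hb⟩ := h m hm
    exact ⟨φ b, by rw [hb, map_nsmul]⟩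
  apply φ.injective
  rw [map_zero]
  apply Prod.ext
  · ext i
    show (φ q).1 i = 0
    by_contra hne
    obtain ⟨b, hb⟩ := hφ (2 * ((φ q).1 i).natAbs) (by positivity)
    have h1 : (φ q).1 i = ((2 * ((φ q).1 i).natAbs : ℕ) : ℤ) * b.1 i := by
      conv_lhs => rw [hb]
      simp
    have h2 : ((2 * ((φ q).1 i).natAbs : ℕ) : ℤ) ∣ (φ q).1 i := ⟨_, h1⟩
    have h3 := Int.natAbs_dvd_natAbs.2 h2
    rw [Int.natAbs_natCast] at h3
    have h4 := Nat.le_of_dvd (Int.natAbs_pos.2 hne) h3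
    have := Int.natAbs_pos.2 hne
    omega
  · refine DFinsupp.ext fun i ↦ ?_
    show (φ q).2 i = 0
    obtain ⟨b, hb⟩ := hφ (p i ^ e i) (pow_pos (hp i).pos _)
    rw [hb]
    show ((p i ^ e i) • b.2) i = 0
    rw [DirectSum.smul_apply]
    simp

section Kummer

variable {Ω : Type*} [Field Ω]

lemma char_step {𝒢 : Type*} [Group 𝒢] (m : ℕ) (hm : 0 < m) (χ₁ χ : 𝒢 →* Ωˣ)
    (h1 : ∀ σ, χ₁ σ ^ m = 1) (hker : ∀ σ, χ₁ σ = 1 → χ σ = 1) :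
    ∃ c : ℕ, χ = χ₁ ^ c := by
  have : NeZero m := ⟨hm.ne'⟩
  have hle : χ₁.range ≤ rootsOfUnity m Ω := by
    rintro _ ⟨σ, rfl⟩; exact h1 σ
  have : Finite χ₁.range := Finite.of_injective _ (Subgroup.inclusion_injective hle)
  obtain ⟨⟨g, σ0, rfl⟩, hg⟩ := IsCyclic.exists_generator (α := χ₁.range)
  have hfin : IsOfFinOrder (χ₁ σ0) := isOfFinOrder_iff_pow_eq_one.2 ⟨m, hm, h1 σ0⟩
  have : NeZero (orderOf (χ₁ σ0)) := ⟨hfin.orderOf_pos.ne'⟩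
  have hprim : IsPrimitiveRoot (χ₁ σ0) (orderOf (χ₁ σ0)) := IsPrimitiveRoot.orderOf _
  have hx : χ σ0 ^ (orderOf (χ₁ σ0)) = 1 := by
    rw [← map_pow]; apply hker; rw [map_pow, pow_orderOf_eq_one]
  obtain ⟨c, -, hc⟩ := (IsPrimitiveRoot.coe_units_iff.2 hprim).eq_pow_of_pow_eq_one
    (ξ := (χ σ0 : Ω)) (by rw [← Units.val_pow_eq_pow_val, hx, Units.val_one])
  have hc' : χ₁ σ0 ^ c = χ σ0 := by ext; simpa using hc
  refine ⟨c, MonoidHom.ext fun σ ↦ ?_⟩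
  obtain ⟨k, hk⟩ := hg ⟨χ₁ σ, σ, rfl⟩
  have hk' : χ₁ σ0 ^ k = χ₁ σ := congrArg Subtype.val hk
  have h2 : χ (σ0 ^ (-k) * σ) = 1 := by
    apply hker
    rw [map_mul, map_zpow, ← hk']; simp
  rw [map_mul, map_zpow, zpow_neg, inv_mul_eq_one] at h2
  rw [MonoidHom.pow_apply, ← h2, ← hk', ← hc', ← zpow_natCast, ← zpow_natCast, ← zpow_mul,
    ← zpow_mul, mul_comm]

lemma char_closure {𝒢 : Type*} [Group 𝒢] (m : ℕ) (hm : 0 < m) (l : List (𝒢 →* Ωˣ))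
    (χ : 𝒢 →* Ωˣ) (hl : ∀ χ' ∈ l, ∀ σ, χ' σ ^ m = 1)
    (hker : ∀ σ, (∀ χ' ∈ l, χ' σ = 1) → χ σ = 1) :
    χ ∈ Subgroup.closure {χ' | χ' ∈ l} := by
  suffices H : ∀ (N : Subgroup 𝒢) (χ : 𝒢 →* Ωˣ),
      (∀ σ ∈ N, (∀ χ' ∈ l, χ' σ = 1) → χ σ = 1) →
      ∃ p ∈ Subgroup.closure {χ' | χ' ∈ l}, ∀ σ ∈ N, χ σ = p σ by
    obtain ⟨p, hp, h⟩ := H ⊤ χ (fun σ _ ↦ hker σ)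
    rwa [show χ = p from MonoidHom.ext fun σ ↦ h σ trivial]
  clear hker χ
  induction l with
  | nil =>
    intro N χ h
    exact ⟨1, one_mem _, fun σ hσ ↦ h σ hσ (by simp)⟩
  | cons χ₁ l ih =>
    intro N χ h
    obtain ⟨p, hp, hpN⟩ := ih (fun χ' h' ↦ hl χ' (by simp [h'])) (N ⊓ χ₁.ker) χ (by
      rintro σ ⟨h1, h2⟩ h3
      refine h σ h1 ?_
      intro χ' hχ'
      rcases List.mem_cons.1 hχ' with rfl | hh
      · exact h2
      · exact h3 _ hh)
    obtain ⟨c, hc⟩ := char_step m hm (χ₁.comp N.subtype) ((χ * p⁻¹).comp N.subtype)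
      (fun σ ↦ hl χ₁ (by simp) _) (by
        intro σ hσ
        have := hpN σ ⟨σ.2, hσ⟩
        simp [this])
    refine ⟨χ₁ ^ c * p, mul_mem (pow_mem (Subgroup.subset_closure
      (show χ₁ ∈ {χ' | χ' ∈ χ₁ :: l} from List.mem_cons_self)) _)
      (Subgroup.closure_mono (fun x hx ↦ List.mem_cons_of_mem _ hx) hp), ?_⟩
    intro σ hσ
    have := DFunLike.congr_fun hc ⟨σ, hσ⟩
    simp only [MonoidHom.comp_apply, Subgroup.subtype_apply, MonoidHom.mul_apply,
      MonoidHom.inv_apply, MonoidHom.pow_apply] at this ⊢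
    rw [← this]; simp

end Kummer

section Descent

variable (K : Type*) [Field K] [NumberField K]

local notation "Ωc" => AlgebraicClosure K

lemma fixed_root {m : ℕ} (hm : 0 < m) {ζ : Ωc} (hζ : IsPrimitiveRoot ζ m) (σ : Gal(Ωc/K))
    (hσ : σ ζ = ζ) (ω : Ωc) (hω : ω ^ m = 1) : σ ω = ω := by
  have : NeZero m := ⟨hm.ne'⟩
  obtain ⟨i, -, rfl⟩ := hζ.eq_pow_of_pow_eq_one hω
  rw [map_pow, hσ]

/-- The subgroup fixing `ζ`. -/
noncomputable def fixZ (ζ : Ωc) : Subgroup Gal(Ωc/K) := MulAction.stabilizer _ ζ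

lemma mem_fixZ (ζ : Ωc) (σ : Gal(Ωc/K)) : σ ∈ fixZ K ζ ↔ σ ζ = ζ := Iff.rfl

/-- Kummer character. -/
noncomputable def kchar {m : ℕ} (hm : 0 < m) {ζ : Ωc} (hζ : IsPrimitiveRoot ζ m) (α : (Ωc)ˣ)
    (hα : ∀ σ : Gal(Ωc/K), σ ((α : Ωc) ^ m) = (α : Ωc) ^ m) : fixZ K ζ →* (Ωc)ˣ :=
  MonoidHom.mk' (fun σ ↦ Units.map (σ.1 : Ωc →* Ωc) α * α⁻¹) (by
    intro σ τ
    have hτ : σ.1 (τ.1 α * (α⁻¹ : (Ωc)ˣ)) = τ.1 α * (α⁻¹ : (Ωc)ˣ) := by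
      apply fixed_root K hm hζ σ.1 σ.2
      rw [mul_pow, ← map_pow, hα, ← mul_pow]
      simp
    ext
    have hu : σ.1 ((α⁻¹ : (Ωc)ˣ) : Ωc) ≠ 0 := by simp
    have h0 : (α : Ωc) ≠ 0 := α.ne_zero
    rw [map_mul] at hτ
    simp only [Units.val_mul, Units.coe_map, Subgroup.coe_mul]
    show σ.1 (τ.1 α) * _ = (σ.1 α * _) * (τ.1 α * _)
    rw [← hτ]
    have h1 : σ.1 (α : Ωc) * σ.1 ((α⁻¹ : (Ωc)ˣ) : Ωc) = 1 := by
      rw [← map_mul]; simp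
    calc σ.1 (τ.1 α) * (α⁻¹ : (Ωc)ˣ)
        = σ.1 (τ.1 α) * (α⁻¹ : (Ωc)ˣ) * (σ.1 (α : Ωc) * σ.1 ((α⁻¹ : (Ωc)ˣ) : Ωc)) := by
          rw [h1, mul_one]
      _ = _ := by ring)

lemma kchar_apply {m : ℕ} (hm : 0 < m) {ζ : Ωc} (hζ : IsPrimitiveRoot ζ m) (α : (Ωc)ˣ)
    (hα : ∀ σ : Gal(Ωc/K), σ ((α : Ωc) ^ m) = (α : Ωc) ^ m) (σ : fixZ K ζ) :
    ((kchar K hm hζ α hα σ : (Ωc)ˣ) : Ωc) = σ.1 α * (α⁻¹ : (Ωc)ˣ) := rfl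

/-- Kummer descent, first part. -/
lemma kummer_descent1 {m : ℕ} (hm : 0 < m) {ζ : Ωc} (hζ : IsPrimitiveRoot ζ m)
    (l : List (Ωc)ˣ) (hl : ∀ α ∈ l, ∀ σ : Gal(Ωc/K), σ ((α : Ωc) ^ m) = (α : Ωc) ^ m)
    (z : (Ωc)ˣ) (hz : ∀ σ : Gal(Ωc/K), σ ((z : Ωc) ^ m) = (z : Ωc) ^ m)
    (hker : ∀ σ : Gal(Ωc/K), σ ζ = ζ → (∀ α ∈ l, σ (α : Ωc) = α) → σ (z : Ωc) = z) :
    ∃ p ∈ Subgroup.closure {α | α ∈ l}, ∀ σ : Gal(Ωc/K), σ ζ = ζ →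
      σ ((z * p⁻¹ : (Ωc)ˣ) : Ωc) = ((z * p⁻¹ : (Ωc)ˣ) : Ωc) := by
  classical
  have hone : ∀ (α : (Ωc)ˣ) hα (σ : fixZ K ζ), kchar K hm hζ α hα σ = 1 ↔ σ.1 (α : Ωc) = α := by
    intro α hα σ
    rw [Units.ext_iff, kchar_apply, Units.val_one, Units.mul_inv_eq_one]
  let l' : List (fixZ K ζ →* (Ωc)ˣ) := l.attach.map (fun α ↦ kchar K hm hζ α.1 (hl α.1 α.2))
  have hmem := char_closure m hm l' (kchar K hm hζ z hz) (by
    intro χ' hχ' σ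
    obtain ⟨α, -, rfl⟩ := List.mem_map.1 hχ'
    ext
    rw [Units.val_pow_eq_pow_val, kchar_apply, mul_pow, ← map_pow, hl α.1 α.2, ← mul_pow]
    simp) (by
    intro σ hσ
    rw [hone]
    refine hker σ.1 σ.2 fun α hα ↦ ?_
    rw [← hone α (hl α hα)]
    exact hσ _ (List.mem_map.2 ⟨⟨α, hα⟩, by simp, rfl⟩))
  have hcl : ∀ χ ∈ Subgroup.closure {χ' | χ' ∈ l'}, ∃ p ∈ Subgroup.closure {α | α ∈ l},
      ∀ σ : fixZ K ζ, χ σ = Units.map (σ.1 : Ωc →* Ωc) p * p⁻¹ := by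
    intro χ hχ
    induction hχ using Subgroup.closure_induction with
    | mem χ h =>
      obtain ⟨α, -, rfl⟩ := List.mem_map.1 h
      exact ⟨α.1, Subgroup.subset_closure α.2, fun σ ↦ rfl⟩
    | one => exact ⟨1, one_mem _, fun σ ↦ by simp⟩
    | mul x y _ _ hx hy =>
      obtain ⟨p, hp, h1⟩ := hx
      obtain ⟨q, hq, h2⟩ := hy
      refine ⟨p * q, mul_mem hp hq, fun σ ↦ ?_⟩
      rw [MonoidHom.mul_apply, h1, h2, map_mul, mul_inv]
      exact mul_mul_mul_comm _ _ _ _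
    | inv x _ hx =>
      obtain ⟨p, hp, h1⟩ := hx
      refine ⟨p⁻¹, inv_mem hp, fun σ ↦ ?_⟩
      rw [MonoidHom.inv_apply, h1, map_inv, mul_inv]
  obtain ⟨p, hp, h⟩ := hcl _ hmem
  refine ⟨p, hp, fun σ hσ ↦ ?_⟩
  have h1 := h ⟨σ, hσ⟩
  have h2 : Units.map (σ : Ωc →* Ωc) z * z⁻¹ = Units.map (σ : Ωc →* Ωc) p * p⁻¹ := h1
  have h3 : Units.map (σ : Ωc →* Ωc) (z * p⁻¹) = z * p⁻¹ := by
    rw [map_mul, map_inv]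
    have := congrArg (fun t ↦ t * z * (Units.map (σ : Ωc →* Ωc) p)⁻¹) h2
    simp only [inv_mul_cancel_right] at this
    rw [this, mul_comm _ p⁻¹, mul_assoc, mul_assoc, mul_left_comm _ z, mul_inv_cancel, mul_one,
      mul_comm]
  exact congrArg Units.val h3

/-- Kummer descent, second part. -/
lemma kummer_descent2 {m : ℕ} (hm : 0 < m) {ζ : Ωc} (hζ : IsPrimitiveRoot ζ m)
    (a : Kˣ) (x : (Ωc)ˣ) (hx : (x : Ωc) ^ m = algebraMap K Ωc a)
    (hfix : ∀ σ : Gal(Ωc/K), σ ζ = ζ → σ (x : Ωc) = x) :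
    ∃ b : Kˣ, a ^ (Units.torsionOrder K) = b ^ m := by
  have : NeZero m := ⟨hm.ne'⟩
  have hc : ∀ σ : Gal(Ωc/K), ∃ c : ℕ, σ ζ = ζ ^ c := by
    intro σ
    obtain ⟨c, -, hc⟩ := hζ.eq_pow_of_pow_eq_one (ξ := σ ζ) (by rw [← map_pow, hζ.pow_eq_one, map_one])
    exact ⟨c, hc.symm⟩
  have hx0 : (x : Ωc) ≠ 0 := x.ne_zero
  let J : AddSubgroup ℤ :=
    { carrier := {j | ∃ b : Kˣ, a ^ j = b ^ m}
      add_mem' := by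
        rintro i j ⟨b, hb⟩ ⟨c, hc⟩
        exact ⟨b * c, by rw [zpow_add, hb, hc, mul_pow]⟩
      zero_mem' := ⟨1, by simp⟩
      neg_mem' := by
        rintro i ⟨b, hb⟩
        exact ⟨b⁻¹, by rw [zpow_neg, hb, inv_pow]⟩ }
  have hJm : (m : ℤ) ∈ J := ⟨a, by simp⟩
  have hJc : ∀ (σ : Gal(Ωc/K)) (c : ℕ), σ ζ = ζ ^ c → (c : ℤ) - 1 ∈ J := by
    intro σ c hσ
    have hfixed : ∀ τ : Gal(Ωc/K), τ (σ x / (x : Ωc) ^ c) = σ x / (x : Ωc) ^ c := by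
      intro τ
      set ω := τ x / (x : Ωc) with hω
      have hωm : ω ^ m = 1 := by
        rw [hω, div_pow, ← map_pow, hx]
        simp
      have hτx : τ x = ω * x := by rw [hω]; field_simp
      have hσω : σ ω = ω ^ c := by
        obtain ⟨i, -, hi⟩ := hζ.eq_pow_of_pow_eq_one hωm
        rw [← hi, map_pow, hσ, ← pow_mul, ← pow_mul, mul_comm]
      have hcomm : τ (σ x) = σ (τ x) := by
        have h1 : ((σ * τ)⁻¹ * (τ * σ)) ζ = ζ := by
          obtain ⟨d, hd⟩ := hc τ
          have : (τ * σ) ζ = (σ * τ) ζ := by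
            show τ (σ ζ) = σ (τ ζ)
            rw [hσ, hd, map_pow, map_pow, hσ, hd, ← pow_mul, ← pow_mul, mul_comm]
          show (σ * τ)⁻¹ ((τ * σ) ζ) = ζ
          rw [this]
          exact (σ * τ).symm_apply_apply ζ
        have h2 := hfix _ h1
        have h3 : (τ * σ) (x : Ωc) = (σ * τ) (x : Ωc) := by
          have h4 : (σ * τ)⁻¹ ((τ * σ) (x : Ωc)) = x := h2
          rw [← h4]
          conv_lhs => rw [h4]
          exact ((σ * τ).apply_symm_apply _).symm
        exact h3
      have hω0 : ω ≠ 0 := by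
        intro h0; rw [h0, zero_pow hm.ne'] at hωm; exact zero_ne_one hωm
      rw [map_div₀, map_pow, hcomm, hτx, map_mul, hσω, mul_pow]
      field_simp
    obtain ⟨κ, hκ⟩ := (InfiniteGalois.mem_range_algebraMap_iff_fixed _).2 hfixed
    have hκ0 : κ ≠ 0 := by
      intro h0
      rw [h0, map_zero] at hκ
      have : σ (x : Ωc) / (x : Ωc) ^ c ≠ 0 := div_ne_zero (by simp) (pow_ne_zero _ hx0)
      exact this hκ.symm
    have hmul : a ^ c * (Units.mk0 κ hκ0) ^ m = a := by
      ext
      apply (algebraMap K Ωc).injective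
      simp only [Units.val_mul, Units.val_pow_eq_pow_val, Units.val_mk0, map_mul, map_pow, hκ]
      have : σ (x : Ωc) ^ m = x ^ m := by rw [← map_pow, hx]; simp
      rw [div_pow, this, ← hx, ← pow_mul, ← pow_mul, mul_comm c m]
      field_simp
    refine ⟨(Units.mk0 κ hκ0)⁻¹, ?_⟩
    rw [zpow_sub, zpow_natCast, zpow_one, inv_pow]
    nth_rewrite 2 [← hmul]
    rw [mul_inv, mul_inv_cancel_left]
  obtain ⟨g0, hg0⟩ := Int.subgroup_cyclic J
  set g := g0.natAbs with hg
  have hJ : ∀ j, j ∈ J ↔ (g : ℤ) ∣ j := by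
    intro j
    rw [hg0, AddSubgroup.mem_closure_singleton, hg, Int.natAbs_dvd]
    constructor
    · rintro ⟨n, rfl⟩; exact ⟨n, by simp [mul_comm]⟩
    · rintro ⟨n, rfl⟩; exact ⟨n, by simp [mul_comm]⟩
  have hgm : g ∣ m := by exact_mod_cast (hJ _).1 hJm
  obtain ⟨d, hd⟩ := hgm
  have hg1 : g ≠ 0 := by rintro h0; rw [h0] at hd; omega
  have hζd : IsPrimitiveRoot (ζ ^ d) g := hζ.pow hm (by rw [hd, mul_comm])
  have hfixd : ∀ σ : Gal(Ωc/K), σ (ζ ^ d) = ζ ^ d := by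
    intro σ
    obtain ⟨c, hσ⟩ := hc σ
    have h1 := (hJ _).1 (hJc σ c hσ)
    rw [map_pow, hσ, ← pow_mul, mul_comm, pow_mul]
    obtain ⟨k, hk⟩ := h1
    have h2 : (ζ ^ d) ^ (c : ℤ) = ζ ^ d := by
      have hζ0 : ζ ^ d ≠ 0 := pow_ne_zero _ (hζ.ne_zero hm.ne')
      rw [show (c : ℤ) = 1 + g * k by omega, zpow_add₀ hζ0, zpow_mul, zpow_one, zpow_natCast,
        hζd.pow_eq_one, one_zpow, mul_one]
    rwa [zpow_natCast] at h2
  obtain ⟨ξ, hξ⟩ := (InfiniteGalois.mem_range_algebraMap_iff_fixed _).2 hfixd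
  have hξp : IsPrimitiveRoot ξ g := by
    rw [← hξ] at hζd
    exact IsPrimitiveRoot.of_map_of_injective hζd (algebraMap K Ωc).injective
  have : NeZero g := ⟨hg1⟩
  have hT : g ∣ Units.torsionOrder K := NumberField.Units.dvd_torsionOrder_of_isPrimitiveRoot hξp
  have hTJ : ((Units.torsionOrder K : ℕ) : ℤ) ∈ J := (hJ _).2 (by exact_mod_cast hT)
  obtain ⟨b, hb⟩ := hTJ
  exact ⟨b, by exact_mod_cast hb⟩

end Descent

end TCS


namespace TCS

open NumberField Polynomial
open scoped NumberField

section Chevalley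

variable (K : Type*) [Field K] [NumberField K]

local notation "Ωc" => AlgebraicClosure K

lemma chev_step (m : ℕ) (hm : 0 < m) (l : List (𝓞 K)ˣ) (w : (𝓞 K)ˣ)
    (h : ∀ n : ℕ, 0 < n → ∃ u ∈ Subgroup.closure {u | u ∈ l}, (n : 𝓞 K) ∣ (w : 𝓞 K) - u) :
    ∃ u ∈ Subgroup.closure {u | u ∈ l}, ∃ b : (𝓞 K)ˣ,
      (w * u⁻¹) ^ (Units.torsionOrder K) = b ^ m := by
  classical
  have : NeZero m := ⟨hm.ne'⟩
  have : NeZero (m : Ωc) := ⟨by exact_mod_cast hm.ne'⟩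
  obtain ⟨ζ, hζ⟩ := HasEnoughRootsOfUnity.exists_primitiveRoot (M := Ωc) m
  -- the map from units of `𝓞 K` to units of `Ωc`
  let ι : (𝓞 K)ˣ →* (Ωc)ˣ := Units.map ((algebraMap (𝓞 K) Ωc : 𝓞 K →+* Ωc) : 𝓞 K →* Ωc)
  have hι : ∀ u : (𝓞 K)ˣ, ((ι u : (Ωc)ˣ) : Ωc) = algebraMap K Ωc ((u : 𝓞 K) : K) := fun u ↦ rfl
  have hι' : ∀ (u : (𝓞 K)ˣ) (σ : Gal(Ωc/K)), σ ((ι u : (Ωc)ˣ) : Ωc) = ι u := by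
    intro u σ; rw [hι]; simp
  have hrt : ∀ u : (𝓞 K)ˣ, ∃ α : (Ωc)ˣ, α ^ m = ι u := by
    intro u
    obtain ⟨z, hz⟩ := IsAlgClosed.exists_pow_nat_eq ((ι u : (Ωc)ˣ) : Ωc) hm
    have hz0 : z ≠ 0 := by
      rintro rfl
      rw [zero_pow hm.ne'] at hz
      exact (ι u).ne_zero hz.symm
    exact ⟨Units.mk0 z hz0, Units.ext (by simpa using hz)⟩
  choose rt hrt using hrt
  let l' : List (Ωc)ˣ := l.map rt
  let S : Set Ωc := insert ζ {x | ∃ α ∈ l', x = ((α : (Ωc)ˣ) : Ωc)}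
  have hSfin : S.Finite := by
    apply Set.Finite.insert
    refine ((List.finite_toSet l').image (fun α : (Ωc)ˣ ↦ (α : Ωc))).subset ?_
    rintro _ ⟨α, hα, rfl⟩
    exact ⟨α, hα, rfl⟩
  let L : IntermediateField K Ωc := IntermediateField.adjoin K S
  have hSL : S ⊆ L := IntermediateField.subset_adjoin K S
  have : Finite S := hSfin
  have : FiniteDimensional K L := IntermediateField.finiteDimensional_adjoin
    (fun x _ ↦ Algebra.IsIntegral.isIntegral x)
  have : NumberField L := NumberField.of_module_finite K L
  let ζL : L := ⟨ζ, hSL (Set.mem_insert _ _)⟩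
  have hζL : IsPrimitiveRoot ζL m :=
    IsPrimitiveRoot.of_map_of_injective (f := algebraMap L Ωc) hζ (algebraMap L Ωc).injective
  -- every element of the closure is an `m`-th power in `𝓞 L`
  have hpow : ∀ u ∈ Subgroup.closure {u | u ∈ l}, ∃ z : (𝓞 L)ˣ,
      z ^ m = Units.map ((algebraMap (𝓞 K) (𝓞 L) : 𝓞 K →+* 𝓞 L) : 𝓞 K →* 𝓞 L) u := by
    intro u hu
    induction hu using Subgroup.closure_induction with
    | mem u h =>
      have hmemL : ((rt u : (Ωc)ˣ) : Ωc) ∈ L :=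
        hSL (Set.mem_insert_of_mem _ ⟨rt u, List.mem_map.2 ⟨u, h, rfl⟩, rfl⟩)
      have hαm : (⟨_, hmemL⟩ : L) ^ m = algebraMap K L ((u : 𝓞 K) : K) := by
        apply (algebraMap L Ωc).injective
        have := congrArg Units.val (hrt u)
        rw [Units.val_pow_eq_pow_val] at this
        exact this
      have hαi : IsIntegral ℤ (⟨_, hmemL⟩ : L) := by
        apply IsIntegral.of_pow hm
        rw [hαm]
        exact ((u : 𝓞 K).isIntegral_coe).algebraMap
      set b : 𝓞 L := ⟨_, hαi⟩
      have hbm : b ^ m = algebraMap (𝓞 K) (𝓞 L) u := by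
        apply RingOfIntegers.ext
        exact hαm
      have hbu : IsUnit b := by
        have : IsUnit (b ^ m) := by rw [hbm]; exact (u.isUnit).map _
        exact (isUnit_pow_iff hm.ne').1 this
      obtain ⟨v, hv⟩ := hbu
      refine ⟨v, Units.ext ?_⟩
      rw [Units.val_pow_eq_pow_val, hv, hbm]
      rfl
    | one => exact ⟨1, by simp⟩
    | mul x y _ _ hx hy =>
      obtain ⟨z1, h1⟩ := hx
      obtain ⟨z2, h2⟩ := hy
      exact ⟨z1 * z2, by rw [mul_pow, h1, h2, map_mul]⟩
    | inv x _ hx =>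
      obtain ⟨z1, h1⟩ := hx
      exact ⟨z1⁻¹, by rw [inv_pow, h1, map_inv]⟩
  let y : (𝓞 L)ˣ := Units.map ((algebraMap (𝓞 K) (𝓞 L) : 𝓞 K →+* 𝓞 L) : 𝓞 K →* 𝓞 L) w
  obtain ⟨z, hz⟩ := kummer_local_global L m hm ζL hζL y (by
    intro P hP hP0 _
    have hN : 0 < Ideal.absNorm P := Nat.pos_of_ne_zero (by
      rwa [Ne, Ideal.absNorm_eq_zero_iff])
    obtain ⟨u, hu, c, hc⟩ := h (Ideal.absNorm P) hN
    obtain ⟨z, hz⟩ := hpow u hu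
    refine ⟨z, ?_⟩
    have h1 := congrArg Units.val hz
    rw [Units.val_pow_eq_pow_val] at h1
    rw [h1]
    show algebraMap (𝓞 K) (𝓞 L) w - algebraMap (𝓞 K) (𝓞 L) u ∈ P
    rw [← map_sub, hc, map_mul, map_natCast]
    exact P.mul_mem_right _ (Ideal.absNorm_mem P))
  -- move to `Ωc`
  have hzm : ((z : L) : Ωc) ^ m = ι w := by
    have := congrArg (algebraMap L Ωc) hz
    rw [map_pow] at this
    exact this
  have hz0 : ((z : L) : Ωc) ≠ 0 := by
    intro h0
    rw [h0, zero_pow hm.ne'] at hzm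
    exact (ι w).ne_zero hzm.symm
  obtain ⟨p, hp, hfix⟩ := kummer_descent1 K hm hζ l' (by
      intro α hα σ
      obtain ⟨u, -, rfl⟩ := List.mem_map.1 hα
      have := congrArg Units.val (hrt u)
      rw [Units.val_pow_eq_pow_val] at this
      rw [this, hι']) (Units.mk0 _ hz0) (by
      intro σ
      rw [Units.val_mk0, hzm, hι']) (by
      intro σ hσ hα
      rw [Units.val_mk0]
      have hle : L ≤ IntermediateField.fixedField (Subgroup.zpowers σ) := by
        rw [IntermediateField.adjoin_le_iff]
        intro x hx
        have hσx : σ x = x := by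
          rcases hx with rfl | ⟨α, h1, rfl⟩
          · exact hσ
          · exact hα α h1
        rw [SetLike.mem_coe, IntermediateField.mem_fixedField_iff]
        intro τ hτ
        have : Subgroup.zpowers σ ≤ MulAction.stabilizer Gal(Ωc/K) x := by
          rw [Subgroup.zpowers_le]; exact hσx
        exact this hτ
      have := hle z.2
      rw [IntermediateField.mem_fixedField_iff] at this
      exact this σ (Subgroup.mem_zpowers σ))
  have hpU : ∀ p ∈ Subgroup.closure {α | α ∈ l'}, ∃ u ∈ Subgroup.closure {u | u ∈ l},
      p ^ m = ι u := by
    intro p hp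
    induction hp using Subgroup.closure_induction with
    | mem α h =>
      obtain ⟨u, h1, rfl⟩ := List.mem_map.1 h
      exact ⟨u, Subgroup.subset_closure h1, hrt u⟩
    | one => exact ⟨1, one_mem _, by simp⟩
    | mul x y _ _ hx hy =>
      obtain ⟨z1, h0, h1⟩ := hx
      obtain ⟨z2, h0', h2⟩ := hy
      exact ⟨z1 * z2, mul_mem h0 h0', by rw [mul_pow, h1, h2, map_mul]⟩
    | inv x _ hx =>
      obtain ⟨z1, h0, h1⟩ := hx
      exact ⟨z1⁻¹, inv_mem h0, by rw [inv_pow, h1, map_inv]⟩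
  obtain ⟨u, hu, hpu⟩ := hpU p hp
  let κ : (𝓞 K)ˣ →* Kˣ := Units.map ((algebraMap (𝓞 K) K : 𝓞 K →+* K) : 𝓞 K →* K)
  have hκinj : Function.Injective κ := Units.map_injective RingOfIntegers.coe_injective
  obtain ⟨b, hb⟩ := kummer_descent2 K hm hζ (κ (w * u⁻¹)) (Units.mk0 _ hz0 * p⁻¹) (by
    rw [← Units.val_pow_eq_pow_val, mul_pow, inv_pow, hpu,
      show (Units.mk0 _ hz0 : (Ωc)ˣ) ^ m = ι w from Units.ext (by simpa using hzm), ← map_inv,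
      ← map_mul]
    rfl) hfix
  have hbi : IsIntegral ℤ (b : K) := by
    apply IsIntegral.of_pow hm
    rw [← Units.val_pow_eq_pow_val, ← hb, ← map_pow]
    exact RingOfIntegers.isIntegral_coe _
  set b0 : 𝓞 K := ⟨b, hbi⟩
  have hb0 : b0 ^ m = (((w * u⁻¹) ^ (Units.torsionOrder K) : (𝓞 K)ˣ) : 𝓞 K) := by
    apply RingOfIntegers.ext
    have := congrArg Units.val hb.symm
    rw [Units.val_pow_eq_pow_val, ← map_pow] at this
    exact this
  have hb0u : IsUnit b0 := by
    have : IsUnit (b0 ^ m) := by rw [hb0]; exact Units.isUnit _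
    exact (isUnit_pow_iff hm.ne').1 this
  obtain ⟨v, hv⟩ := hb0u
  refine ⟨u, hu, v, Units.ext ?_⟩
  rw [← hb0, Units.val_pow_eq_pow_val, hv]

lemma exists_not_dvd (a : 𝓞 K) (ha : a ≠ 0) : ∃ n : ℕ, 0 < n ∧ ¬ (n : 𝓞 K) ∣ a := by
  by_contra! H
  apply ha
  refine fg_div a fun m hm ↦ ?_
  obtain ⟨c, hc⟩ := H m hm
  exact ⟨c, by rw [hc, nsmul_eq_mul]⟩

/-- Chevalley's theorem on units, in the form: subgroups of the unit group are closed in the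
congruence topology. -/
theorem chevalley (U : Subgroup (𝓞 K)ˣ) (w : (𝓞 K)ˣ)
    (h : ∀ n : ℕ, 0 < n → ∃ u ∈ U, (n : 𝓞 K) ∣ (w : 𝓞 K) - u) : w ∈ U := by
  classical
  -- choose `n0`
  obtain ⟨n0, hn0, htors⟩ : ∃ n0 : ℕ, 0 < n0 ∧ ∀ ζ : (𝓞 K)ˣ, ζ ^ (Units.torsionOrder K) = 1 →
      (n0 : 𝓞 K) ∣ (ζ : 𝓞 K) - 1 → ζ = 1 := by
    have h1 : ∀ ζ : (𝓞 K)ˣ, ∃ n : ℕ, 0 < n ∧ (ζ ≠ 1 → ¬ (n : 𝓞 K) ∣ (ζ : 𝓞 K) - 1) := by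
      intro ζ
      by_cases hζ : ζ = 1
      · exact ⟨1, one_pos, fun h ↦ absurd hζ h⟩
      · obtain ⟨n, hn, hd⟩ := exists_not_dvd K ((ζ : 𝓞 K) - 1) (by
          rw [sub_ne_zero]; intro h; exact hζ (Units.ext h))
        exact ⟨n, hn, fun _ ↦ hd⟩
    choose n hn hd using h1
    have : NeZero (Units.torsionOrder K) := ⟨Units.torsionOrder_ne_zero K⟩
    have hfin : Set.Finite {ζ : (𝓞 K)ˣ | ζ ^ (Units.torsionOrder K) = 1} :=
      @Set.toFinite _ (rootsOfUnity (Units.torsionOrder K) (𝓞 K) : Set (𝓞 K)ˣ)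
        (inferInstanceAs (Finite (rootsOfUnity (Units.torsionOrder K) (𝓞 K))))
    refine ⟨∏ ζ ∈ hfin.toFinset, n ζ, Finset.prod_pos fun ζ _ ↦ hn ζ, ?_⟩
    intro ζ hζ hdvd
    by_contra hne
    refine hd ζ hne (dvd_trans ?_ hdvd)
    have : n ζ ∣ ∏ ζ ∈ hfin.toFinset, n ζ := Finset.dvd_prod_of_mem n (by simpa using hζ)
    exact_mod_cast Nat.cast_dvd_cast this
  -- congruence subgroup
  have hcong : ∀ (n : ℕ) (a b c : (𝓞 K)ˣ), (n : 𝓞 K) ∣ (a : 𝓞 K) - b →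
      (n : 𝓞 K) ∣ ((a * c : (𝓞 K)ˣ) : 𝓞 K) - ((b * c : (𝓞 K)ˣ) : 𝓞 K) := by
    intro n a b c hd
    rw [Units.val_mul, Units.val_mul, ← sub_mul]
    exact Dvd.dvd.mul_right hd _
  let E0 : Subgroup (𝓞 K)ˣ :=
    { carrier := {u | (n0 : 𝓞 K) ∣ (u : 𝓞 K) - ((1 : (𝓞 K)ˣ) : 𝓞 K)}
      mul_mem' := by
        intro a b ha hb
        have h1 := hcong n0 a 1 b ha
        rw [one_mul] at h1
        have h2 := dvd_add h1 hb
        rwa [sub_add_sub_cancel] at h2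
      one_mem' := by simp
      inv_mem' := by
        intro a ha
        have h1 := hcong n0 a 1 a⁻¹ ha
        rw [one_mul, mul_inv_cancel] at h1
        rw [← dvd_neg, neg_sub] at h1
        exact h1 }
  obtain ⟨u0, hu0, hw0⟩ := h n0 hn0
  set w' := w * u0⁻¹ with hw'
  have hw'E : w' ∈ E0 := by
    have := hcong n0 w u0 u0⁻¹ hw0
    rwa [mul_inv_cancel] at this
  let U' := U ⊓ E0
  have h' : ∀ n : ℕ, 0 < n → ∃ u ∈ U', (n : 𝓞 K) ∣ (w' : 𝓞 K) - u := by
    intro n hn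
    obtain ⟨u, hu, hd⟩ := h (n * n0) (by positivity)
    have hd1 := hcong _ w u u0⁻¹ hd
    rw [Nat.cast_mul] at hd1
    refine ⟨u * u0⁻¹, ⟨U.mul_mem hu (U.inv_mem hu0), ?_⟩, (Dvd.intro _ rfl).trans hd1⟩
    have h2 : (n0 : 𝓞 K) ∣ ((w * u0⁻¹ : (𝓞 K)ˣ) : 𝓞 K) - ((u * u0⁻¹ : (𝓞 K)ˣ) : 𝓞 K) :=
      (Dvd.intro_left _ rfl).trans hd1
    have h3 := dvd_sub hw'E h2
    rw [hw', sub_sub_sub_cancel_left, ← dvd_neg, neg_sub] at h3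
    show (n0 : 𝓞 K) ∣ ((u * u0⁻¹ : (𝓞 K)ˣ) : 𝓞 K) - ((1 : (𝓞 K)ˣ) : 𝓞 K)
    rw [← dvd_neg, neg_sub]
    exact h3
  -- finite generation
  have hfg : U'.FG := by
    have : IsNoetherian ℤ (Additive (𝓞 K)ˣ) := isNoetherian_of_isNoetherianRing_of_finite _ _
    rw [Subgroup.fg_iff_add_fg]
    have h1 := this.noetherian (AddSubgroup.toIntSubmodule (Subgroup.toAddSubgroup U'))
    rw [Submodule.fg_iff_addSubgroup_fg] at h1
    exact h1
  obtain ⟨S, hS⟩ := hfg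
  have hS' : Subgroup.closure {u | u ∈ S.toList} = U' := by
    rw [← hS]; congr 1; ext; simp
  have key : ∀ m : ℕ, 0 < m → ∃ u ∈ U', ∃ b : (𝓞 K)ˣ,
      (w' * u⁻¹) ^ (Units.torsionOrder K) = b ^ m := by
    intro m hm
    have := chev_step K m hm S.toList w' (by rw [hS']; exact h')
    rwa [hS'] at this
  -- divisibility in the quotient
  set T := Units.torsionOrder K
  let V : Subgroup (𝓞 K)ˣ := U'.map (powMonoidHom T)
  have hwV : w' ^ T ∈ V := by
    let A := Additive (𝓞 K)ˣ ⧸ (AddSubgroup.toIntSubmodule (Subgroup.toAddSubgroup V))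
    let mkA : Additive (𝓞 K)ˣ →ₗ[ℤ] A := Submodule.mkQ _
    have hz : mkA (Additive.ofMul (w' ^ T)) = 0 := by
      refine fg_div _ fun m hm ↦ ?_
      obtain ⟨u, hu, b, hb⟩ := key m hm
      refine ⟨mkA (Additive.ofMul b), ?_⟩
      rw [← map_nsmul, ← sub_eq_zero, ← map_sub]
      rw [← LinearMap.mem_ker, Submodule.ker_mkQ]
      show w' ^ T / b ^ m ∈ V
      refine ⟨u, hu, ?_⟩
      rw [powMonoidHom_apply, div_eq_mul_inv, ← hb, mul_pow w', inv_pow, mul_inv, inv_inv,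
        mul_inv_cancel_left]
    rw [← LinearMap.mem_ker, Submodule.ker_mkQ] at hz
    exact hz
  obtain ⟨v, hv, hvw⟩ := hwV
  have hv1 : w' * v⁻¹ = 1 := by
    apply htors
    · rw [mul_pow, inv_pow, ← hvw]; simp
    · exact E0.mul_mem hw'E (inv_mem hv.2)
  have : w = v * u0 := by
    rw [mul_inv_eq_one] at hv1
    rw [← hv1, hw']; simp
  rw [this]
  exact mul_mem hv.1 hu0

end Chevalley

end TCS


namespace TCS

section FiniteIndexHelpers

lemma finiteIndex_of_map {Γ : Type*} [Group Γ] (Z : Subgroup Γ) {X : Type*} [Finite X] (f : Γ → X)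
    (h : ∀ a b, f a = f b → a⁻¹ * b ∈ Z) : Z.FiniteIndex := by
  have : Finite (Γ ⧸ Z) := by
    refine Finite.of_injective (fun q : Γ ⧸ Z ↦ f q.out) ?_
    intro q q' hq
    have := h _ _ hq
    rw [← QuotientGroup.eq] at this
    simpa using this
  exact Subgroup.finiteIndex_of_finite_quotient

lemma finiteIndex_map_subtype {Γ : Type*} [Group Γ] (M : Subgroup Γ) [hM : M.FiniteIndex]
    (N : Subgroup M) (hN : N.FiniteIndex) : (N.map M.subtype).FiniteIndex := by
  constructor
  rw [Subgroup.index_map_subtype]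
  exact mul_ne_zero hN.index_ne_zero hM.index_ne_zero

end FiniteIndexHelpers

section FieldOf

universe v

lemma numberField_of_domain (R : Type*) [CommRing R] [IsDomain R] [Algebra ℚ R]
    [hfin : Module.Finite ℚ R] :
    ∃ (F : Field R) (_ : F.toCommRing = ‹CommRing R›), @NumberField R F := by
  have hart : IsArtinianRing R := IsArtinianRing.of_finite ℚ R
  have hf : IsField R := IsArtinianRing.isField_of_isDomain R
  have hcz : CharZero R := algebraRat.charZero R
  let F : Field R := { ‹CommRing R›, hf.toField with }
  refine ⟨F, rfl, ?_⟩
  have h1 : @CharZero R (@AddGroupWithOne.toAddMonoidWithOne R (@Ring.toAddGroupWithOne R (@DivisionRing.toRing R F.toDivisionRing))) := hcz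
  refine @NumberField.mk R F h1 ?_
  convert hfin
  · rfl
  · exact Subsingleton.elim _ _

lemma jac_le (R : Type*) [CommRing R] [Algebra ℚ R] [Module.Finite ℚ R] (x : R)
    (hx : ∀ h : R →ₐ[ℚ] AlgebraicClosure ℚ, h x = 0) : x ∈ Ideal.jacobson (⊥ : Ideal R) := by
  rw [Ideal.jacobson, Ideal.mem_sInf]
  rintro M ⟨-, hM⟩
  have : Module.Finite ℚ (R ⧸ M) := inferInstance
  let l : (R ⧸ M) →ₐ[ℚ] AlgebraicClosure ℚ := IsAlgClosed.lift
  have h2 : l (Ideal.Quotient.mkₐ ℚ M x) = 0 := hx (l.comp (Ideal.Quotient.mkₐ ℚ M))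
  have hinj : Function.Injective l := by
    letI : Field (R ⧸ M) := Ideal.Quotient.field M
    exact l.toRingHom.injective
  rw [map_eq_zero_iff l hinj] at h2
  exact Ideal.Quotient.eq_zero_iff_mem.1 h2

variable {V : Type v} [AddCommGroup V] [Module ℚ V]

lemma exists_commRing [FiniteDimensional ℚ V] (T : Set (Module.End ℚ V))
    (hT : ∀ x ∈ T, ∀ y ∈ T, x * y = y * x) :
    ∃ (R : Type v) (_ : CommRing R) (_ : Algebra ℚ R) (_ : Module.Finite ℚ R)
      (j : R →ₐ[ℚ] Module.End ℚ V), Function.Injective j ∧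
      ∀ x, x ∈ Set.range j ↔ x ∈ Algebra.adjoin ℚ T := by
  refine ⟨Algebra.adjoin ℚ T, Algebra.adjoinCommRingOfComm ℚ hT, inferInstance, inferInstance,
    (Algebra.adjoin ℚ T).val, Subtype.val_injective, ?_⟩
  intro x
  constructor
  · rintro ⟨y, rfl⟩
    exact y.2
  · intro hx
    exact ⟨⟨x, hx⟩, rfl⟩

lemma field_of_comm [FiniteDimensional ℚ V] [Nontrivial V]
    (T : Set (Module.End ℚ V)) (hT : ∀ x ∈ T, ∀ y ∈ T, x * y = y * x)
    (hker : ∀ r ∈ Algebra.adjoin ℚ T, LinearMap.ker r = ⊥ ∨ LinearMap.ker r = ⊤) :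
    ∃ (K : Type v) (_ : Field K) (_ : NumberField K) (j : K →+* Module.End ℚ V),
      ∀ x, x ∈ Set.range j ↔ x ∈ Algebra.adjoin ℚ T := by
  obtain ⟨R, _, _, _, j, hj, hr⟩ := exists_commRing T hT
  have hnt : Nontrivial R := j.toRingHom.domain_nontrivial
  have hnz : NoZeroDivisors R := by
    constructor
    intro a b hab
    rcases hker (j a) ((hr _).1 ⟨a, rfl⟩) with h | h
    · right
      have h1 : j a * j b = 0 := by rw [← map_mul, hab, map_zero]
      apply hj
      rw [map_zero]
      apply LinearMap.ext
      intro v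
      have h2 : j a (j b v) = 0 := LinearMap.congr_fun h1 v
      rw [← LinearMap.mem_ker, h, Submodule.mem_bot] at h2
      exact h2
    · left
      apply hj
      rw [map_zero]
      exact LinearMap.ker_eq_top.1 h
  have hdom : IsDomain R := NoZeroDivisors.to_isDomain R
  obtain ⟨F, h1, h2⟩ := numberField_of_domain R
  subst h1
  exact ⟨R, F, h2, j.toRingHom, hr⟩

end FieldOf

section VA

variable {V : Type*} [AddCommGroup V] [Module ℚ V]

/-- every finite index subgroup acts irreducibly -/
def SIrr {Γ : Type*} [Group Γ] (ρ : Γ →* Module.End ℚ V) : Prop :=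
  ∀ M : Subgroup Γ, M.FiniteIndex → ∀ W : Submodule ℚ V,
    (∀ g ∈ M, ∀ v ∈ W, ρ g v ∈ W) → W = ⊥ ∨ W = ⊤

lemma SIrr.restrict {Γ : Type*} [Group Γ] {ρ : Γ →* Module.End ℚ V} (h : SIrr ρ)
    (M : Subgroup Γ) (hM : M.FiniteIndex) : SIrr (ρ.comp M.subtype) := by
  intro N hN W hW
  refine h _ (finiteIndex_map_subtype M N hN) W ?_
  rintro _ ⟨g, hg, rfl⟩ v hv
  exact hW g hg v hv

/-- A normal commutative subgroup has a centralizer of finite index. -/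
lemma centralizer_finiteIndex [FiniteDimensional ℚ V] [Nontrivial V]
    {Γ : Type*} [Group Γ] (ρ : Γ →* Module.End ℚ V)
    (hinj : Function.Injective ρ) (hirr : SIrr ρ) (N : Subgroup Γ) [hNn : N.Normal]
    (hN : ∀ a ∈ N, ∀ b ∈ N, a * b = b * a) :
    (Subgroup.centralizer (N : Set Γ)).FiniteIndex := by
  classical
  have hcomm : ∀ x ∈ ρ '' N, ∀ y ∈ ρ '' N, x * y = y * x := by
    rintro _ ⟨a, ha, rfl⟩ _ ⟨b, hb, rfl⟩
    rw [← map_mul, hN a ha b hb, map_mul]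
  obtain ⟨R, _, _, _, j, hj, hr⟩ := exists_commRing _ hcomm
  have hρ1 : ∀ g : Γ, ρ g⁻¹ * ρ g = 1 := fun g ↦ by rw [← map_mul]; simp
  have hρ2 : ∀ g : Γ, ρ g * ρ g⁻¹ = 1 := fun g ↦ by rw [← map_mul]; simp
  let conj (g : Γ) : Module.End ℚ V →ₐ[ℚ] Module.End ℚ V :=
    { toFun := fun x ↦ ρ g * x * ρ g⁻¹
      map_one' := by simp [hρ2]
      map_mul' := by
        intro x y
        calc ρ g * (x * y) * ρ g⁻¹ = ρ g * x * 1 * y * ρ g⁻¹ := by noncomm_ring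
          _ = _ := by rw [← hρ1 g]; noncomm_ring
      map_zero' := by simp
      map_add' := by intro x y; noncomm_ring
      commutes' := by
        intro r
        rw [← Algebra.commutes, mul_assoc, hρ2, mul_one] }
  have hconjR : ∀ g, ∀ x ∈ Algebra.adjoin ℚ (ρ '' N), conj g x ∈ Algebra.adjoin ℚ (ρ '' N) := by
    intro g x hx
    induction hx using Algebra.adjoin_induction with
    | mem x hx =>
      obtain ⟨n, hn, rfl⟩ := hx
      apply Algebra.subset_adjoin
      exact ⟨g * n * g⁻¹, hNn.conj_mem n hn g, by simp [conj]⟩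
    | algebraMap r => rw [AlgHom.commutes]; exact Subalgebra.algebraMap_mem _ r
    | add x y _ _ hx hy => rw [map_add]; exact add_mem hx hy
    | mul x y _ _ hx hy => rw [map_mul]; exact mul_mem hx hy
  have hcj : ∀ g : Γ, ∃ f : R →ₐ[ℚ] R, ∀ x, j (f x) = ρ g * j x * ρ g⁻¹ := by
    intro g
    have h1 : ∀ x : R, (conj g) (j x) ∈ j.range := fun x ↦
      (hr _).2 (hconjR g _ ((hr _).1 ⟨x, rfl⟩))
    let e : R ≃ₐ[ℚ] j.range := AlgEquiv.ofInjective j hj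
    refine ⟨e.symm.toAlgHom.comp (((conj g).comp j).codRestrict j.range h1), ?_⟩
    intro x
    have h2 := congrArg Subtype.val (e.apply_symm_apply (⟨conj g (j x), h1 x⟩ : j.range))
    exact h2
  choose cj hcj using hcj
  letI : Module R V := Module.compHom V j.toRingHom
  have hsm : ∀ (r : R) (v : V), r • v = j r v := fun r v ↦ rfl
  have hst : IsScalarTower ℚ R V := ⟨by
    intro q r v
    rw [hsm, hsm, map_smul]; rfl⟩
  let Ω := AlgebraicClosure ℚ
  let J : Ideal R := ⨅ h : R →ₐ[ℚ] Ω, RingHom.ker h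
  have hJmem : ∀ x : R, x ∈ J ↔ ∀ h : R →ₐ[ℚ] Ω, h x = 0 := by
    intro x
    simp [J, RingHom.mem_ker]
  have hJjac : J ≤ Ideal.jacobson ⊥ := fun x hx ↦ jac_le R x ((hJmem x).1 hx)
  have hfgV : (⊤ : Submodule R V).FG := by
    have : Module.Finite R V := Module.Finite.of_restrictScalars_finite ℚ R V
    exact this.fg_top
  have hJbot : J = ⊥ := by
    -- the submodule `J V`
    let W : Submodule ℚ V := (J • (⊤ : Submodule R V)).restrictScalars ℚ
    have hWinv : ∀ g ∈ (⊤ : Subgroup Γ), ∀ v ∈ W, ρ g v ∈ W := by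
      intro g _ v hv
      have hv' : v ∈ J • (⊤ : Submodule R V) := hv
      show ρ g v ∈ J • (⊤ : Submodule R V)
      clear hv
      induction hv' using Submodule.smul_induction_on' with
      | smul r hr n _ =>
        have hh : ρ g (r • n) = (cj g r) • (ρ g n) := by
          rw [hsm, hsm, hcj]
          have : ρ g⁻¹ (ρ g n) = n := LinearMap.congr_fun (hρ1 g) n
          simp only [Module.End.mul_apply, this]
        rw [hh]
        refine Submodule.smul_mem_smul ?_ trivial
        rw [hJmem]
        intro h
        exact (hJmem r).1 hr (h.comp (cj g))
      | add x _ y _ hx hy =>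
        rw [map_add]
        exact add_mem hx hy
    rcases hirr ⊤ inferInstance W hWinv with h | h
    · rw [eq_bot_iff]
      intro r hr
      rw [Ideal.mem_bot]
      apply hj
      rw [map_zero]
      apply LinearMap.ext
      intro v
      have : (r • v : V) ∈ W :=
        (Submodule.smul_mem_smul hr trivial : r • v ∈ J • (⊤ : Submodule R V))
      rw [h, Submodule.mem_bot] at this
      exact this
    · exfalso
      have h1 : (⊤ : Submodule R V) ≤ J • ⊤ := by
        intro v _
        have : v ∈ W := by rw [h]; trivial
        exact this
      have h2 := Submodule.eq_bot_of_le_smul_of_le_jacobson_bot J ⊤ hfgV h1 hJjac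
      exact (bot_ne_top (α := Submodule R V)) h2.symm
  have hsep : ∀ x y : R, (∀ h : R →ₐ[ℚ] Ω, h x = h y) → x = y := by
    intro x y hxy
    rw [← sub_eq_zero, ← Ideal.mem_bot, ← hJbot, hJmem]
    intro h
    rw [map_sub, hxy, sub_self]
  refine finiteIndex_of_map _ (fun g ↦ fun h : R →ₐ[ℚ] Ω ↦ h.comp (cj g)) ?_
  intro a b hab
  rw [Subgroup.mem_centralizer_iff]
  intro n hn
  obtain ⟨x, hx⟩ := (hr (ρ n)).2 (Algebra.subset_adjoin ⟨n, hn, rfl⟩)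
  have h1 : cj a x = cj b x := hsep _ _ fun h ↦ DFunLike.congr_fun (congrFun hab h) x
  have h2 : ρ a * ρ n * ρ a⁻¹ = ρ b * ρ n * ρ b⁻¹ := by
    rw [← hx, ← hcj, ← hcj, h1]
  rw [← map_mul, ← map_mul, ← map_mul, ← map_mul] at h2
  have h3 := hinj h2
  calc n * (a⁻¹ * b) = a⁻¹ * (b * n * b⁻¹) * b := by rw [← h3]; group
    _ = a⁻¹ * b * n := by group

end VA

end TCS


namespace TCS

universe u v

/-- residual finiteness -/
def RF (Γ : Type*) [Group Γ] : Prop :=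
  ∀ g : Γ, g ≠ 1 → ∃ N : Subgroup Γ, N.FiniteIndex ∧ g ∉ N

lemma RF.subgroup {Γ : Type*} [Group Γ] (h : RF Γ) (Z : Subgroup Γ) : RF Z := by
  intro g hg
  obtain ⟨N, hN, hgN⟩ := h g (by simpa using hg)
  exact ⟨N.subgroupOf Z, inferInstance, by simpa [Subgroup.mem_subgroupOf] using hgN⟩

lemma RF.finite {Γ : Type*} [Group Γ] (h : RF Γ) (S : Set Γ) (hS : S.Finite) :
    ∃ N : Subgroup Γ, N.FiniteIndex ∧ ∀ s ∈ S, s ∈ N → s = 1 := by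
  classical
  have h' : ∀ g : Γ, ∃ N : Subgroup Γ, N.FiniteIndex ∧ (g ≠ 1 → g ∉ N) := by
    intro g
    by_cases hg : g = 1
    · exact ⟨⊤, inferInstance, fun h ↦ absurd hg h⟩
    · obtain ⟨N, h1, h2⟩ := h g hg
      exact ⟨N, h1, fun _ ↦ h2⟩
  choose N hN hgN using h'
  have := hS.to_subtype
  refine ⟨⨅ s : S, N s, Subgroup.finiteIndex_iInf (fun s ↦ hN s), ?_⟩
  intro s hs hsN
  by_contra hne
  exact hgN s hne ((Subgroup.mem_iInf.1 hsN) ⟨s, hs⟩)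

section

variable {V : Type v} [AddCommGroup V] [Module ℚ V] [FiniteDimensional ℚ V] [Nontrivial V]

lemma central_finite {Z : Type*} [Group Z] (ρ : Z →* Module.End ℚ V)
    (hinj : Function.Injective ρ) (hirr : SIrr ρ) (D : Subgroup Z)
    (hD : D ≤ commutator Z) (hcent : ∀ d ∈ D, ∀ z, d * z = z * d) :
    (D : Set Z).Finite := by
  classical
  have hcomm : ∀ x ∈ ρ '' D, ∀ y ∈ ρ '' D, x * y = y * x := by
    rintro _ ⟨a, ha, rfl⟩ _ ⟨b, hb, rfl⟩
    rw [← map_mul, hcent a ha b, map_mul]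
  have hRc : ∀ r ∈ Algebra.adjoin ℚ (ρ '' D), ∀ z, r * ρ z = ρ z * r := by
    intro r hr z
    induction hr using Algebra.adjoin_induction with
    | mem x hx =>
      obtain ⟨d, hd, rfl⟩ := hx
      rw [← map_mul, hcent d hd, map_mul]
    | algebraMap r => exact Algebra.commutes _ _
    | add x y _ _ hx hy => rw [add_mul, mul_add, hx, hy]
    | mul x y _ _ hx hy => rw [mul_assoc, hy, ← mul_assoc, hx, mul_assoc]
  obtain ⟨K, _, _, j, hj⟩ := field_of_comm (ρ '' D) hcomm (by
    intro r hr
    refine hirr ⊤ inferInstance _ ?_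
    intro g _ v hv
    rw [LinearMap.mem_ker] at hv ⊢
    have := LinearMap.congr_fun (hRc r hr g) v
    simp only [Module.End.mul_apply] at this
    rw [this, hv, map_zero])
  letI : Module K V := Module.compHom V j
  have hsm : ∀ (r : K) (v : V), r • v = j r v := fun r v ↦ rfl
  have hst : IsScalarTower ℚ K V := ⟨by
    intro q r v
    rw [hsm, hsm, map_rat_smul]; rfl⟩
  have hfin : Module.Finite K V := Module.Finite.of_restrictScalars_finite ℚ K V
  let L : Z →* Module.End K V :=
    { toFun := fun z ↦
        { toFun := ρ z
          map_add' := map_add _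
          map_smul' := by
            intro k v
            simp only [hsm, RingHom.id_apply]
            exact (LinearMap.congr_fun (hRc (j k) ((hj _).1 ⟨k, rfl⟩) z) v).symm }
      map_one' := by ext v; simp
      map_mul' := by intro a b; ext v; simp }
  have hLa : ∀ z v, L z v = ρ z v := fun z v ↦ rfl
  let dt : Z →* K := LinearMap.det.comp L
  have hdt : ∀ d ∈ D, dt d = 1 := by
    intro d hd
    have hle : commutator Z ≤ dt.ker := by
      rw [commutator_def, Subgroup.commutator_le]
      intro a _ b _
      rw [MonoidHom.mem_ker, commutatorElement_def, map_mul, map_mul, map_mul]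
      rw [mul_right_comm (dt a), ← map_mul, mul_inv_cancel, map_one, one_mul, ← map_mul,
        mul_inv_cancel, map_one]
    exact hle (hD hd)
  have hκ : ∀ d : D, ∃ κ : K, j κ = ρ d := fun d ↦
    (hj _).2 (Algebra.subset_adjoin ⟨d, d.2, rfl⟩)
  choose κ hκ using hκ
  have hpow : ∀ d : D, κ d ^ (Module.finrank K V) = 1 := by
    intro d
    have h1 : L d = κ d • (1 : Module.End K V) := by
      ext v
      rw [hLa, LinearMap.smul_apply, Module.End.one_apply, hsm, hκ]
    have h2 : LinearMap.det (L d) = 1 := hdt d d.2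
    rw [h1, LinearMap.det_smul, map_one, mul_one] at h2
    exact h2
  have hn : 0 < Module.finrank K V := Module.finrank_pos
  have hκinj : Function.Injective κ := by
    intro a b hab
    apply Subtype.ext
    apply hinj
    rw [← hκ, ← hκ, hab]
  have : Finite D := by
    refine Finite.of_injective (β := {x // x ∈ Polynomial.nthRootsFinset (Module.finrank K V) (1 : K)})
      (fun d ↦ ⟨κ d, (Polynomial.mem_nthRootsFinset hn _).2 (hpow d)⟩) ?_
    intro a b hab
    exact hκinj (congrArg Subtype.val hab)
  exact Set.toFinite _

theorem VA (d : ℕ) : ∀ (Γ : Type u) [Group Γ] (ρ : Γ →* Module.End ℚ V),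
    Function.Injective ρ → SIrr ρ → RF Γ → derivedSeries Γ d = ⊥ →
    ∃ M : Subgroup Γ, M.FiniteIndex ∧ ∀ a ∈ M, ∀ b ∈ M, a * b = b * a := by
  induction d with
  | zero =>
    intro Γ _ ρ _ _ _ h
    refine ⟨⊤, inferInstance, ?_⟩
    have : Subsingleton Γ := by
      rw [derivedSeries_zero] at h
      exact (Subgroup.subsingleton_iff).1 (subsingleton_of_bot_eq_top h.symm)
    intro a _ b _
    exact Subsingleton.elim _ _
  | succ d ih =>
    intro Γ _ ρ hinj hirr hRF h
    have hNc : ∀ a ∈ derivedSeries Γ d, ∀ b ∈ derivedSeries Γ d, a * b = b * a := by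
      intro a ha b hb
      have h1 := Subgroup.commutator_mem_commutator ha hb
      rw [← derivedSeries_succ] at h1
      rw [h, Subgroup.mem_bot] at h1
      exact commutatorElement_eq_one_iff_mul_comm.1 h1
    rcases d with _ | d
    · refine ⟨⊤, inferInstance, ?_⟩
      simpa using hNc
    set N := derivedSeries Γ (d + 1) with hNdef
    have hZ := centralizer_finiteIndex ρ hinj hirr N hNc
    set Z := Subgroup.centralizer (N : Set Γ)
    have hDN : ∀ x ∈ derivedSeries Z (d + 1), (x : Γ) ∈ N := by
      intro x hx
      exact map_derivedSeries_le_derivedSeries Z.subtype (d + 1) ⟨x, hx, rfl⟩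
    have hfin := central_finite (ρ.comp Z.subtype) (hinj.comp Subtype.val_injective)
      (hirr.restrict Z hZ) (derivedSeries Z (d + 1))
      (by rw [← derivedSeries_one]; exact derivedSeries_antitone Z (by omega)) (by
        intro x hx z
        apply Subtype.ext
        exact Subgroup.mem_centralizer_iff.1 z.2 x (hDN x hx))
    obtain ⟨N2, hN2, hN2D⟩ := (hRF.subgroup Z).finite _ hfin
    obtain ⟨M, hM, hMc⟩ := ih N2 ((ρ.comp Z.subtype).comp N2.subtype)
      ((hinj.comp Subtype.val_injective).comp Subtype.val_injective)
      ((hirr.restrict Z hZ).restrict N2 hN2) ((hRF.subgroup Z).subgroup N2) (by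
        rw [eq_bot_iff]
        intro x hx
        rw [Subgroup.mem_bot]
        apply Subtype.ext
        exact hN2D x (map_derivedSeries_le_derivedSeries N2.subtype (d + 1) ⟨x, hx, rfl⟩) x.2)
    refine ⟨(M.map N2.subtype).map Z.subtype,
      finiteIndex_map_subtype Z _ (finiteIndex_map_subtype N2 _ hM), ?_⟩
    rintro _ ⟨_, ⟨a, ha, rfl⟩, rfl⟩ _ ⟨_, ⟨b, hb, rfl⟩, rfl⟩
    have := hMc a ha b hb
    simp only [← map_mul, this]

end

end TCS


namespace TCS

universe v

open NumberField

lemma uniform_mult {A : Type*} [AddCommGroup A] [Module.Finite ℤ A] (S : AddSubgroup A)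
    (h : ∀ b : A, ∃ k : ℕ, 0 < k ∧ k • b ∈ S) : ∃ k : ℕ, 0 < k ∧ ∀ b : A, k • b ∈ S := by
  classical
  obtain ⟨s, hs⟩ := (Module.Finite.fg_top : (⊤ : Submodule ℤ A).FG)
  choose k hk hkS using h
  refine ⟨∏ x ∈ s, k x, Finset.prod_pos fun x _ ↦ hk x, ?_⟩
  intro b
  have hb : b ∈ Submodule.span ℤ (s : Set A) := by rw [hs]; trivial
  induction hb using Submodule.span_induction with
  | mem x hx =>
    obtain ⟨m, hm⟩ := Finset.dvd_prod_of_mem k (show x ∈ s from hx)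
    rw [hm, mul_comm, mul_nsmul']
    exact S.nsmul_mem (hkS x) m
  | zero => simp
  | add x y _ _ hx hy => rw [nsmul_add]; exact S.add_mem hx hy
  | smul z x _ hx => rw [smul_comm]; exact S.zsmul_mem hx z

section

variable {C : Type*} [Group C] {A : Type*} [AddCommGroup A] [Module.Finite ℤ A]
  {V : Type v} [AddCommGroup V] [Module ℚ V] [FiniteDimensional ℚ V]

theorem abelian_closed (ι : A →+ V) (hι : Function.Injective ι)
    (ρ : C →* Module.End ℤ A) (ρV : C →* Module.End ℚ V)
    (hρ : ∀ c a, ρV c (ι a) = ι (ρ c a))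
    (hcomm : ∀ c d, ρV c * ρV d = ρV d * ρV c)
    (hirr : ∀ W : Submodule ℚ V, (∀ c, ∀ v ∈ W, ρV c v ∈ W) → W = ⊥ ∨ W = ⊤)
    (δ : C → A) (hδ : ∀ c d, δ (c * d) = δ c + ρ c (δ d)) (a : A)
    (ha : ∀ n : ℕ, 0 < n → ∃ c b, a - δ c = n • b) : ∃ c, δ c = a := by
  classical
  have hδ1 : δ 1 = 0 := by
    have := hδ 1 1
    simpa using this
  have hδinv : ∀ c, ρ c (δ c⁻¹) = - δ c := by
    intro c
    have := hδ c c⁻¹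
    rw [mul_inv_cancel, hδ1] at this
    exact (neg_eq_of_add_eq_zero_right this.symm).symm
  have hρinj : ∀ c, ρV c = 1 → ρ c = 1 := by
    intro c hc
    ext b
    apply hι
    rw [← hρ, hc]; rfl
  -- trivial `δ`
  have htriv : (∀ c, δ c = 0) → ∃ c, δ c = a := by
    intro h0
    refine ⟨1, ?_⟩
    rw [hδ1]
    symm
    refine fg_div a fun m hm ↦ ?_
    obtain ⟨c, b, hb⟩ := ha m hm
    exact ⟨b, by rw [← hb, h0, sub_zero]⟩
  by_cases hE : ∃ e, ρ e = 1 ∧ δ e ≠ 0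
  · -- the image of the kernel
    let S : AddSubgroup A :=
      { carrier := {b | ∃ e, ρ e = 1 ∧ δ e = b}
        zero_mem' := ⟨1, map_one _, hδ1⟩
        add_mem' := by
          rintro _ _ ⟨e, he, rfl⟩ ⟨f, hf, rfl⟩
          exact ⟨e * f, by rw [map_mul, he, hf, one_mul], by rw [hδ, he]; rfl⟩
        neg_mem' := by
          rintro _ ⟨e, he, rfl⟩
          refine ⟨e⁻¹, ?_, ?_⟩
          · have : ρ (e * e⁻¹) = 1 := by rw [mul_inv_cancel, map_one]
            rwa [map_mul, he, one_mul] at this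
          · have := hδinv e
            rwa [he] at this }
    have hSinv : ∀ c, ∀ b ∈ S, ρ c b ∈ S := by
      rintro c _ ⟨e, he, rfl⟩
      refine ⟨c * e * c⁻¹, ?_, ?_⟩
      · rw [map_mul, map_mul, he, mul_one, ← map_mul, mul_inv_cancel, map_one]
      · rw [hδ, hδ, map_mul, he, mul_one, hδinv]
        abel
    let W : Submodule ℚ V := Submodule.span ℚ (ι '' S)
    have hW : W = ⊤ := by
      refine (hirr W ?_).resolve_left ?_
      · intro c v hv
        induction hv using Submodule.span_induction with
        | mem x hx =>
          obtain ⟨b, hb, rfl⟩ := hx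
          rw [hρ]
          exact Submodule.subset_span ⟨_, hSinv c b hb, rfl⟩
        | zero => rw [map_zero]; exact zero_mem _
        | add x y _ _ hx hy => rw [map_add]; exact add_mem hx hy
        | smul q x _ hx => rw [map_smul]; exact W.smul_mem q hx
      · intro hbot
        obtain ⟨e, he, hne⟩ := hE
        have : ι (δ e) ∈ W := Submodule.subset_span ⟨_, ⟨e, he, rfl⟩, rfl⟩
        rw [hbot, Submodule.mem_bot, map_eq_zero_iff ι hι] at this
        exact hne this
    have hWS : ∀ w ∈ W, ∃ k : ℕ, 0 < k ∧ ∃ s ∈ S, k • w = ι s := by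
      intro w hw
      induction hw using Submodule.span_induction with
      | mem x hx =>
        obtain ⟨b, hb, rfl⟩ := hx
        exact ⟨1, one_pos, b, hb, one_nsmul _⟩
      | zero => exact ⟨1, one_pos, 0, zero_mem _, by simp⟩
      | add x y _ _ hx hy =>
        obtain ⟨k, hk, s, hs, h1⟩ := hx
        obtain ⟨l, hl, t, ht, h2⟩ := hy
        refine ⟨k * l, by positivity, l • s + k • t,
          add_mem (S.nsmul_mem hs l) (S.nsmul_mem ht k), ?_⟩
        rw [map_add, map_nsmul, map_nsmul, ← h1, ← h2, nsmul_add, mul_nsmul, mul_nsmul']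
      | smul q x _ hx =>
        obtain ⟨k, hk, s, hs, h1⟩ := hx
        refine ⟨k * q.den, Nat.mul_pos hk q.den_pos, q.num • s, S.zsmul_mem hs _, ?_⟩
        rw [map_zsmul, ← h1, ← Nat.cast_smul_eq_nsmul ℚ, ← Nat.cast_smul_eq_nsmul ℚ,
          ← Int.cast_smul_eq_zsmul ℚ, smul_smul, smul_smul, Nat.cast_mul, mul_assoc,
          mul_comm (q.den : ℚ), Rat.mul_den_eq_num, mul_comm]
    obtain ⟨k, hk, hkS⟩ := uniform_mult S (by
      intro b
      obtain ⟨k, hk, s, hs, h1⟩ := hWS (ι b) (by rw [hW]; trivial)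
      rw [← map_nsmul] at h1
      exact ⟨k, hk, by rwa [hι h1]⟩)
    obtain ⟨c, b, hb⟩ := ha k hk
    obtain ⟨e, he, heb⟩ := hkS b
    refine ⟨e * c, ?_⟩
    rw [hδ, he, heb, ← hb]
    simp
  · push Not at hE
    by_cases hc0 : ∀ c, ρ c = 1
    · exact htriv fun c ↦ hE c (hc0 c)
    push Not at hc0
    obtain ⟨c0, hc0⟩ := hc0
    have hAnt : Nontrivial A := by
      by_contra hA
      rw [not_nontrivial_iff_subsingleton] at hA
      exact hc0 (Subsingleton.elim _ _)
    have hVnt : Nontrivial V := hι.nontrivial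
    have hRc : ∀ r ∈ Algebra.adjoin ℚ (Set.range ρV), ∀ z, r * ρV z = ρV z * r := by
      intro r hr z
      induction hr using Algebra.adjoin_induction with
      | mem x hx =>
        obtain ⟨d, rfl⟩ := hx
        exact hcomm _ _
      | algebraMap r => exact Algebra.commutes _ _
      | add x y _ _ hx hy => rw [add_mul, mul_add, hx, hy]
      | mul x y _ _ hx hy => rw [mul_assoc, hy, ← mul_assoc, hx, mul_assoc]
    obtain ⟨K, _, _, j, hj⟩ := field_of_comm (Set.range ρV) (by
      rintro _ ⟨c, rfl⟩ _ ⟨d, rfl⟩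
      exact hcomm c d) (by
      intro r hr
      refine hirr _ ?_
      intro g v hv
      rw [LinearMap.mem_ker] at hv ⊢
      have := LinearMap.congr_fun (hRc r hr g) v
      simp only [Module.End.mul_apply] at this
      rw [this, hv, map_zero])
    have hjinj : Function.Injective j := j.injective
    have hσ : ∀ c, ∃ x : K, j x = ρV c := fun c ↦ (hj _).2 (Algebra.subset_adjoin ⟨c, rfl⟩)
    choose σ hσ using hσ
    have hσmul : ∀ c d, σ (c * d) = σ c * σ d := by
      intro c d
      apply hjinj
      rw [map_mul, hσ, hσ, hσ, map_mul]
    have hσ1 : σ 1 = 1 := by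
      apply hjinj
      rw [hσ, map_one, map_one]
    set s : K := σ c0 - 1 with hs
    have hs0 : s ≠ 0 := by
      intro h
      apply hc0
      apply hρinj
      rw [← hσ, sub_eq_zero.1 h, map_one]
    set v : V := j s⁻¹ (ι (δ c0)) with hv
    have hjj : ∀ x y w, j x (j y w) = j (x * y) w := by
      intro x y w
      rw [map_mul]; rfl
    have hδv : ∀ c, ι (δ c) = j (σ c - 1) v := by
      intro c
      have h1 : δ (c * c0) = δ (c0 * c) := by
        have h2 : c * c0 = c0 * c * ((c0 * c)⁻¹ * (c * c0)) := by group
        have h3 : ρ ((c0 * c)⁻¹ * (c * c0)) = 1 := by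
          apply hρinj
          rw [← hσ, hσmul, hσmul c, mul_comm (σ c), ← hσmul c0, ← hσmul, inv_mul_cancel, hσ1,
            map_one]
        rw [h2, hδ, hE _ h3, map_zero, add_zero]
      rw [hδ, hδ] at h1
      have h4 := congrArg ι h1
      rw [map_add, map_add, ← hρ, ← hρ, ← hσ, ← hσ] at h4
      have h5 : j s (ι (δ c)) = j (σ c - 1) (ι (δ c0)) := by
        simp only [hs, map_sub, map_one, LinearMap.sub_apply, Module.End.one_apply]
        rw [sub_eq_sub_iff_add_eq_add, add_comm, ← h4, add_comm]
      have h6 := congrArg (j s⁻¹) h5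
      rw [hjj, hjj, inv_mul_cancel₀ hs0, map_one, Module.End.one_apply, mul_comm, ← hjj] at h6
      exact h6
    by_cases hv0 : v = 0
    · refine htriv fun c ↦ ?_
      have := hδv c
      rw [hv0, map_zero, map_eq_zero_iff ι hι] at this
      exact this
    have hjv : ∀ x, j x v = 0 → x = 0 := by
      intro x hx
      by_contra hx0
      have := congrArg (j x⁻¹) hx
      rw [hjj, inv_mul_cancel₀ hx0, map_one, map_zero] at this
      exact hv0 this
    have hjv' : ∀ x y, j x v = j y v → x = y := by
      intro x y hxy
      rw [← sub_eq_zero]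
      apply hjv
      rw [map_sub, LinearMap.sub_apply, hxy, sub_self]
    have hsurj : ∀ x : V, ∃ k, j k v = x := by
      let W : Submodule ℚ V :=
        { carrier := {x | ∃ k, j k v = x}
          zero_mem' := ⟨0, by simp⟩
          add_mem' := by
            rintro _ _ ⟨k, rfl⟩ ⟨l, rfl⟩
            exact ⟨k + l, by rw [map_add]; rfl⟩
          smul_mem' := by
            rintro q _ ⟨k, rfl⟩
            exact ⟨q • k, by rw [map_rat_smul]; rfl⟩ }
      have hW : W = ⊤ := by
        refine (hirr W ?_).resolve_left ?_
        · rintro c _ ⟨k, rfl⟩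
          exact ⟨σ c * k, by rw [← hjj, hσ]⟩
        · intro hbot
          have : v ∈ W := ⟨1, by simp⟩
          rw [hbot, Submodule.mem_bot] at this
          exact hv0 this
      intro x
      have : x ∈ W := by rw [hW]; trivial
      exact this
    have hf : ∃ f : A →+ K, ∀ b, j (f b) v = ι b := by
      choose f hf using fun b ↦ hsurj (ι b)
      refine ⟨AddMonoidHom.mk' f ?_, hf⟩
      intro x y
      apply hjv'
      rw [map_add, LinearMap.add_apply, hf, hf, hf, map_add]
    obtain ⟨f, hf⟩ := hf
    have hfinj : Function.Injective f := by
      intro x y hxy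
      apply hι
      rw [← hf, ← hf, hxy]
    have hfδ : ∀ c, f (δ c) = σ c - 1 := by
      intro c
      apply hjv'
      rw [hf, hδv]
    have hfρ : ∀ c b, f (ρ c b) = σ c * f b := by
      intro c b
      apply hjv'
      rw [hf, ← hρ, ← hσ, ← hf, hjj]
    let NA : Submodule ℤ K := LinearMap.range f.toIntLinearMap
    have hNA : NA ≠ ⊥ := by
      obtain ⟨b, hb⟩ := exists_ne (0 : A)
      intro h
      have : f b ∈ NA := ⟨b, rfl⟩
      rw [h, Submodule.mem_bot, map_eq_zero_iff f hfinj] at this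
      exact hb this
    have hNAfg : NA.FG := by
      have := (Module.Finite.fg_top : (⊤ : Submodule ℤ A).FG).map f.toIntLinearMap
      rwa [Submodule.map_top] at this
    have hσint : ∀ c, IsIntegral ℤ (σ c) := by
      intro c
      refine isIntegral_of_smul_mem_submodule NA hNA hNAfg (σ c) ?_
      rintro _ ⟨b, rfl⟩
      exact ⟨ρ c b, hfρ c b⟩
    let τ0 : C →* 𝓞 K :=
      { toFun := fun c ↦ ⟨σ c, hσint c⟩
        map_one' := RingOfIntegers.ext hσ1
        map_mul' := fun c d ↦ RingOfIntegers.ext (hσmul c d) }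
    let τ : C →* (𝓞 K)ˣ := τ0.toHomUnits
    have hτ : ∀ c, (((τ c : (𝓞 K)ˣ) : 𝓞 K) : K) = σ c := fun c ↦ rfl
    -- denominators
    obtain ⟨D, hD, hDint⟩ := uniform_mult
      ((integralClosure ℤ K).toSubring.toAddSubgroup.comap f) (by
        intro b
        have : IsAlgebraic ℤ (f b) := (IsFractionRing.isAlgebraic_iff ℤ ℚ K).2
          (Algebra.IsAlgebraic.isAlgebraic (f b))
        obtain ⟨y, hy, hintg⟩ := this.exists_integral_multiple
        refine ⟨y.natAbs, Int.natAbs_pos.2 hy, ?_⟩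
        have h1 : IsIntegral ℤ (f (y.natAbs • b)) := by
          rw [map_nsmul]
          rcases Int.natAbs_eq y with h | h
          · rw [h, natCast_zsmul] at hintg
            exact hintg
          · rw [h, neg_smul, natCast_zsmul] at hintg
            simpa using hintg.neg
        exact h1)
    have hDint' : ∀ b, IsIntegral ℤ (D • f b) := by
      intro b
      rw [← map_nsmul]
      exact hDint b
    set w : K := f a + 1 with hw
    have hcong : ∀ n : ℕ, 0 < n → ∃ c, ∃ o : 𝓞 K, w - σ c = n * (o : K) := by
      intro n hn
      obtain ⟨c, b, hb⟩ := ha (n * D) (by positivity)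
      refine ⟨c, ⟨_, hDint' b⟩, ?_⟩
      have := congrArg f hb
      rw [map_sub, hfδ, map_nsmul, mul_comm, mul_nsmul] at this
      rw [hw, show f a + 1 - σ c = f a - (σ c - 1) by ring, this, nsmul_eq_mul]
      rfl
    have hwint : IsIntegral ℤ w := by
      obtain ⟨c, o, h1⟩ := hcong 1 one_pos
      rw [sub_eq_iff_eq_add, Nat.cast_one, one_mul] at h1
      rw [h1]
      exact o.isIntegral_coe.add (hσint c)
    let w0 : 𝓞 K := ⟨w, hwint⟩
    have hcong' : ∀ n : ℕ, 0 < n → ∃ c, (n : 𝓞 K) ∣ w0 - τ c := by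
      intro n hn
      obtain ⟨c, o, h1⟩ := hcong n hn
      refine ⟨c, o, RingOfIntegers.ext ?_⟩
      push_cast
      exact h1
    have hunit : IsUnit w0 := by
      by_contra hnu
      obtain ⟨P, hP, hwP⟩ := exists_max_ideal_of_mem_nonunits hnu
      have hP0 : P ≠ ⊥ := Ring.ne_bot_of_isMaximal_of_not_isField hP
        (RingOfIntegers.not_isField K)
      have hN : 0 < Ideal.absNorm P := Nat.pos_of_ne_zero (by
        rwa [Ne, Ideal.absNorm_eq_zero_iff])
      obtain ⟨c, o, ho⟩ := hcong' _ hN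
      have h2 : ((τ c : (𝓞 K)ˣ) : 𝓞 K) ∈ P := by
        have h3 : ((τ c : (𝓞 K)ˣ) : 𝓞 K) = w0 - (Ideal.absNorm P : 𝓞 K) * o := by
          rw [← ho]; ring
        rw [h3]
        exact P.sub_mem hwP (P.mul_mem_right _ (Ideal.absNorm_mem P))
      exact hP.ne_top (Ideal.eq_top_of_isUnit_mem _ h2 (Units.isUnit _))
    obtain ⟨w1, hw1⟩ := hunit
    obtain ⟨c, hc⟩ := chevalley K τ.range w1 (by
      intro n hn
      obtain ⟨c, hc⟩ := hcong' n hn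
      exact ⟨τ c, ⟨c, rfl⟩, by rw [hw1]; exact hc⟩)
    refine ⟨c, hfinj ?_⟩
    have h1 : σ c = w := by
      rw [← hτ, hc, hw1]; rfl
    rw [hfδ, h1, hw]; ring

end

end TCS


namespace TCS

universe u

section Clo

variable {C : Type*} [Group C] {G : Type*} [Group G]

lemma finiteIndex_comap {G H : Type*} [Group G] [Group H] (f : G →* H) (N : Subgroup H)
    (hN : N.FiniteIndex) : (N.comap f).FiniteIndex := by
  refine finiteIndex_of_map _ (fun g ↦ (f g : H ⧸ N)) ?_
  intro a b hab
  have := QuotientGroup.eq.1 hab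
  rw [Subgroup.mem_comap, map_mul, map_inv]
  exact this

/-- `z` lies in the profinite closure of the image of `δ`. -/
def InClo {C : Type*} (δ : C → G) (z : G) : Prop :=
  ∀ N : Subgroup G, N.Normal → N.FiniteIndex → ∃ c, (δ c)⁻¹ * z ∈ N

/-- the image of `δ` is closed in the profinite topology. -/
def Clo {C : Type*} (δ : C → G) : Prop := ∀ z, InClo δ z → ∃ c, δ c = z

/-- `δ` is a cocycle (crossed homomorphism) -/
def IsCoc (ρ : C →* Monoid.End G) (δ : C → G) : Prop := ∀ c d, δ (c * d) = δ c * ρ c (δ d)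

variable {ρ : C →* Monoid.End G} {δ : C → G}

lemma end_inv (ρ : C →* Monoid.End G) (c : C) (x : G) : ρ c⁻¹ (ρ c x) = x := by
  have : (ρ c⁻¹ * ρ c) x = x := by rw [← map_mul, inv_mul_cancel, map_one]; rfl
  exact this

lemma end_inv' (ρ : C →* Monoid.End G) (c : C) (x : G) : ρ c (ρ c⁻¹ x) = x := by
  have : (ρ c * ρ c⁻¹) x = x := by rw [← map_mul, mul_inv_cancel, map_one]; rfl
  exact this

lemma IsCoc.one (h : IsCoc ρ δ) : δ 1 = 1 := by
  have := h 1 1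
  rw [mul_one, map_one] at this
  exact (mul_eq_left.1 this.symm)

lemma IsCoc.inv (h : IsCoc ρ δ) (c : C) : δ c⁻¹ = ρ c⁻¹ (δ c)⁻¹ := by
  have := h c⁻¹ c
  rw [inv_mul_cancel, h.one] at this
  rw [map_inv]
  exact eq_inv_of_mul_eq_one_left this.symm

lemma IsCoc.restrict (h : IsCoc ρ δ) (M : Subgroup C) :
    IsCoc (ρ.comp M.subtype) (fun m : M ↦ δ m) := fun c d ↦ h c d

lemma IsCoc.translate (h : IsCoc ρ δ) (M : Subgroup C) (c0 : C) (z : G)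
    (hz : ∀ N : Subgroup G, N.Normal → N.FiniteIndex → ∃ m ∈ M, (δ (c0 * m))⁻¹ * z ∈ N) :
    InClo (fun m : M ↦ δ m) (ρ c0⁻¹ ((δ c0)⁻¹ * z)) := by
  intro N hN hF
  let f : G →* G := ρ c0⁻¹
  obtain ⟨m, hm, hmN'⟩ := hz (N.comap f) (hN.comap _) (finiteIndex_comap f N hF)
  refine ⟨⟨m, hm⟩, ?_⟩
  have hmN : ρ c0⁻¹ ((δ (c0 * m))⁻¹ * z) ∈ N := hmN'
  convert hmN using 1
  rw [h, mul_inv_rev, mul_assoc, map_mul _ (ρ c0 (δ m))⁻¹, ← map_inv, end_inv]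

lemma IsCoc.translate_eq (h : IsCoc ρ δ) (c0 m : C) (z : G)
    (hm : δ m = ρ c0⁻¹ ((δ c0)⁻¹ * z)) : δ (c0 * m) = z := by
  rw [h, hm, end_inv']; simp

lemma InClo.pigeon {z : G} (hz : InClo δ z) (M : Subgroup C) (hM : M.FiniteIndex) :
    ∃ c0, ∀ N : Subgroup G, N.Normal → N.FiniteIndex → ∃ m ∈ M, (δ (c0 * m))⁻¹ * z ∈ N := by
  by_contra! H
  choose N hN hF hH using H
  have : Finite (C ⧸ M) := inferInstance
  obtain ⟨c, hc⟩ := hz (⨅ q : C ⧸ M, N q.out)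
    (Subgroup.normal_iInf_normal (fun q ↦ hN _)) (Subgroup.finiteIndex_iInf (fun q ↦ hF _))
  have hc' := (Subgroup.mem_iInf.1 hc) (c : C ⧸ M)
  have hmem : ((c : C ⧸ M).out)⁻¹ * c ∈ M := by
    rw [← QuotientGroup.eq]; simp
  exact hH (c : C ⧸ M).out _ hmem (by rw [mul_inv_cancel_left]; exact hc')

lemma clo_of_subgroup (h : IsCoc ρ δ) (M : Subgroup C) (hM : M.FiniteIndex)
    (hc : Clo (fun m : M ↦ δ m)) : Clo δ := by
  intro z hz
  obtain ⟨c0, h0⟩ := hz.pigeon M hM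
  obtain ⟨m, hm⟩ := hc _ (h.translate M c0 z h0)
  exact ⟨c0 * m, h.translate_eq c0 m z hm⟩

/-- Reduction lemma. -/
theorem reduction (h : IsCoc ρ δ) (A : Subgroup G) [hA : A.Normal]
    (hAρ : ∀ c, ∀ a ∈ A, ρ c a ∈ A)
    (h1 : ∀ M : Subgroup C, M.FiniteIndex → Clo (fun m : M ↦ (δ m : G ⧸ A)))
    (h2 : ∀ (C1 : Subgroup C) (hC1 : ∀ c ∈ C1, δ c ∈ A), (∀ c, δ c ∈ A → c ∈ C1) →
      Clo (fun c : C1 ↦ (⟨δ c, hC1 c c.2⟩ : A)))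
    (h3 : ∀ B : Subgroup A, B.Normal → B.FiniteIndex → ∃ N : Subgroup G, N.Normal ∧ N.FiniteIndex ∧
      (∀ c, ∀ x ∈ N, ρ c x ∈ N) ∧ ∀ a : A, (a : G) ∈ N → a ∈ B) : Clo δ := by
  have hquot : ∀ (M : Subgroup C) (z : G), InClo (fun m : M ↦ δ m) z →
      InClo (fun m : M ↦ (δ m : G ⧸ A)) (z : G ⧸ A) := by
    intro M z hz N hN hF
    obtain ⟨m, hm⟩ := hz (N.comap (QuotientGroup.mk' A)) (hN.comap _)
      (finiteIndex_comap _ N hF)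
    exact ⟨m, hm⟩
  -- preimages of invariant subgroups
  have hpre : ∀ N : Subgroup G, (∀ c, ∀ x ∈ N, ρ c x ∈ N) →
      ∃ M : Subgroup C, ∀ c, c ∈ M ↔ δ c ∈ N := by
    intro N hN
    refine ⟨{ carrier := {c | δ c ∈ N}, one_mem' := ?_, mul_mem' := ?_, inv_mem' := ?_ },
      fun c ↦ Iff.rfl⟩
    · intro a b ha hb
      show δ (a * b) ∈ N
      rw [h]
      exact mul_mem ha (hN _ _ hb)
    · show δ 1 ∈ N
      rw [h.one]; exact one_mem _
    · intro a ha
      show δ a⁻¹ ∈ N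
      rw [h.inv]
      exact hN _ _ (inv_mem ha)
  -- elements of `A`
  have key : ∀ z ∈ A, InClo δ z → ∃ c, δ c = z := by
    intro z hzA hz
    obtain ⟨C1, hC1⟩ := hpre A hAρ
    have hcl : InClo (fun c : C1 ↦ (⟨δ c, (hC1 c).1 c.2⟩ : A)) ⟨z, hzA⟩ := by
      intro B hB hBF
      obtain ⟨N, hN, hNF, hNρ, hNB⟩ := h3 B hB hBF
      obtain ⟨M, hM⟩ := hpre N hNρ
      have hMF : M.FiniteIndex := by
        refine finiteIndex_of_map M (fun c ↦ (δ c : G ⧸ N)) ?_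
        intro a b hab
        rw [hM, h, h.inv, ← map_mul]
        exact hNρ _ _ (QuotientGroup.eq.1 hab)
      obtain ⟨c0, h0⟩ := hz.pigeon M hMF
      have h4 := h.translate M c0 z h0
      obtain ⟨m, hm⟩ := h1 M hMF _ (hquot M _ h4)
      have hm' : (δ m)⁻¹ * ρ c0⁻¹ ((δ c0)⁻¹ * z) ∈ A := QuotientGroup.eq.1 hm
      have hm2 : (δ (c0 * m))⁻¹ * z ∈ A := by
        have := hAρ c0 _ hm'
        rw [map_mul, end_inv'] at this
        rw [h, mul_inv_rev, mul_assoc, ← map_inv]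
        exact this
      have hmC : c0 * m ∈ C1 := by
        rw [hC1]
        have := mul_mem hzA (inv_mem hm2)
        simpa using this
      obtain ⟨m', hm'M, hm'N⟩ := h0 N hN hNF
      refine ⟨⟨c0 * m, hmC⟩, hNB _ ?_⟩
      show (δ (c0 * m))⁻¹ * z ∈ N
      have h5 : (δ (c0 * m))⁻¹ * δ (c0 * m') ∈ N := by
        rw [h, h, mul_inv_rev, mul_assoc, inv_mul_cancel_left, ← map_inv, ← map_mul]
        exact hNρ _ _ (mul_mem (inv_mem ((hM _).1 m.2)) ((hM _).1 hm'M))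
      have := mul_mem h5 hm'N
      rwa [mul_assoc, mul_inv_cancel_left] at this
    obtain ⟨c, hc⟩ := h2 C1 (fun c hc ↦ (hC1 c).1 hc) (fun c hc ↦ (hC1 c).2 hc) _ hcl
    exact ⟨c, congrArg Subtype.val hc⟩
  intro z hz
  have hzT : ∀ c0 : C, InClo (fun m : (⊤ : Subgroup C) ↦ δ m) (ρ c0⁻¹ ((δ c0)⁻¹ * z)) := by
    intro c0
    refine h.translate ⊤ c0 z ?_
    intro N hN hF
    obtain ⟨c, hc⟩ := hz N hN hF
    exact ⟨c0⁻¹ * c, trivial, by rwa [mul_inv_cancel_left]⟩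
  have hT1 := hzT 1
  rw [inv_one, map_one, h.one, inv_one, one_mul] at hT1
  obtain ⟨c0', hc0⟩ := h1 ⊤ inferInstance _ (hquot ⊤ _ hT1)
  obtain ⟨c0, hc00⟩ : ∃ c0 : C, c0 = c0' := ⟨_, rfl⟩
  replace hc0 : (δ c0 : G ⧸ A) = (z : G ⧸ A) := by rw [hc00]; exact hc0
  have hc0' : (δ c0)⁻¹ * z ∈ A := QuotientGroup.eq.1 hc0
  obtain ⟨c, hc⟩ := key (ρ c0⁻¹ ((δ c0)⁻¹ * z)) (hAρ _ _ hc0') (by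
    intro N hN hF
    obtain ⟨c, hc⟩ := hzT c0 N hN hF
    exact ⟨c, hc⟩)
  exact ⟨c0 * c, h.translate_eq c0 c z hc⟩

end Clo

section Good

/-- virtually solvable groups -/
def VSolv (C : Type*) [Group C] : Prop := ∃ S : Subgroup C, S.FiniteIndex ∧ Group.IsSolvable S

lemma VSolv.of_injective {C D : Type*} [Group C] [Group D] (h : VSolv C) (f : D →* C)
    (hf : Function.Injective f) : VSolv D := by
  obtain ⟨S, hS, hs⟩ := h
  refine ⟨S.comap f, finiteIndex_comap f S hS, ?_⟩
  exact Group.isSolvable_of_isSolvable_injective (f := f.subgroupComap S) (by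
    intro a b hab
    apply Subtype.ext
    apply hf
    exact congrArg Subtype.val hab)

lemma VSolv.subgroup {C : Type*} [Group C] (h : VSolv C) (M : Subgroup C) : VSolv M :=
  h.of_injective M.subtype Subtype.val_injective

/-- all cocycles from virtually solvable groups have closed image. -/
def Good (G : Type u) [Group G] : Prop :=
  ∀ (C : Type u) [Group C], VSolv C → ∀ (ρ : C →* Monoid.End G) (δ : C → G),
    IsCoc ρ δ → Clo δ

theorem good_reduction {C G : Type u} [Group C] [Group G] (hC : VSolv C)
    {ρ : C →* Monoid.End G} {δ : C → G} (h : IsCoc ρ δ) (A : Subgroup G) [hA : A.Normal]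
    (hAρ : ∀ c, ∀ a ∈ A, ρ c a ∈ A) (h1 : Good (G ⧸ A)) (h2 : Good A)
    (h3 : ∀ B : Subgroup A, B.Normal → B.FiniteIndex → ∃ N : Subgroup G, N.Normal ∧ N.FiniteIndex ∧
      (∀ c, ∀ x ∈ N, ρ c x ∈ N) ∧ ∀ a : A, (a : G) ∈ N → a ∈ B) : Clo δ := by
  refine reduction h A hAρ ?_ ?_ h3
  · intro M _
    let ρq : M →* Monoid.End (G ⧸ A) :=
      { toFun := fun c ↦ QuotientGroup.map A A (ρ c) (hAρ c)
        map_one' := by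
          refine MonoidHom.ext fun x ↦ ?_
          induction x using QuotientGroup.induction_on with
          | H x =>
            show ((ρ ((1 : M) : C) x : G) : G ⧸ A) = (x : G ⧸ A)
            rw [Subgroup.coe_one, map_one]; rfl
        map_mul' := by
          intro a b
          refine MonoidHom.ext fun x ↦ ?_
          induction x using QuotientGroup.induction_on with
          | H x =>
            show ((ρ ((a * b : M) : C) x : G) : G ⧸ A) = ((ρ a (ρ b x) : G) : G ⧸ A)
            rw [Subgroup.coe_mul, map_mul]; rfl }
    refine h1 M (hC.subgroup M) ρq _ ?_
    intro c d
    show ((δ (c * d) : G) : G ⧸ A) = (δ c : G ⧸ A) * ((ρ c (δ d) : G) : G ⧸ A)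
    rw [h]; rfl
  · intro C1 hC1 _
    let ρA : C1 →* Monoid.End A :=
      { toFun := fun c ↦ ((ρ c).comp A.subtype).codRestrict A (fun a ↦ hAρ c a a.2)
        map_one' := by
          refine MonoidHom.ext fun x ↦ Subtype.ext ?_
          show ρ ((1 : C1) : C) x = x
          rw [Subgroup.coe_one, map_one]; rfl
        map_mul' := by
          intro a b
          refine MonoidHom.ext fun x ↦ Subtype.ext ?_
          show ρ ((a * b : C1) : C) x = ρ a (ρ b x)
          rw [Subgroup.coe_mul, map_mul]; rfl }
    refine h2 C1 (hC.subgroup C1) ρA _ ?_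
    intro c d
    apply Subtype.ext
    exact h c d

end Good

end TCS


namespace TCS

universe u

open TensorProduct

lemma pow_fi {A : Type*} [CommGroup A] (hA : Module.Finite ℤ (Additive A)) (n : ℕ) (hn : 0 < n) :
    ((powMonoidHom n : A →* A).range).FiniteIndex := by
  have h1 : AddGroup.FG (Additive A) := Module.Finite.iff_addGroup_fg.1 hA
  have h2 : Group.FG A := GroupFG.iff_add_fg.2 h1
  have h3 : Finite (A ⧸ (powMonoidHom n : A →* A).range) := by
    refine CommGroup.finite_of_fg_isMulTorsion _ ?_
    intro x
    induction x using QuotientGroup.induction_on with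
    | H x =>
      rw [isOfFinOrder_iff_pow_eq_one]
      refine ⟨n, hn, ?_⟩
      rw [← QuotientGroup.mk_pow, QuotientGroup.eq_one_iff]
      exact ⟨x, rfl⟩
  exact Subgroup.finiteIndex_of_finite_quotient

section

variable {C : Type u} [Group C] {A : Type u} [CommGroup A]

/-- linearisation -/
def linZ (ρ : C →* Monoid.End A) : C →* Module.End ℤ (Additive A) where
  toFun c := (MonoidHom.toAdditive (ρ c : A →* A)).toIntLinearMap
  map_one' := by
    ext x
    show Additive.ofMul (ρ 1 x.toMul) = x
    rw [map_one]; rfl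
  map_mul' c d := by
    ext x
    show Additive.ofMul (ρ (c * d) x.toMul) = Additive.ofMul (ρ c (ρ d x.toMul))
    rw [map_mul]; rfl

/-- rationalisation -/
noncomputable def linQ (ρ : C →* Monoid.End A) : C →* Module.End ℚ (ℚ ⊗[ℤ] (Additive A)) :=
  (Module.End.baseChangeHom ℤ ℚ (Additive A) : _ →* _).comp (linZ ρ)

/-- inclusion -/
noncomputable def iot (A : Type u) [CommGroup A] : Additive A →+ ℚ ⊗[ℤ] (Additive A) :=
  (TensorProduct.mk ℤ ℚ (Additive A) 1).toAddMonoidHom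

lemma iot_inj [IsMulTorsionFree A] : Function.Injective (iot A) := by
  intro a b hab
  obtain ⟨c, hc⟩ := (IsLocalizedModule.eq_iff_exists (nonZeroDivisors ℤ)
    (TensorProduct.mk ℤ ℚ (Additive A) 1)).1 hab
  have hc0 : (c : ℤ) ≠ 0 := nonZeroDivisors.ne_zero c.2
  exact smul_right_injective _ hc0 hc

lemma iot_surj (v : ℚ ⊗[ℤ] (Additive A)) : ∃ (n : ℤ) (a : Additive A), n ≠ 0 ∧
    n • v = iot A a := by
  obtain ⟨⟨a, n⟩, h⟩ := IsLocalizedModule.surj (nonZeroDivisors ℤ)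
    (TensorProduct.mk ℤ ℚ (Additive A) 1) v
  exact ⟨n, a, nonZeroDivisors.ne_zero n.2, h⟩

lemma linQ_iot (ρ : C →* Monoid.End A) (c : C) (a : Additive A) :
    linQ ρ c (iot A a) = iot A (linZ ρ c a) := by
  show (linZ ρ c).baseChange ℚ (1 ⊗ₜ a) = 1 ⊗ₜ _
  rw [LinearMap.baseChange_tmul]

lemma linQ_eq_one [IsMulTorsionFree A] (ρ : C →* Monoid.End A) (c : C) (h : linQ ρ c = 1) (a : A) :
    ρ c a = a := by
  have := linQ_iot ρ c (Additive.ofMul a)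
  rw [h] at this
  exact (iot_inj this).symm

lemma virt_comm [IsMulTorsionFree A] (hA : Module.Finite ℤ (Additive A)) [Nontrivial A]
    (hC : VSolv C) (ρ : C →* Monoid.End A) (hirr : SIrr (linQ ρ)) :
    ∃ M : Subgroup C, M.FiniteIndex ∧ ∀ c ∈ M, ∀ d ∈ M, linQ ρ c * linQ ρ d = linQ ρ d * linQ ρ c := by
  obtain ⟨S, hS, hs⟩ := hC
  have hnt : Nontrivial (ℚ ⊗[ℤ] (Additive A)) := (iot_inj (A := A)).nontrivial
  let f : S →* (Module.End ℚ (ℚ ⊗[ℤ] (Additive A)))ˣ := ((linQ ρ).comp S.subtype).toHomUnits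
  have hf : ∀ s : S, (f s : Module.End ℚ (ℚ ⊗[ℤ] (Additive A))) = linQ ρ s := fun s ↦ rfl
  let g : S →* f.range := f.rangeRestrict
  have hg : Function.Surjective g := f.rangeRestrict_surjective
  let ρΓ : f.range →* Module.End ℚ (ℚ ⊗[ℤ] (Additive A)) := (Units.coeHom _).comp f.range.subtype
  have hρΓ : ∀ s : S, ρΓ (g s) = linQ ρ s := fun s ↦ rfl
  have hinj : Function.Injective ρΓ := by
    intro a b hab
    exact Subtype.ext (Units.ext hab)
  have hpull : ∀ M : Subgroup f.range, M.FiniteIndex →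
      ((M.comap g).map S.subtype).FiniteIndex := fun M hM ↦
    finiteIndex_map_subtype S _ (finiteIndex_comap g M hM)
  have hI : SIrr ρΓ := by
    intro M hM W hW
    refine hirr _ (hpull M hM) W ?_
    rintro _ ⟨s, hs, rfl⟩ v hv
    exact hW _ hs v hv
  have hRF : RF f.range := by
    intro x hx
    obtain ⟨s, rfl⟩ := hg x
    have h1 : ∃ a, linZ ρ s a - a ≠ 0 := by
      by_contra! H
      apply hx
      apply hinj
      rw [hρΓ, map_one]
      show (linZ ρ s).baseChange ℚ = 1
      have : linZ ρ s = 1 := by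
        refine LinearMap.ext fun a ↦ ?_
        exact sub_eq_zero.1 (H a)
      rw [this]
      exact LinearMap.baseChange_id
    obtain ⟨a, ha⟩ := h1
    have h2 : ∃ m : ℕ, 0 < m ∧ ∀ b : Additive A, linZ ρ s a - a ≠ m • b := by
      by_contra! H
      exact ha (fg_div _ H)
    obtain ⟨m, hm, hmb⟩ := h2
    let P : Subgroup A := (powMonoidHom m : A →* A).range
    have hP : P.FiniteIndex := pow_fi hA m hm
    have hPρ : ∀ c, ∀ x ∈ P, ρ c x ∈ P := by
      rintro c _ ⟨y, rfl⟩
      exact ⟨ρ c y, (map_pow (ρ c) y m).symm⟩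
    let N0 : Subgroup S :=
      { carrier := {t | ∀ x, x⁻¹ * ρ t x ∈ P}
        one_mem' := by
          intro x
          show x⁻¹ * ρ 1 x ∈ P
          rw [map_one]
          show x⁻¹ * x ∈ P
          rw [inv_mul_cancel]; exact one_mem _
        mul_mem' := by
          intro t t' ht ht' x
          show x⁻¹ * ρ (t * t') x ∈ P
          rw [map_mul]
          show x⁻¹ * ρ t (ρ t' x) ∈ P
          have := mul_mem (ht' x) (ht (ρ t' x))
          rwa [mul_assoc, mul_inv_cancel_left] at this
        inv_mem' := by
          intro t ht x
          show x⁻¹ * ρ ((t : C)⁻¹) x ∈ P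
          have := inv_mem (ht (ρ ((t : C)⁻¹) x))
          rw [end_inv', mul_inv_rev, inv_inv] at this
          exact this }
    have hN0 : N0.FiniteIndex := by
      refine finiteIndex_of_map N0 (fun t ↦ (fun x : A ⧸ P ↦ QuotientGroup.map P P (ρ t) (hPρ t) x)) ?_
      intro t t' htt x
      have h3 := congrFun htt (x : A ⧸ P)
      have h4 : (ρ t x)⁻¹ * ρ t' x ∈ P := QuotientGroup.eq.1 h3
      have h5 := hPρ (t : C)⁻¹ _ h4
      rw [map_mul, map_inv, end_inv] at h5
      show x⁻¹ * ρ ((t : C)⁻¹ * t') x ∈ P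
      rw [map_mul]
      exact h5
    refine ⟨N0.map g, ?_, ?_⟩
    · constructor
      have := Subgroup.index_map_dvd N0 hg
      intro h0
      rw [h0] at this
      exact hN0.index_ne_zero (Nat.eq_zero_of_zero_dvd this)
    · rintro ⟨t, ht, hts⟩
      have h6 : linQ ρ t = linQ ρ s := by rw [← hρΓ, ← hρΓ, hts]
      have h7 : linZ ρ t a = linZ ρ s a := by
        apply iot_inj
        rw [← linQ_iot, ← linQ_iot, h6]
      obtain ⟨b, hb⟩ := ht a.toMul
      refine hmb (Additive.ofMul b) ?_
      rw [← h7, sub_eq_iff_eq_add']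
      have h8 : ρ t a.toMul = a.toMul * b ^ m := by
        have : b ^ m = (a.toMul)⁻¹ * ρ t a.toMul := hb
        rw [this, mul_inv_cancel_left]
      exact h8
  have hsol : Group.IsSolvable f.range := Group.isSolvable_of_surjective hg
  obtain ⟨d, hd⟩ := hsol.solvable
  obtain ⟨M, hM, hMc⟩ := VA d f.range ρΓ hinj hI hRF hd
  refine ⟨_, hpull M hM, ?_⟩
  rintro _ ⟨s, hs, rfl⟩ _ ⟨t, ht, rfl⟩
  have := congrArg ρΓ (hMc _ hs _ ht)
  rw [map_mul, map_mul] at this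
  exact this

theorem good_irr [IsMulTorsionFree A] (hA : Module.Finite ℤ (Additive A)) [Nontrivial A]
    (hC : VSolv C) (ρ : C →* Monoid.End A) (hirr : SIrr (linQ ρ)) (δ : C → A) (h : IsCoc ρ δ) :
    Clo δ := by
  obtain ⟨M, hM, hMc⟩ := virt_comm hA hC ρ hirr
  refine clo_of_subgroup h M hM ?_
  intro z hz
  exact abelian_closed (C := M) (iot A) iot_inj ((linZ ρ).comp M.subtype) ((linQ ρ).comp M.subtype)
    (fun c a ↦ linQ_iot ρ c a) (fun c d ↦ hMc c c.2 d d.2)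
    (fun W hW ↦ hirr M hM W (fun g hg v hv ↦ hW ⟨g, hg⟩ v hv))
    (fun m ↦ Additive.ofMul (δ m)) (fun c d ↦ congrArg Additive.ofMul (h c d)) (Additive.ofMul z) (by
      intro n hn
      obtain ⟨c, b, hb⟩ := hz _ inferInstance (pow_fi hA n hn)
      refine ⟨c, Additive.ofMul b, ?_⟩
      have h1 : z / δ c = b ^ n := by
        have : b ^ n = (δ c)⁻¹ * z := hb
        rw [this, div_eq_mul_inv, mul_comm]
      exact congrArg Additive.ofMul h1)

end

theorem good_free (n : ℕ) : ∀ (A : Type u) [CommGroup A] [IsMulTorsionFree A],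
    Module.Finite ℤ (Additive A) → Module.finrank ℤ (Additive A) ≤ n → Good A := by
  induction n with
  | zero =>
    intro A _ _ hA hn C _ _ ρ δ _ z _
    have : Subsingleton A := by
      by_contra H
      rw [not_subsingleton_iff_nontrivial] at H
      have : Nontrivial (Additive A) := H
      have := Module.finrank_pos (R := ℤ) (M := Additive A)
      omega
    exact ⟨1, Subsingleton.elim _ _⟩
  | succ n ih =>
    intro A _ _ hA hn C _ hC ρ δ h
    by_cases hA0 : Subsingleton A
    · intro z _
      exact ⟨1, Subsingleton.elim _ _⟩
    rw [not_subsingleton_iff_nontrivial] at hA0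
    by_cases hirr : SIrr (linQ ρ)
    · exact good_irr hA hC ρ hirr δ h
    simp only [SIrr, not_forall, not_or] at hirr
    obtain ⟨M, hM, W, hW, hW0, hW1⟩ := hirr
    refine clo_of_subgroup h M hM ?_
    have hdiv : ∀ (n : ℤ) (v : ℚ ⊗[ℤ] (Additive A)), n ≠ 0 → n • v ∈ W → v ∈ W := by
      intro n v hn hv
      have := W.smul_mem ((n : ℚ)⁻¹) hv
      rwa [← Int.cast_smul_eq_zsmul ℚ, smul_smul, inv_mul_cancel₀ (by exact_mod_cast hn),
        one_smul] at this
    let A' : Subgroup A := AddSubgroup.toSubgroup' (W.toAddSubgroup.comap (iot A))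
    have hA' : ∀ a : A, a ∈ A' ↔ iot A (Additive.ofMul a) ∈ W := fun a ↦ Iff.rfl
    have hsat : ∀ (n : ℕ) (a : A), n ≠ 0 → a ^ n ∈ A' → a ∈ A' := by
      intro n a hn ha
      rw [hA'] at ha ⊢
      refine hdiv n _ (by exact_mod_cast hn) ?_
      rw [ofMul_pow, map_nsmul] at ha
      rwa [natCast_zsmul]
    have hTF : IsMulTorsionFree (A ⧸ A') := by
      constructor
      intro n hn x y hxy
      induction x using QuotientGroup.induction_on with
      | H x =>
      induction y using QuotientGroup.induction_on with
      | H y =>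
      rw [QuotientGroup.eq]
      refine hsat n _ hn ?_
      have h1 : ((x ^ n : A) : A ⧸ A') = ((y ^ n : A) : A ⧸ A') := hxy
      rw [QuotientGroup.eq] at h1
      rwa [mul_pow, inv_pow]
    let f : Additive A →ₗ[ℤ] Additive (A ⧸ A') :=
      (MonoidHom.toAdditive (QuotientGroup.mk' A')).toIntLinearMap
    have hf : Function.Surjective f := QuotientGroup.mk'_surjective A'
    let e : Additive A' ≃+ LinearMap.ker f :=
      { toFun := fun x ↦ ⟨Additive.ofMul (x.toMul : A), (QuotientGroup.eq_one_iff _).2 x.toMul.2⟩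
        invFun := fun y ↦ Additive.ofMul ⟨y.1.toMul, (QuotientGroup.eq_one_iff _).1 y.2⟩
        left_inv := fun x ↦ rfl
        right_inv := fun x ↦ rfl
        map_add' := fun x y ↦ rfl }
    have hfin1 : Module.Finite ℤ (Additive (A ⧸ A')) := Module.Finite.of_surjective f hf
    have hfin2 : Module.Finite ℤ (Additive A') :=
      Module.Finite.equiv e.toIntLinearEquiv.symm
    have hr := Submodule.finrank_quotient_add_finrank (LinearMap.ker f)
    rw [(f.quotKerEquivOfSurjective hf).finrank_eq, ← e.toIntLinearEquiv.finrank_eq] at hr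
    have hn1 : Nontrivial (Additive A') := by
      obtain ⟨v, hv, hv0⟩ := W.ne_bot_iff.1 hW0
      obtain ⟨k, a, hk, hka⟩ := iot_surj v
      refine ⟨⟨Additive.ofMul ⟨a.toMul, ?_⟩, 0, ?_⟩⟩
      · rw [hA']
        show iot A a ∈ W
        rw [← hka]
        exact W.toAddSubgroup.zsmul_mem hv k
      · intro h0
        have h1 : a = 0 := congrArg Subtype.val h0
        rw [h1, map_zero] at hka
        have := hdiv
        rw [← Int.cast_smul_eq_zsmul ℚ, smul_eq_zero] at hka
        rcases hka with h2 | h2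
        · exact hk (by exact_mod_cast h2)
        · exact hv0 h2
    have hn2 : Nontrivial (Additive (A ⧸ A')) := by
      by_contra H
      rw [not_nontrivial_iff_subsingleton] at H
      apply hW1
      rw [eq_top_iff]
      intro v _
      obtain ⟨k, a, hk, hka⟩ := iot_surj v
      refine hdiv k v hk ?_
      rw [hka]
      have : ((a.toMul : A) : A ⧸ A') = 1 := H.elim (Additive.ofMul _) (Additive.ofMul _)
      exact (QuotientGroup.eq_one_iff _).1 this
    have hp1 := Module.finrank_pos (R := ℤ) (M := Additive A')
    have hp2 := Module.finrank_pos (R := ℤ) (M := Additive (A ⧸ A'))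
    refine good_reduction (hC.subgroup M) (h.restrict M) A' ?_
      (ih _ hfin1 (by omega)) (ih _ hfin2 (by omega)) ?_
    · intro c a ha
      rw [hA'] at ha ⊢
      have := hW c c.2 _ ha
      rw [linQ_iot] at this
      exact this
    · intro B hB hBF
      have hk : 0 < B.index := Nat.pos_of_ne_zero hBF.index_ne_zero
      refine ⟨(powMonoidHom B.index : A →* A).range, inferInstance, pow_fi hA _ hk, ?_, ?_⟩
      · rintro c _ ⟨y, rfl⟩
        exact ⟨ρ c y, (map_pow (ρ c) y _).symm⟩
      · rintro a ⟨y, hy⟩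
        have hy' : y ^ B.index = a := hy
        have hyA : y ∈ A' := hsat _ y hk.ne' (by rw [hy']; exact a.2)
        have : a = (⟨y, hyA⟩ : A') ^ B.index := Subtype.ext hy'.symm
        rw [this]
        exact Subgroup.pow_index_mem B _

end TCS


namespace TCS

universe u

lemma good_finite (G : Type u) [Group G] [Finite G] : Good G := by
  intro C _ _ ρ δ _ z hz
  obtain ⟨c, hc⟩ := hz ⊥ inferInstance inferInstance
  refine ⟨c, ?_⟩
  rw [Subgroup.mem_bot] at hc
  exact (inv_mul_eq_one.1 hc)

lemma good_abelian (A : Type u) [CommGroup A] (hA : Module.Finite ℤ (Additive A)) : Good A := by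
  let T : Subgroup A := CommGroup.torsion A
  have hT : ∀ x : A, x ∈ T ↔ IsOfFinOrder x := fun x ↦ Iff.rfl
  have hsat : ∀ (n : ℕ) (a : A), n ≠ 0 → a ^ n ∈ T → a ∈ T := by
    intro n a hn ha
    rw [hT] at ha ⊢
    exact (isOfFinOrder_pow.1 ha).resolve_right hn
  have hTF : IsMulTorsionFree (A ⧸ T) := by
    constructor
    intro n hn x y hxy
    induction x using QuotientGroup.induction_on with
    | H x =>
    induction y using QuotientGroup.induction_on with
    | H y =>
    rw [QuotientGroup.eq]
    refine hsat n _ hn ?_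
    have h1 : ((x ^ n : A) : A ⧸ T) = ((y ^ n : A) : A ⧸ T) := hxy
    rw [QuotientGroup.eq] at h1
    rwa [mul_pow, inv_pow]
  let f : Additive A →ₗ[ℤ] Additive (A ⧸ T) :=
    (MonoidHom.toAdditive (QuotientGroup.mk' T)).toIntLinearMap
  have hf : Function.Surjective f := QuotientGroup.mk'_surjective T
  have hfin1 : Module.Finite ℤ (Additive (A ⧸ T)) := Module.Finite.of_surjective f hf
  let g : Additive T →ₗ[ℤ] Additive A := (MonoidHom.toAdditive T.subtype).toIntLinearMap
  have hfin2 : Module.Finite ℤ (Additive T) :=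
    Module.Finite.of_injective g Subtype.val_injective
  have hfgT : Group.FG T := GroupFG.iff_add_fg.2 (Module.Finite.iff_addGroup_fg.1 hfin2)
  have hTfin : Finite T := by
    refine CommGroup.finite_of_fg_isMulTorsion _ ?_
    intro x
    exact (Submonoid.isOfFinOrder_coe).1 ((hT x).1 x.2)
  intro C _ hC ρ δ h
  refine good_reduction hC h T ?_ (good_free _ _ hfin1 le_rfl) (good_finite T) ?_
  · intro c a ha
    rw [hT] at ha ⊢
    exact MonoidHom.isOfFinOrder (ρ c : A →* A) ha
  · intro B _ _
    have hk : 0 < Nat.card T := Nat.card_pos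
    refine ⟨(powMonoidHom (Nat.card T) : A →* A).range, inferInstance, pow_fi hA _ hk, ?_, ?_⟩
    · rintro c _ ⟨y, rfl⟩
      exact ⟨ρ c y, (map_pow (ρ c) y _).symm⟩
    · rintro a ⟨y, hy⟩
      have hy' : y ^ Nat.card T = a := hy
      have hyA : y ∈ T := hsat _ y hk.ne' (by rw [hy']; exact a.2)
      have : a = (⟨y, hyA⟩ : T) ^ Nat.card T := Subtype.ext hy'.symm
      rw [this, pow_card_eq_one']
      exact one_mem _

/-- fully invariant core -/
lemma fcore {G : Type*} [Group G] (hG : Group.FG G) (N : Subgroup G) (hN : N.FiniteIndex) :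
    ∃ N' : Subgroup G, N' ≤ N ∧ N'.Normal ∧ N'.FiniteIndex ∧ ∀ f : G →* G, ∀ x ∈ N', f x ∈ N' := by
  have : Finite (G →* G ⧸ N.normalCore) := by
    obtain ⟨S, hS, hSf⟩ := (Subgroup.fg_iff _).1 hG.out
    have := hSf.to_subtype
    refine Finite.of_injective (fun (f : G →* G ⧸ N.normalCore) ↦ fun s : S ↦ f s) ?_
    intro f g hfg
    refine MonoidHom.eq_of_eqOn_dense hS ?_
    intro s hs
    exact congrFun hfg ⟨s, hs⟩
  refine ⟨⨅ f : G →* G ⧸ N.normalCore, f.ker, ?_, ?_, ?_, ?_⟩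
  · intro x hx
    have := (Subgroup.mem_iInf.1 hx) (QuotientGroup.mk' N.normalCore)
    rw [QuotientGroup.ker_mk'] at this
    exact N.normalCore_le this
  · exact Subgroup.normal_iInf_normal fun f ↦ inferInstance
  · refine Subgroup.finiteIndex_iInf fun f ↦ ?_
    rw [← MonoidHom.comap_bot]
    exact finiteIndex_comap f ⊥ inferInstance
  · intro f x hx
    rw [Subgroup.mem_iInf] at hx ⊢
    intro g
    exact hx (g.comp f)

/-- iterated cyclic or finite extensions -/
inductive Reach {G : Type*} [Group G] (A : Subgroup G) : Subgroup G → Prop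
  | base : Reach A A
  | cyc (H K : Subgroup G) (t : G) : Reach A H → H ≤ K → (∀ x ∈ K, ∀ h ∈ H, x * h * x⁻¹ ∈ H) →
      t ∈ K → (∀ x ∈ K, ∃ k : ℤ, ∃ h ∈ H, x = t ^ k * h) → Reach A K
  | fin (H K : Subgroup G) : Reach A H → H ≤ K → H.relIndex K ≠ 0 → Reach A K

lemma Reach.map {G G' : Type*} [Group G] [Group G'] (f : G →* G') {A K : Subgroup G}
    (h : Reach A K) : Reach (A.map f) (K.map f) := by
  induction h with
  | base => exact .base
  | cyc H K t _ hHK hn ht hx ih =>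
    refine .cyc _ _ (f t) ih (Subgroup.map_mono hHK) ?_ ⟨t, ht, rfl⟩ ?_
    · rintro _ ⟨x, hx, rfl⟩ _ ⟨y, hy, rfl⟩
      exact ⟨_, hn x hx y hy, by simp⟩
    · rintro _ ⟨x, hxK, rfl⟩
      obtain ⟨k, y, hy, rfl⟩ := hx x hxK
      exact ⟨k, f y, ⟨y, hy, rfl⟩, by simp⟩
  | fin H K _ hHK hi ih =>
    refine .fin _ _ ih (Subgroup.map_mono hHK) ?_
    rw [← Subgroup.relIndex_comap]
    intro h0
    have := Subgroup.relIndex_dvd_of_le_left K (Subgroup.le_comap_map f H)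
    rw [h0] at this
    exact hi (Nat.eq_zero_of_zero_dvd this)

lemma Reach.comap {G G' : Type*} [Group G] [Group G'] (f : G →* G') (hf : Function.Surjective f)
    {A K : Subgroup G'} (h : Reach A K) : Reach (A.comap f) (K.comap f) := by
  induction h with
  | base => exact .base
  | cyc H K t _ hHK hn ht hx ih =>
    obtain ⟨t, rfl⟩ := hf t
    refine .cyc _ _ t ih (Subgroup.comap_mono hHK) ?_ ht ?_
    · intro x hx y hy
      have := hn _ hx _ hy
      rw [Subgroup.mem_comap]
      simpa using this
    · intro x hxK
      obtain ⟨k, y, hy, hxy⟩ := hx (f x) hxK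
      refine ⟨k, (t ^ k)⁻¹ * x, ?_, by rw [mul_inv_cancel_left]⟩
      rw [Subgroup.mem_comap, map_mul, hxy, map_inv, map_zpow, inv_mul_cancel_left]
      exact hy
  | fin H K _ hHK hi ih =>
    refine .fin _ _ ih (Subgroup.comap_mono hHK) ?_
    exact Subgroup.relIndex_comap_ne_zero f hi

lemma fg_ext {G : Type*} [Group G] (L L0 : Subgroup G) (h : L0 ≤ L) (h0 : L0.FG) (T : Set G)
    (hT : T.Finite) (hTL : T ⊆ L)
    (hx : ∀ x ∈ L, ∃ y ∈ Subgroup.closure T, y⁻¹ * x ∈ L0) : L.FG := by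
  obtain ⟨S, hS, hSf⟩ := (Subgroup.fg_iff _).1 h0
  refine (Subgroup.fg_iff _).2 ⟨S ∪ T, ?_, hSf.union hT⟩
  rw [Subgroup.closure_union, hS]
  apply le_antisymm
  · exact sup_le h ((Subgroup.closure_le _).2 hTL)
  · intro x hxL
    obtain ⟨y, hy, hyx⟩ := hx x hxL
    have := mul_mem (Subgroup.mem_sup_right (S := L0) hy) (Subgroup.mem_sup_left hyx)
    rwa [mul_inv_cancel_left] at this

lemma Reach.fg {G : Type*} [Group G] {K : Subgroup G} (h : Reach ⊥ K) : ∀ L ≤ K, L.FG := by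
  induction h with
  | base =>
    intro L hL
    rw [le_bot_iff.1 hL]
    exact Subgroup.FG.bot
  | cyc H K t _ hHK hn ht hx ih =>
    intro L hL
    let D : AddSubgroup ℤ :=
      { carrier := {k | ∃ h ∈ H, t ^ k * h ∈ L}
        zero_mem' := ⟨1, one_mem _, by simp⟩
        add_mem' := by
          rintro a b ⟨x, hx, hxL⟩ ⟨y, hy, hyL⟩
          refine ⟨(t ^ b)⁻¹ * x * (t ^ b) * y, mul_mem ?_ hy, ?_⟩
          · have := hn (t ^ b)⁻¹ (inv_mem (zpow_mem ht b)) x hx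
            rwa [inv_inv] at this
          · have := mul_mem hxL hyL
            convert this using 1
            rw [zpow_add]; group
        neg_mem' := by
          rintro a ⟨x, hx, hxL⟩
          refine ⟨t ^ a * x⁻¹ * (t ^ a)⁻¹, hn _ (zpow_mem ht a) _ (inv_mem hx), ?_⟩
          have := inv_mem hxL
          convert this using 1
          group }
    obtain ⟨k0, hk0⟩ := Int.subgroup_cyclic D
    have hk0D : k0 ∈ D := by rw [hk0]; exact AddSubgroup.subset_closure (Set.mem_singleton _)
    obtain ⟨h0, hh0, hx0⟩ := hk0D
    refine fg_ext L (L ⊓ H) inf_le_left (ih _ inf_le_right) {t ^ k0 * h0} (Set.finite_singleton _)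
      (by rintro _ rfl; exact hx0) ?_
    intro x hxL
    obtain ⟨k, y, hy, hxy⟩ := hx x (hL hxL)
    have hkD : k ∈ D := ⟨y, hy, by rwa [← hxy]⟩
    rw [hk0, AddSubgroup.mem_closure_singleton] at hkD
    obtain ⟨m, hm⟩ := hkD
    refine ⟨(t ^ k0 * h0) ^ m, zpow_mem (Subgroup.subset_closure (Set.mem_singleton _)) m, ?_⟩
    refine ⟨L.mul_mem (L.inv_mem (L.zpow_mem hx0 m)) hxL, ?_⟩
    -- work in the quotient of `K` by `H`
    let N : Subgroup K := H.subgroupOf K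
    have hN : N.Normal := by
      constructor
      intro n hn' g
      exact hn g g.2 n hn'
    let t' : K := ⟨t, ht⟩
    let h0' : K := ⟨h0, hHK hh0⟩
    let y' : K := ⟨y, hHK hy⟩
    have e1 : (h0' : K ⧸ N) = 1 := (QuotientGroup.eq_one_iff _).2 hh0
    have e2 : (y' : K ⧸ N) = 1 := (QuotientGroup.eq_one_iff _).2 hy
    have e3 : ((((t' ^ k0 * h0') ^ m)⁻¹ * (t' ^ k * y') : K) : K ⧸ N) = 1 := by
      rw [QuotientGroup.mk_mul, QuotientGroup.mk_inv, QuotientGroup.mk_zpow, QuotientGroup.mk_mul,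
        QuotientGroup.mk_mul, e1, e2, QuotientGroup.mk_zpow, QuotientGroup.mk_zpow, mul_one, mul_one,
        ← hm, ← zpow_mul, smul_eq_mul, mul_comm m k0, inv_mul_cancel]
    have e4 := (QuotientGroup.eq_one_iff _).1 e3
    have e5 : ((t ^ k0 * h0) ^ m)⁻¹ * (t ^ k * y) ∈ H := e4
    rw [hxy]
    exact e5
  | fin H K _ hHK hi ih =>
    intro L hL
    have hi' : (H.subgroupOf L).FiniteIndex := by
      constructor
      intro h0
      exact hi (Subgroup.relIndex_eq_zero_of_le_right hL h0)
    let T : Set G := Set.range (fun q : L ⧸ H.subgroupOf L ↦ (q.out : G))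
    refine fg_ext L (L ⊓ H) inf_le_left (ih _ inf_le_right) T (Set.finite_range _)
      (by rintro _ ⟨q, rfl⟩; exact q.out.2) ?_
    intro x hx
    refine ⟨_, Subgroup.subset_closure ⟨((⟨x, hx⟩ : L) : L ⧸ H.subgroupOf L), rfl⟩, ?_⟩
    refine ⟨L.mul_mem (L.inv_mem (Subtype.coe_prop _)) hx, ?_⟩
    have : ((⟨x, hx⟩ : L) : L ⧸ H.subgroupOf L).out⁻¹ * ⟨x, hx⟩ ∈ H.subgroupOf L := by
      rw [← QuotientGroup.eq]; simp
    exact this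

lemma ext_cyc {G : Type*} [Group G] (hmax : ∀ L : Subgroup G, L.FG) (H K : Subgroup G) (t : G)
    (hHK : H ≤ K) (hn : ∀ x ∈ K, ∀ h ∈ H, x * h * x⁻¹ ∈ H) (ht : t ∈ K)
    (hx : ∀ x ∈ K, ∃ k : ℤ, ∃ h ∈ H, x = t ^ k * h) (B : Subgroup G) (hB : B ≤ H)
    (hBi : B.relIndex H ≠ 0) : ∃ N ≤ K, N.relIndex K ≠ 0 ∧ N ⊓ H ≤ B := by
  by_cases hfin : ∃ j : ℤ, j ≠ 0 ∧ t ^ j ∈ H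
  · obtain ⟨j, hj, htj⟩ := hfin
    refine ⟨B, hB.trans hHK, ?_, inf_le_left⟩
    refine Subgroup.relIndex_ne_zero_trans hBi ?_
    choose k h hh hkh using hx
    have : NeZero j.natAbs := ⟨Int.natAbs_ne_zero.2 hj⟩
    have := finiteIndex_of_map (H.subgroupOf K) (fun x : K ↦ ((k x x.2 : ℤ) : ZMod j.natAbs)) (by
      intro a b hab
      rw [ZMod.intCast_eq_intCast_iff_dvd_sub, Int.natAbs_dvd] at hab
      obtain ⟨m, hm⟩ := hab
      have e1 : (a : G)⁻¹ * b = (h a a.2)⁻¹ * (t ^ j) ^ m * h b b.2 := by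
        rw [← zpow_mul, ← hm, sub_eq_neg_add, zpow_add, zpow_neg]
        conv_lhs => rw [hkh a a.2, hkh b b.2]
        group
      show (a : G)⁻¹ * b ∈ H
      rw [e1]
      exact mul_mem (mul_mem (inv_mem (hh _ _)) (zpow_mem htj m)) (hh _ _))
    exact this.index_ne_zero
  · push Not at hfin
    have hHfg : Group.FG H := (Group.fg_iff_subgroup_fg H).2 (hmax H)
    obtain ⟨B1, hB1, hB1n, hB1i, hB1f⟩ := fcore hHfg (B.subgroupOf H) ⟨hBi⟩
    have hconj : ∀ l : ℤ, ∀ b : G, ∀ hb : b ∈ B1.map H.subtype,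
        t ^ l * b * (t ^ l)⁻¹ ∈ B1.map H.subtype := by
      rintro l _ ⟨b, hb, rfl⟩
      let f : H →* H :=
        { toFun := fun x ↦ ⟨t ^ l * x * (t ^ l)⁻¹, hn _ (zpow_mem ht l) _ x.2⟩
          map_one' := by apply Subtype.ext; simp
          map_mul' := by intro x y; apply Subtype.ext; simp }
      exact ⟨f b, hB1f f b hb, rfl⟩
    let N : Subgroup G :=
      { carrier := {x | ∃ k : ℤ, ∃ b ∈ B1.map H.subtype, x = t ^ k * b}
        one_mem' := ⟨0, 1, one_mem _, by simp⟩
        mul_mem' := by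
          rintro _ _ ⟨k, b, hb, rfl⟩ ⟨k', b', hb', rfl⟩
          refine ⟨k + k', _, mul_mem (hconj (-k') b hb) hb', ?_⟩
          rw [zpow_add]; group
        inv_mem' := by
          rintro _ ⟨k, b, hb, rfl⟩
          refine ⟨-k, _, hconj k _ (inv_mem hb), ?_⟩
          group }
    have hB1H : B1.map H.subtype ≤ H := by
      rintro _ ⟨b, _, rfl⟩
      exact b.2
    refine ⟨N, ?_, ?_, ?_⟩
    · rintro _ ⟨k, b, hb, rfl⟩
      exact mul_mem (zpow_mem ht k) (hHK (hB1H hb))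
    · choose k h hh hkh using hx
      have := finiteIndex_of_map (N.subgroupOf K)
        (fun x : K ↦ ((⟨h x⁻¹ (inv_mem x.2), hh _ _⟩⁻¹ : H) : H ⧸ B1)) (by
        intro a b hab
        have hab1 := QuotientGroup.eq.1 hab
        have hab2 : h (a : G)⁻¹ (inv_mem a.2) * (h (b : G)⁻¹ (inv_mem b.2))⁻¹ ∈ B1.map H.subtype := by
          refine ⟨_, hab1, ?_⟩
          simp
        have ea := hkh (a : G)⁻¹ (inv_mem a.2)
        have eb := hkh (b : G)⁻¹ (inv_mem b.2)
        have e1 : (a : G)⁻¹ * b = t ^ (k (a : G)⁻¹ (inv_mem a.2)) *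
            (h (a : G)⁻¹ (inv_mem a.2) * (h (b : G)⁻¹ (inv_mem b.2))⁻¹) *
            t ^ (- k (b : G)⁻¹ (inv_mem b.2)) := by
          have eb' : (b : G) = (h (b : G)⁻¹ (inv_mem b.2))⁻¹ * t ^ (- k (b : G)⁻¹ (inv_mem b.2)) := by
            rw [zpow_neg, ← mul_inv_rev, ← eb, inv_inv]
          conv_lhs => rw [ea, eb']
          group
        show (a : G)⁻¹ * b ∈ N
        rw [e1]
        exact mul_mem (mul_mem ⟨_, 1, one_mem _, (mul_one _).symm⟩ ⟨0, _, hab2, by simp⟩)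
          ⟨_, 1, one_mem _, (mul_one _).symm⟩)
      exact this.index_ne_zero
    · rintro x ⟨⟨k, b, hb, rfl⟩, hxH⟩
      have hk : k = 0 := by
        by_contra hk
        apply hfin k hk
        have := H.mul_mem hxH (H.inv_mem (hB1H hb))
        simpa using this
      rw [hk, zpow_zero, one_mul]
      obtain ⟨b, hb, rfl⟩ := hb
      exact hB1 hb

lemma Reach.ext {G : Type*} [Group G] (hmax : ∀ L : Subgroup G, L.FG) {A K : Subgroup G}
    (h : Reach A K) : A ≤ K ∧ ∀ B ≤ A, B.relIndex A ≠ 0 → ∃ N ≤ K, N.relIndex K ≠ 0 ∧ N ⊓ A ≤ B := by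
  induction h with
  | base => exact ⟨le_rfl, fun B hB hBi ↦ ⟨B, hB, hBi, inf_le_left⟩⟩
  | cyc H K t _ hHK hn ht hx ih =>
    refine ⟨ih.1.trans hHK, fun B hB hBi ↦ ?_⟩
    obtain ⟨N1, hN1, hN1i, hN1B⟩ := ih.2 B hB hBi
    obtain ⟨N, hN, hNi, hNB⟩ := ext_cyc hmax H K t hHK hn ht hx N1 hN1 hN1i
    exact ⟨N, hN, hNi, fun x hx ↦ hN1B ⟨hNB ⟨hx.1, ih.1 hx.2⟩, hx.2⟩⟩
  | fin H K _ hHK hi ih =>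
    refine ⟨ih.1.trans hHK, fun B hB hBi ↦ ?_⟩
    obtain ⟨N1, hN1, hN1i, hN1B⟩ := ih.2 B hB hBi
    exact ⟨N1, hN1.trans hHK, Subgroup.relIndex_ne_zero_trans hN1i hi, hN1B⟩

end TCS

namespace TCS

universe u

lemma solvable_step {G : Type*} [Group G] (H K : Subgroup G) (t : G)
    (hn : ∀ x ∈ K, ∀ h ∈ H, x * h * x⁻¹ ∈ H)
    (hx : ∀ x ∈ K, ∃ k : ℤ, ∃ h ∈ H, x = t ^ k * h) (ht : t ∈ K) (hs : Group.IsSolvable H) :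
    Group.IsSolvable K := by
  let N : Subgroup K := H.subgroupOf K
  have hN : N.Normal := by
    constructor
    intro n hn' g
    exact hn g g.2 n hn'
  have h1 : Group.IsSolvable N := by
    let f : N →* H := (K.subtype.comp N.subtype).codRestrict H (fun x ↦ x.2)
    refine Group.isSolvable_of_isSolvable_injective (f := f) ?_
    intro a b hab
    have h3 : ((a : K) : G) = ((b : K) : G) := congrArg (fun z : H ↦ (z : G)) hab
    exact Subtype.ext (Subtype.ext h3)
  have hgen : ∀ q : K ⧸ N, ∃ k : ℤ, q = ((⟨t, ht⟩ : K) : K ⧸ N) ^ k := by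
    intro q
    induction q using QuotientGroup.induction_on with
    | H x =>
      obtain ⟨k, h, hh, hxk⟩ := hx x x.2
      refine ⟨k, ?_⟩
      rw [← QuotientGroup.mk_zpow, eq_comm, QuotientGroup.eq]
      show (t ^ k)⁻¹ * (x : G) ∈ H
      rw [hxk, inv_mul_cancel_left]
      exact hh
  have h2 : Group.IsSolvable (K ⧸ N) := by
    apply Group.isSolvable_of_comm
    intro a b
    obtain ⟨k, rfl⟩ := hgen a
    obtain ⟨l, rfl⟩ := hgen b
    rw [← zpow_add, ← zpow_add, add_comm]
  exact (Group.isSolvable_iff_subgroup_quotient N).2 ⟨h1, h2⟩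

lemma polycyclic_facts {H : Type*} [Group H] (h : IsPolycyclic H) :
    Group.IsSolvable H ∧ Reach (⊥ : Subgroup H) ⊤ := by
  obtain ⟨n, s, h0, h1, hs⟩ := h
  have key : ∀ i : Fin (n + 1), Group.IsSolvable (s i) ∧ Reach (⊥ : Subgroup H) (s i) := by
    intro i
    induction i using Fin.induction with
    | zero =>
      rw [h0]
      exact ⟨inferInstance, .base⟩
    | succ i ih =>
      obtain ⟨hle, hn, t, ht, hx⟩ := hs i
      exact ⟨solvable_step _ _ t hn hx ht ih.1, .cyc _ _ t ih.2 hle hn ht hx⟩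
  have := key (Fin.last n)
  rw [h1] at this
  refine ⟨?_, this.2⟩
  have h2 := this.1
  exact Group.isSolvable_of_surjective (f := (⊤ : Subgroup H).subtype) (fun x ↦ ⟨⟨x, trivial⟩, rfl⟩)

open scoped commutatorElement in
theorem good_main (d : ℕ) : ∀ (G : Type u) [Group G], Reach (⊥ : Subgroup G) ⊤ →
    (∃ S : Subgroup G, S.FiniteIndex ∧ derivedSeries S d = ⊥) → Good G := by
  induction d with
  | zero =>
    rintro G _ _ ⟨S, hS, hd⟩
    have : Subsingleton S := by
      rw [derivedSeries_zero] at hd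
      exact Subgroup.subsingleton_iff.1 (subsingleton_of_bot_eq_top hd.symm)
    have hSb : S = ⊥ := Subgroup.eq_bot_of_subsingleton S
    have : Finite G := by
      rw [hSb] at hS
      have : Finite (G ⧸ (⊥ : Subgroup G)) := inferInstance
      exact Finite.of_equiv _ (QuotientGroup.quotientBot (G := G)).toEquiv
    exact good_finite G
  | succ d ih =>
    rintro G _ hR ⟨S0, hS0, hd0⟩
    have hmax : ∀ L : Subgroup G, L.FG := fun L ↦ hR.fg L le_top
    have hGfg : Group.FG G := ⟨hmax ⊤⟩
    obtain ⟨S, hSS0, hSn, hS, hSf⟩ := fcore hGfg S0 hS0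
    have hd : derivedSeries S (d + 1) = ⊥ := by
      have h1 := map_derivedSeries_le_derivedSeries (Subgroup.inclusion hSS0) (d + 1)
      rw [hd0, le_bot_iff, Subgroup.map_eq_bot_iff_of_injective _
        (Subgroup.inclusion_injective hSS0)] at h1
      exact h1
    let A : Subgroup G := (derivedSeries S d).map S.subtype
    have hAS : A ≤ S := by
      rintro _ ⟨x, _, rfl⟩
      exact x.2
    have hAf : ∀ f : G →* G, ∀ x ∈ A, f x ∈ A := by
      rintro f _ ⟨x, hx, rfl⟩
      let g : S →* S := (f.comp S.subtype).codRestrict S (fun y ↦ hSf f y y.2)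
      exact ⟨g x, map_derivedSeries_le_derivedSeries g d ⟨x, hx, rfl⟩, rfl⟩
    have hAn : A.Normal := by
      constructor
      intro n hn g
      exact hAf (MulAut.conj g).toMonoidHom n hn
    have hAc : ∀ a b : A, a * b = b * a := by
      rintro ⟨_, a, ha, rfl⟩ ⟨_, b, hb, rfl⟩
      apply Subtype.ext
      show (a : G) * b = b * a
      have h1 : ⁅a, b⁆ ∈ derivedSeries S (d + 1) := by
        rw [derivedSeries_succ]
        exact Subgroup.commutator_mem_commutator ha hb
      rw [hd, Subgroup.mem_bot, commutatorElement_eq_one_iff_mul_comm] at h1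
      exact congrArg Subtype.val h1
    have hgA : Good A := by
      let inst : CommGroup A := { (inferInstance : Group A) with mul_comm := hAc }
      have hAfg : Group.FG A := (Group.fg_iff_subgroup_fg A).2 (hmax A)
      have : Module.Finite ℤ (Additive A) :=
        Module.Finite.iff_addGroup_fg.2 (GroupFG.iff_add_fg.1 hAfg)
      exact good_abelian A this
    have hRq : Reach (⊥ : Subgroup (G ⧸ A)) ⊤ := by
      have := hR.map (QuotientGroup.mk' A)
      rwa [Subgroup.map_bot, Subgroup.map_top_of_surjective _ (QuotientGroup.mk'_surjective A)] at this
    have hRA : Reach A ⊤ := by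
      have := hRq.comap (QuotientGroup.mk' A) (QuotientGroup.mk'_surjective A)
      rwa [MonoidHom.comap_bot, QuotientGroup.ker_mk', Subgroup.comap_top] at this
    have hgq : Good (G ⧸ A) := by
      refine ih (G ⧸ A) hRq ⟨S.map (QuotientGroup.mk' A), ?_, ?_⟩
      · constructor
        have := Subgroup.index_map_dvd S (QuotientGroup.mk'_surjective A)
        intro h0
        rw [h0] at this
        exact hS.index_ne_zero (Nat.eq_zero_of_zero_dvd this)
      · let g : S →* S.map (QuotientGroup.mk' A) := (QuotientGroup.mk' A).subgroupMap S
        have hg : Function.Surjective g := (QuotientGroup.mk' A).subgroupMap_surjective S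
        rw [← map_derivedSeries_eq hg, eq_bot_iff]
        rintro _ ⟨x, hx, rfl⟩
        rw [Subgroup.mem_bot]
        apply Subtype.ext
        exact (QuotientGroup.eq_one_iff _).2 ⟨x, hx, rfl⟩
    intro C _ hC ρ δ h
    refine good_reduction hC h A (fun c a ha ↦ hAf (ρ c) a ha) hgq hgA ?_
    intro B _ hBF
    have hBA : B.map A.subtype ≤ A := by
      rintro _ ⟨x, _, rfl⟩
      exact x.2
    obtain ⟨N0, _, hN0i, hN0B⟩ := (hRA.ext hmax).2 (B.map A.subtype) hBA (by
      rw [Subgroup.relIndex, Subgroup.subgroupOf, Subgroup.comap_map_eq_self_of_injective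
        A.subtype_injective]
      exact hBF.index_ne_zero)
    rw [Subgroup.relIndex_top_right] at hN0i
    obtain ⟨N, hN, hNn, hNi, hNf⟩ := fcore hGfg N0 ⟨hN0i⟩
    refine ⟨N, hNn, hNi, fun c x hx ↦ hNf (ρ c) x hx, ?_⟩
    intro a ha
    obtain ⟨b, hb, hba⟩ := hN0B ⟨hN ha, a.2⟩
    have : b = a := Subtype.ext hba
    rwa [← this]

end TCS

open TCS in
/-- Every polycyclic-by-finite group is strongly twisted conjugacy separable: it is
`φ`-conjugacy separable for every automorphism `φ`. -/
theorem polycyclicByFinite_strongly_twisted_conjugacy_separable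
    {G : Type*} [Group G] (h : PolycyclicByFinite G) (φ : MulAut G) :
    PhiConjSep φ := by
  obtain ⟨H, hHn, hHp, hHi⟩ := h
  obtain ⟨hsol, hreach⟩ := polycyclic_facts hHp
  have hR : Reach (⊥ : Subgroup G) ⊤ := by
    have h1 := hreach.map H.subtype
    rw [Subgroup.map_bot, ← MonoidHom.range_eq_map, Subgroup.range_subtype] at h1
    refine .fin H ⊤ h1 le_top ?_
    rw [Subgroup.relIndex_top_right]
    exact hHi.index_ne_zero
  have hGfg : Group.FG G := ⟨hR.fg ⊤ le_top⟩
  obtain ⟨d, hd⟩ := hsol.solvable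
  have hgood : Good G := good_main d G hR ⟨H, hHi, hd⟩
  intro x y hxy
  -- the cocycle
  let ψ : G →* G := (MulAut.conj x).toMonoidHom.comp φ.toMonoidHom
  have hψ : ∀ g, ψ g = x * φ g * x⁻¹ := fun g ↦ rfl
  let ρ : G →* Monoid.End G :=
    { toFun := fun g ↦ (MulAut.conj (ψ g)).toMonoidHom
      map_one' := by
        refine MonoidHom.ext fun z ↦ ?_
        show ψ 1 * z * (ψ 1)⁻¹ = z
        simp
      map_mul' := by
        intro a b
        refine MonoidHom.ext fun z ↦ ?_
        show ψ (a * b) * z * (ψ (a * b))⁻¹ = ψ a * (ψ b * z * (ψ b)⁻¹) * (ψ a)⁻¹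
        rw [map_mul]; group }
  have hρ : ∀ g z, ρ g z = ψ g * z * (ψ g)⁻¹ := fun g z ↦ rfl
  let δ : G → G := fun g ↦ g * (ψ g)⁻¹
  have hδ : IsCoc ρ δ := by
    intro a b
    show a * b * (ψ (a * b))⁻¹ = a * (ψ a)⁻¹ * ρ a (b * (ψ b)⁻¹)
    rw [hρ, map_mul]; group
  have hclo : Clo δ := hgood G ⟨H, hHi, hsol⟩ ρ δ hδ
  have hnot : ¬ InClo δ (y * x⁻¹) := by
    intro hin
    obtain ⟨g, hg⟩ := hclo _ hin
    apply hxy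
    refine ⟨g, ?_⟩
    have h1 : y = g * (x * φ g * x⁻¹)⁻¹ * x := by
      have : g * (x * φ g * x⁻¹)⁻¹ = y * x⁻¹ := hg
      rw [this]; group
    rw [h1]; group
  simp only [InClo, not_forall, not_exists] at hnot
  obtain ⟨N0, _, hN0i, hN0⟩ := hnot
  obtain ⟨N, hNN0, hN, hNi, hNf⟩ := fcore hGfg N0 hN0i
  have hmap : N.map (φ : G →* G) = N := by
    apply le_antisymm
    · rintro _ ⟨z, hz, rfl⟩
      exact hNf (φ : G →* G) z hz
    · intro z hz
      exact ⟨φ.symm z, hNf (φ.symm : G →* G) z hz, φ.apply_symm_apply z⟩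
  let φ0 : (G ⧸ N) ≃* (G ⧸ N) := QuotientGroup.congr N N φ hmap
  have hφ0 : ∀ g : G, φ0 (g : G ⧸ N) = ((φ g : G) : G ⧸ N) := fun g ↦ rfl
  let e : Shrink.{0} (G ⧸ N) ≃* (G ⧸ N) := Shrink.mulEquiv
  have hfinK : Finite (Shrink.{0} (G ⧸ N)) := Finite.of_equiv _ e.symm.toEquiv
  let φK : MulAut (Shrink.{0} (G ⧸ N)) := (e.trans φ0).trans e.symm
  have hφK : ∀ g : G, φK (e.symm (g : G ⧸ N)) = e.symm ((φ g : G) : G ⧸ N) := by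
    intro g
    show e.symm (φ0 (e (e.symm (g : G ⧸ N)))) = _
    rw [e.apply_symm_apply, hφ0]
  let F : G →* Shrink.{0} (G ⧸ N) := e.symm.toMonoidHom.comp (QuotientGroup.mk' N)
  have hF : ∀ g, F g = e.symm (g : G ⧸ N) := fun g ↦ rfl
  have hsurj : Function.Surjective F := e.symm.surjective.comp (QuotientGroup.mk'_surjective N)
  refine SepWitness.intro (Shrink.{0} (G ⧸ N)) φK F hsurj (fun g ↦ (hφK g).symm) ?_
  rintro ⟨k, hk⟩
  obtain ⟨g, rfl⟩ := hsurj k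
  have h1 : φK (F g) = F (φ g) := hφK g
  rw [h1, ← map_mul, ← map_inv, ← map_mul] at hk
  have h2 : ((g * x * (φ g)⁻¹ : G) : G ⧸ N) = (y : G ⧸ N) := (e.symm.injective hk).symm
  have h3 := hN.conj_mem _ (QuotientGroup.eq.1 h2) x
  apply hN0 g
  apply hNN0
  convert h3 using 1
  show (g * (x * φ g * x⁻¹)⁻¹)⁻¹ * (y * x⁻¹) = _
  group
end

section
/- Let G be a finite group and φ an automorphism of G. Then the Reidemeister number R(φ), i.e., the number of φ-conjugacy classes of G, equals the number of isomorphism classes of irreducible finite-dimensional complex representations ρ of G such that ρ ∘ φ is isomorphic to ρ (twisted Burnside–Frobenius theorem for finite groups). -/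
/-- Twisted conjugacy is an equivalence relation; its classes are the
`φ`-conjugacy (Reidemeister) classes. -/
def twSetoid (G : Type*) [Group G] (φ : MulAut G) : Setoid G where
  r := TwistedConj φ
  iseqv := by
    refine ⟨fun x => ⟨1, by simp⟩, ?_, ?_⟩
    · rintro x y ⟨g, rfl⟩
      exact ⟨g⁻¹, by simp [mul_assoc]⟩
    · rintro x y z ⟨g, rfl⟩ ⟨h, rfl⟩
      exact ⟨h * g, by simp [mul_assoc]⟩

/-- A finite-dimensional complex representation of `G`: a dimension `n` together with a
homomorphism `G → GL(n, ℂ)`. -/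
def FinRep (G : Type*) [Group G] :=
  Σ n : ℕ, G →* Matrix.GeneralLinearGroup (Fin n) ℂ

/-- A representation is irreducible if its space is nonzero and the only invariant
subspaces are `0` and the whole space. -/
def FinRep.IsIrreducible {G : Type*} [Group G] (V : FinRep G) : Prop :=
  0 < V.1 ∧
  ∀ p : Submodule ℂ (Fin V.1 → ℂ),
    (∀ g : G, ∀ v ∈ p, ((V.2 g : Matrix (Fin V.1) (Fin V.1) ℂ).mulVec v) ∈ p) →
    p = ⊥ ∨ p = ⊤

/-- Two representations are isomorphic if there is an invertible linear intertwiner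
between them. -/
def FinRep.Iso {G : Type*} [Group G] (V W : FinRep G) : Prop :=
  ∃ e : (Fin V.1 → ℂ) ≃ₗ[ℂ] (Fin W.1 → ℂ),
    ∀ (g : G) (v : Fin V.1 → ℂ),
      e ((V.2 g : Matrix (Fin V.1) (Fin V.1) ℂ).mulVec v) =
        (W.2 g : Matrix (Fin W.1) (Fin W.1) ℂ).mulVec (e v)

/-- The pullback `ρ ∘ φ` of a representation `ρ` along an automorphism `φ`. -/
def FinRep.comp {G : Type*} [Group G] (φ : MulAut G) (V : FinRep G) : FinRep G :=
  ⟨V.1, V.2.comp φ.toMonoidHom⟩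

/-- The matrix of `g` in the representation `V`. -/
def FinRep.mat {G : Type*} [Group G] (V : FinRep G) (g : G) : Matrix (Fin V.1) (Fin V.1) ℂ :=
  (V.2 g : Matrix (Fin V.1) (Fin V.1) ℂ)

section
variable {G : Type*} [Group G]

lemma FinRep.mat_mul (V : FinRep G) (g h : G) : V.mat (g * h) = V.mat g * V.mat h := by
  simp [FinRep.mat]

lemma FinRep.mat_one (V : FinRep G) : V.mat 1 = 1 := by
  simp [FinRep.mat]

lemma FinRep.mat_mul_inv (V : FinRep G) (g : G) : V.mat g * V.mat g⁻¹ = 1 := by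
  rw [← FinRep.mat_mul]; simp [FinRep.mat_one]

lemma FinRep.mat_inv_mul (V : FinRep G) (g : G) : V.mat g⁻¹ * V.mat g = 1 := by
  rw [← FinRep.mat_mul]; simp [FinRep.mat_one]

lemma FinRep.iso_iff (V W : FinRep G) : V.Iso W ↔
    ∃ (T : Matrix (Fin W.1) (Fin V.1) ℂ) (S : Matrix (Fin V.1) (Fin W.1) ℂ),
      T * S = 1 ∧ S * T = 1 ∧ ∀ g, T * V.mat g = W.mat g * T := by
  constructor
  · rintro ⟨e, he⟩
    refine ⟨LinearMap.toMatrix' e.toLinearMap, LinearMap.toMatrix' e.symm.toLinearMap, ?_, ?_, ?_⟩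
    · rw [← LinearMap.toMatrix'_comp]; simp
    · rw [← LinearMap.toMatrix'_comp]; simp
    · intro g
      apply Matrix.toLin'.injective
      apply LinearMap.ext
      intro v
      simp only [Matrix.toLin'_mul, LinearMap.comp_apply, Matrix.toLin'_toMatrix']
      simpa [FinRep.mat] using he g v
  · rintro ⟨T, S, h1, h2, h⟩
    refine ⟨LinearEquiv.ofLinearMap (Matrix.toLin' T) (Matrix.toLin' S) ?_ ?_, ?_⟩
    · rw [← Matrix.toLin'_mul, h1]; simp
    · rw [← Matrix.toLin'_mul, h2]; simp
    · intro g v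
      have := congrArg (fun M => M.mulVec v) (h g)
      simpa [FinRep.mat, ← Matrix.mulVec_mulVec] using this

lemma FinRep.Iso.symm' {V W : FinRep G} (h : V.Iso W) : W.Iso V := by
  obtain ⟨e, he⟩ := h
  refine ⟨e.symm, fun g v => ?_⟩
  apply e.injective
  rw [he]; simp

lemma FinRep.Iso.refl' (V : FinRep G) : V.Iso V := ⟨LinearEquiv.refl _ _, fun _ _ => rfl⟩

lemma FinRep.Iso.trans' {V W U : FinRep G} (h : V.Iso W) (h' : W.Iso U) : V.Iso U := by
  obtain ⟨e, he⟩ := h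
  obtain ⟨f, hf⟩ := h'
  exact ⟨e.trans f, fun g v => by simp [he, hf]⟩

/-- Schur's lemma, first half. -/
lemma FinRep.schur_iso {V W : FinRep G} (hV : V.IsIrreducible) (hW : W.IsIrreducible)
    (X : Matrix (Fin W.1) (Fin V.1) ℂ) (hX : ∀ g, X * V.mat g = W.mat g * X) (h0 : X ≠ 0) :
    V.Iso W := by
  have hv : ∀ g v, X.mulVec ((V.mat g).mulVec v) = (W.mat g).mulVec (X.mulVec v) := by
    intro g v
    rw [Matrix.mulVec_mulVec, hX, Matrix.mulVec_mulVec]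
  have hne : Matrix.toLin' X ≠ 0 := by
    intro h; apply h0; exact Matrix.toLin'.map_eq_zero_iff.mp h
  have hk : LinearMap.ker (Matrix.toLin' X) = ⊥ := by
    refine (hV.2 (LinearMap.ker (Matrix.toLin' X)) ?_).resolve_right ?_
    · intro g v hv'
      have h1 : X.mulVec v = 0 := by simpa using hv'
      have := hv g v
      rw [h1, Matrix.mulVec_zero] at this
      simpa [FinRep.mat] using this
    · intro h; exact hne (LinearMap.ker_eq_top.mp h)
  have hr : LinearMap.range (Matrix.toLin' X) = ⊤ := by
    refine (hW.2 (LinearMap.range (Matrix.toLin' X)) ?_).resolve_left ?_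
    · rintro g _ ⟨v, rfl⟩
      exact ⟨(V.mat g).mulVec v, by simpa [FinRep.mat] using hv g v⟩
    · intro h; exact hne (LinearMap.range_eq_bot.mp h)
  refine ⟨LinearEquiv.ofBijective (Matrix.toLin' X)
    ⟨LinearMap.ker_eq_bot.mp hk, LinearMap.range_eq_top.mp hr⟩, ?_⟩
  intro g v
  exact hv g v

/-- Schur's lemma, second half. -/
lemma FinRep.schur_scalar {V : FinRep G} (hV : V.IsIrreducible)
    (X : Matrix (Fin V.1) (Fin V.1) ℂ) (hX : ∀ g, X * V.mat g = V.mat g * X) :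
    ∃ c : ℂ, X = c • 1 := by
  have : Nonempty (Fin V.1) := ⟨⟨0, hV.1⟩⟩
  obtain ⟨c, hc⟩ := Module.End.exists_eigenvalue (Matrix.toLin' X)
  refine ⟨c, ?_⟩
  have h := (hV.2 (Module.End.eigenspace (Matrix.toLin' X) c) ?_).resolve_left hc
  · apply Matrix.toLin'.injective
    apply LinearMap.ext
    intro v
    have hv : v ∈ Module.End.eigenspace (Matrix.toLin' X) c := by rw [h]; trivial
    rw [Module.End.mem_eigenspace_iff] at hv
    rw [hv]; simp
  · intro g v hv
    rw [Module.End.mem_eigenspace_iff, Matrix.toLin'_apply] at hv ⊢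
    change X.mulVec ((V.mat g).mulVec v) = c • ((V.mat g).mulVec v)
    rw [Matrix.mulVec_mulVec, hX, ← Matrix.mulVec_mulVec, hv, Matrix.mulVec_smul]

lemma FinRep.avg_intertwine [Fintype G] (V W : FinRep G) (X : Matrix (Fin V.1) (Fin W.1) ℂ)
    (h : G) : (∑ g, V.mat g * X * W.mat g⁻¹) * W.mat h = V.mat h * ∑ g, V.mat g * X * W.mat g⁻¹ := by
  rw [Matrix.sum_mul, Matrix.mul_sum, ← Equiv.sum_comp (Equiv.mulLeft h)]
  refine Finset.sum_congr rfl fun g _ => ?_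
  simp only [Equiv.coe_mulLeft, mul_inv_rev, FinRep.mat_mul, Matrix.mul_assoc,
    FinRep.mat_inv_mul, Matrix.mul_one]

lemma FinRep.avg_entry [Fintype G] (V W : FinRep G) (j : Fin V.1) (k : Fin W.1)
    (i : Fin V.1) (l : Fin W.1) :
    (∑ g, V.mat g * Matrix.single j k (1 : ℂ) * W.mat g⁻¹) i l =
      ∑ g, V.mat g i j * W.mat g⁻¹ k l := by
  rw [Matrix.sum_apply]
  refine Finset.sum_congr rfl fun g _ => ?_
  rw [Matrix.mul_apply, Finset.sum_eq_single k]
  · simp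
  · intro b _ hb
    rw [Matrix.mul_single_apply_of_ne]
    · simp
    · exact hb
  · simp

lemma FinRep.sum_trace_expand [Fintype G] (V W : FinRep G) (A : Matrix (Fin V.1) (Fin V.1) ℂ)
    (B : Matrix (Fin W.1) (Fin W.1) ℂ) :
    ∑ g, (V.mat g * A).trace * (W.mat g⁻¹ * B).trace =
      ∑ i, ∑ j, ∑ k, ∑ l, A j i * B l k * ∑ g, V.mat g i j * W.mat g⁻¹ k l := by
  have h1 : ∀ g, (V.mat g * A).trace * (W.mat g⁻¹ * B).trace =
      ∑ i, ∑ j, ∑ k, ∑ l, A j i * B l k * (V.mat g i j * W.mat g⁻¹ k l) := by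
    intro g
    simp only [Matrix.trace, Matrix.diag_apply, Matrix.mul_apply]
    rw [Finset.sum_mul]
    refine Finset.sum_congr rfl fun i _ => ?_
    rw [Finset.sum_mul]
    refine Finset.sum_congr rfl fun j _ => ?_
    rw [Finset.mul_sum]
    refine Finset.sum_congr rfl fun k _ => ?_
    rw [Finset.mul_sum]
    refine Finset.sum_congr rfl fun l _ => ?_
    ring
  rw [Finset.sum_congr rfl fun g _ => h1 g, Finset.sum_comm]
  refine Finset.sum_congr rfl fun i _ => ?_
  rw [Finset.sum_comm]
  refine Finset.sum_congr rfl fun j _ => ?_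
  rw [Finset.sum_comm]
  refine Finset.sum_congr rfl fun k _ => ?_
  rw [Finset.sum_comm]
  refine Finset.sum_congr rfl fun l _ => ?_
  rw [Finset.mul_sum]

lemma FinRep.orth_ne [Fintype G] {V W : FinRep G} (hV : V.IsIrreducible) (hW : W.IsIrreducible)
    (hVW : ¬ W.Iso V) (A : Matrix (Fin V.1) (Fin V.1) ℂ) (B : Matrix (Fin W.1) (Fin W.1) ℂ) :
    ∑ g, (V.mat g * A).trace * (W.mat g⁻¹ * B).trace = 0 := by
  have key : ∀ i j k l, ∑ g, V.mat g i j * W.mat g⁻¹ k l = 0 := by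
    intro i j k l
    rw [← FinRep.avg_entry]
    have : (∑ g, V.mat g * Matrix.single j k (1 : ℂ) * W.mat g⁻¹) = 0 := by
      by_contra h
      exact hVW (FinRep.schur_iso hW hV _ (FinRep.avg_intertwine V W _) h)
    rw [this]; rfl
  rw [FinRep.sum_trace_expand]
  simp [key]

lemma FinRep.orth_self [Fintype G] {V : FinRep G} (hV : V.IsIrreducible)
    (A B : Matrix (Fin V.1) (Fin V.1) ℂ) (hAB : A * B = 1) :
    ∑ g, (V.mat g * A).trace * (V.mat g⁻¹ * B).trace = Fintype.card G := by
  have hn : (V.1 : ℂ) ≠ 0 := by exact_mod_cast hV.1.ne'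
  have key : ∀ i j k l, ∑ g, V.mat g i j * V.mat g⁻¹ k l =
      if j = k then (if i = l then (Fintype.card G : ℂ) / V.1 else 0) else 0 := by
    intro i j k l
    rw [← FinRep.avg_entry]
    obtain ⟨c, hc⟩ := FinRep.schur_scalar hV _
      (FinRep.avg_intertwine V V (Matrix.single j k (1 : ℂ)))
    have ht := congrArg Matrix.trace hc
    have : ∀ g, (V.mat g * Matrix.single j k (1 : ℂ) * V.mat g⁻¹).trace =
        if j = k then 1 else 0 := by
      intro g
      rw [Matrix.trace_mul_comm, ← Matrix.mul_assoc, FinRep.mat_inv_mul, Matrix.one_mul]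
      split_ifs with h
      · subst h; simp
      · simp [Matrix.trace_single_eq_of_ne, h]
    rw [Matrix.trace_sum, Finset.sum_congr rfl (fun g _ => this g)] at ht
    rw [hc]
    simp only [Finset.sum_const, Finset.card_univ, Matrix.trace_smul, Matrix.trace_one,
      Fintype.card_fin, smul_eq_mul, nsmul_eq_mul] at ht
    have hc' : c = (if j = k then (Fintype.card G : ℂ) else 0) / V.1 := by
      rw [eq_div_iff hn, ← ht]; simp
    rw [hc', Matrix.smul_apply, Matrix.one_apply]
    split_ifs <;> simp
  rw [FinRep.sum_trace_expand]
  simp only [key]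
  have : ∀ i, ∑ j, A j i * B i j = (B * A) i i := by
    intro i
    rw [Matrix.mul_apply]
    exact Finset.sum_congr rfl fun j _ => mul_comm _ _
  simp only [mul_ite, mul_zero, Finset.sum_ite_eq, Finset.mem_univ, if_true, Finset.sum_ite_irrel, Finset.sum_const_zero]
  simp only [← Finset.sum_mul, this, mul_eq_one_comm.mp hAB]
  simp
  field_simp

/-- An element of the group algebra killed by every irreducible matrix representation is zero. -/
lemma FinRep.eq_zero_of_forall [Fintype G] (f : G → ℂ)
    (h : ∀ V : FinRep G, V.IsIrreducible → ∑ g, f g • V.mat g = 0) : f = 0 := by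
  classical
  let A := MonoidAlgebra ℂ G
  let α : A := ∑ g, f g • MonoidAlgebra.of ℂ G g
  have hα : α = 0 := by
    have : NeZero (Nat.card G : ℂ) := ⟨by exact_mod_cast Nat.card_pos.ne'⟩
    have hss : IsSemisimpleRing A := inferInstance
    have hjac : Ring.jacobson A = ⊥ := IsSemisimpleRing.jacobson_eq_bot A
    have hmem : α ∈ Ring.jacobson A := by
      rw [Ring.jacobson, Module.jacobson, Submodule.mem_sInf]
      intro m hm
      have hs : IsSimpleModule A (A ⧸ m) := isSimpleModule_iff_isCoatom.mpr hm
      let M := A ⧸ m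
      let b := Module.finBasis ℂ M
      let ρ : A →ₐ[ℂ] Matrix (Fin (Module.finrank ℂ M)) (Fin (Module.finrank ℂ M)) ℂ :=
        (LinearMap.toMatrixAlgEquiv b).toAlgHom.comp (Algebra.lsmul ℂ ℂ M)
      let V : FinRep G := ⟨Module.finrank ℂ M,
        (ρ.toMonoidHom.comp (MonoidAlgebra.of ℂ G)).toHomUnits⟩
      have hVm : ∀ g, V.mat g = ρ (MonoidAlgebra.of ℂ G g) := fun g => rfl
      have hρ : ∀ a (x : M), (ρ a).mulVec (b.equivFun x) = b.equivFun (a • x) := by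
        intro a x
        exact LinearMap.toMatrix_mulVec_repr b b (Algebra.lsmul ℂ ℂ M a) x
      have hirr : V.IsIrreducible := by
        have : Nontrivial M := IsSimpleModule.nontrivial A M
        refine ⟨Module.finrank_pos, ?_⟩
        intro p hp
        let q : Submodule A M :=
          { carrier := {x | b.equivFun x ∈ p}
            add_mem' := fun {x y} hx hy => by
              simp only [Set.mem_ofPred_eq, map_add] at *; exact p.add_mem hx hy
            zero_mem' := by simp
            smul_mem' := fun a x hx => by
              induction a using MonoidAlgebra.induction_on with
              | of g =>
                have := hp g _ hx
                change (V.mat g).mulVec _ ∈ p at this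
                rw [hVm, hρ] at this
                exact this
              | add a c ha hc =>
                simp only [Set.mem_ofPred_eq, add_smul, map_add] at *; exact p.add_mem ha hc
              | smul r a ha =>
                simp only [Set.mem_ofPred_eq, smul_assoc, map_smul] at *; exact p.smul_mem r ha }
        rcases eq_bot_or_eq_top q with hq | hq
        · left
          rw [Submodule.eq_bot_iff]
          intro v hv
          have : b.equivFun.symm v ∈ q := by
            change b.equivFun (b.equivFun.symm v) ∈ p
            rw [LinearEquiv.apply_symm_apply]; exact hv
          rw [hq, Submodule.mem_bot] at this
          exact b.equivFun.symm.map_eq_zero_iff.mp this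
        · right
          rw [Submodule.eq_top_iff']
          intro v
          have : b.equivFun.symm v ∈ q := by rw [hq]; trivial
          change b.equivFun (b.equivFun.symm v) ∈ p at this
          rw [LinearEquiv.apply_symm_apply] at this; exact this
      have h0 : ρ α = 0 := by
        have := h V hirr
        simp only [hVm] at this
        rw [map_sum]
        simp only [map_smul]
        exact this
      have h1 := hρ α (Submodule.Quotient.mk 1)
      rw [h0, Matrix.zero_mulVec] at h1
      have h2 : α • (Submodule.Quotient.mk 1 : M) = 0 := by
        apply b.equivFun.injective; rw [← h1, map_zero]
      rw [← Submodule.Quotient.mk_smul, Submodule.Quotient.mk_eq_zero] at h2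
      simpa using h2
    rw [hjac] at hmem
    simpa using hmem
  funext g
  have hα' : (∑ x, MonoidAlgebra.single x (f x) : MonoidAlgebra ℂ G) = 0 := by
    rw [← hα]
    refine Finset.sum_congr rfl fun x _ => ?_
    simp [MonoidAlgebra.of_apply]
  have := congrArg (fun a : MonoidAlgebra ℂ G => a.coeff g) hα'
  simpa [MonoidAlgebra.coeff_sum, Finsupp.finsetSum_apply, Finsupp.single_apply] using this

lemma FinRep.comp_irr (φ : MulAut G) {V : FinRep G} (hV : V.IsIrreducible) :
    (FinRep.comp φ V).IsIrreducible := by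
  refine ⟨hV.1, fun p hp => hV.2 p fun g v hv => ?_⟩
  have := hp (φ.symm g) v hv
  have h2 : (FinRep.comp φ V).2 (φ.symm g) = V.2 g := by
    change V.2 (φ (φ.symm g)) = V.2 g
    rw [MulEquiv.apply_symm_apply]
  rw [h2] at this
  exact this

lemma FinRep.comp_mat (φ : MulAut G) (V : FinRep G) (g : G) :
    (FinRep.comp φ V).mat g = V.mat (φ g) := rfl

lemma FinRep.exists_twist (φ : MulAut G) {V : FinRep G} (h : FinRep.Iso (FinRep.comp φ V) V) :
    ∃ T S : Matrix (Fin V.1) (Fin V.1) ℂ,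
      T * S = 1 ∧ S * T = 1 ∧ ∀ g, T * V.mat (φ g) = V.mat g * T :=
  (FinRep.iso_iff _ _).mp h

end

/-- Twisted Burnside–Frobenius theorem for finite groups: for a finite group `G` and an
automorphism `φ`, the Reidemeister number `R(φ)` (the number of `φ`-conjugacy classes of
`G`) equals the number of isomorphism classes of irreducible finite-dimensional complex
representations `ρ` of `G` with `ρ ∘ φ` isomorphic to `ρ`. -/
theorem twisted_burnside_frobenius_finite
    (G : Type*) [Group G] [Finite G] (φ : MulAut G) :
    Nat.card (Quotient (twSetoid G φ)) =
      Nat.card (Quot (fun V W :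
          {V : FinRep G // V.IsIrreducible ∧ FinRep.Iso (FinRep.comp φ V) V} =>
        FinRep.Iso V.1 W.1)) := by
  classical
  have : Fintype G := Fintype.ofFinite G
  set X := {V : FinRep G // V.IsIrreducible ∧ FinRep.Iso (FinRep.comp φ V) V} with hXdef
  set I := Quot (fun V W : X => FinRep.Iso V.1 W.1) with hI
  have hcard : (Fintype.card G : ℂ) ≠ 0 := by exact_mod_cast Fintype.card_ne_zero
  have hir : ∀ i : I, i.out.1.IsIrreducible := fun i => i.out.2.1
  have hex := fun i : I => FinRep.exists_twist φ i.out.2.2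
  choose T S hTS hST hT using hex
  have hne : ∀ i j : I, i ≠ j → ¬ i.out.1.Iso j.out.1 := by
    intro i j hij h
    apply hij
    rw [← Quot.out_eq i, ← Quot.out_eq j]
    exact Quot.sound h
  let Q := Quotient (twSetoid G φ)
  let L : (Q → ℂ) →ₗ[ℂ] (I → ℂ) :=
    { toFun := fun F i => ∑ x, F (Quotient.mk _ x) * (i.out.1.mat x⁻¹ * T i).trace
      map_add' := fun F F' => by
        funext i; simp [add_mul, Finset.sum_add_distrib]
      map_smul' := fun c F => by
        funext i; simp [Finset.mul_sum, mul_assoc] }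
  have hL : ∀ F i, L F i = ∑ x, F (Quotient.mk _ x) * (i.out.1.mat x⁻¹ * T i).trace :=
    fun _ _ => rfl
  have hS : ∀ i g, S i * i.out.1.mat g = i.out.1.mat (φ g) * S i := by
    intro i g
    have h := hT i g
    calc S i * i.out.1.mat g = S i * (i.out.1.mat g * T i) * S i := by
          rw [Matrix.mul_assoc, Matrix.mul_assoc, hTS, Matrix.mul_one]
      _ = S i * (T i * i.out.1.mat (φ g)) * S i := by rw [h]
      _ = _ := by rw [← Matrix.mul_assoc, hST]; rw [Matrix.one_mul]
  let f : I → Q → ℂ := fun i => Quotient.lift (fun x => (i.out.1.mat x * S i).trace) (by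
    rintro x y ⟨g, rfl⟩
    change _ = (i.out.1.mat (g * x * (φ g)⁻¹) * S i).trace
    rw [← map_inv, FinRep.mat_mul, Matrix.mul_assoc, ← hS, FinRep.mat_mul, ← Matrix.mul_assoc,
      Matrix.trace_mul_comm _ (i.out.1.mat g⁻¹), ← Matrix.mul_assoc, ← Matrix.mul_assoc,
      FinRep.mat_inv_mul, Matrix.one_mul])
  have hLf : ∀ i, L (f i) = Pi.single i (Fintype.card G : ℂ) := by
    intro i
    funext j
    rw [hL]
    change ∑ x, (i.out.1.mat x * S i).trace * (j.out.1.mat x⁻¹ * T j).trace = _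
    by_cases hij : j = i
    · subst hij
      rw [Pi.single_eq_same]
      exact FinRep.orth_self (hir j) _ _ (hST j)
    · rw [Pi.single_eq_of_ne hij]
      exact FinRep.orth_ne (hir i) (hir j) (hne j i hij) _ _
  have hli : LinearIndependent ℂ f := by
    apply LinearIndependent.of_comp L
    have : L ∘ f = fun i => (Fintype.card G : ℂ) • (Pi.single i (1 : ℂ) : I → ℂ) := by
      funext i
      simp only [Function.comp, hLf]
      rw [← Pi.single_smul]; simp
    rw [this]
    have h1 := Pi.linearIndependent_single_one I ℂ
    exact h1.units_smul (fun _ => Units.mk0 _ hcard)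
  have : Finite Q := Quotient.finite _
  have : Fintype Q := Fintype.ofFinite _
  have : Finite I := hli.finite
  have : Fintype I := Fintype.ofFinite _
  have hle : Fintype.card I ≤ Fintype.card Q := by
    have := hli.fintype_card_le_finrank
    simpa using this
  have hinj : Function.Injective L := by
    rw [← LinearMap.ker_eq_bot, LinearMap.ker_eq_bot']
    intro F hF
    have hz : (fun x : G => F (Quotient.mk _ x⁻¹)) = 0 := by
      apply FinRep.eq_zero_of_forall
      intro V hV
      set a := ∑ g, F (Quotient.mk _ g⁻¹) • V.mat g with ha
      have ha' : a = ∑ g, F (Quotient.mk _ g) • V.mat g⁻¹ := by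
        rw [ha, ← Equiv.sum_comp (Equiv.inv G)]; simp
      have haV : ∀ g, a * V.mat g = V.mat (φ g) * a := by
        intro g
        rw [ha', Finset.sum_mul, Finset.mul_sum,
          ← Equiv.sum_comp ((Equiv.mulLeft g).trans (Equiv.mulRight (φ g)⁻¹))]
        refine Finset.sum_congr rfl fun x _ => ?_
        have hc : (Quotient.mk (twSetoid G φ) (g * x * (φ g)⁻¹)) = Quotient.mk _ x :=
          (Quotient.sound (show TwistedConj φ x _ from ⟨g, rfl⟩)).symm
        simp only [Equiv.trans_apply, Equiv.coe_mulLeft, Equiv.coe_mulRight, hc, mul_inv_rev,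
          inv_inv, FinRep.mat_mul, Matrix.smul_mul, Matrix.mul_smul, Matrix.mul_assoc,
          FinRep.mat_inv_mul, Matrix.mul_one]
      by_contra hne0
      have hiso : V.Iso (FinRep.comp φ V) :=
        FinRep.schur_iso hV (FinRep.comp_irr φ hV) a haV hne0
      -- transport to the representative
      let i : I := Quot.mk _ ⟨V, hV, hiso.symm'⟩
      have hVi : i.out.1.Iso V := by
        have h := Quot.eqvGen_exact (Quot.out_eq i)
        have heq : Equivalence (fun V W : X => FinRep.Iso V.1 W.1) :=
          ⟨fun _ => FinRep.Iso.refl' _, FinRep.Iso.symm', FinRep.Iso.trans'⟩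
        exact heq.eqvGen_iff.mp h
      obtain ⟨P, P', hP, hP', hPV⟩ := (FinRep.iso_iff _ _).mp hVi
      -- the twisting matrix on `V`
      let T' := P * T i * P'
      have hVW : ∀ g, V.mat g = P * i.out.1.mat g * P' := by
        intro g; rw [hPV, Matrix.mul_assoc, hP, Matrix.mul_one]
      have hPV' : ∀ g, P' * V.mat g = i.out.1.mat g * P' := by
        intro g; rw [hVW, Matrix.mul_assoc, ← Matrix.mul_assoc P', hP', Matrix.one_mul]
      have hcomm : ∀ g, (T' * a) * V.mat g = V.mat g * (T' * a) := by
        intro g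
        have h := hT i g
        have h2 : T' * V.mat (φ g) = V.mat g * T' := by
          calc P * T i * P' * V.mat (φ g) = P * (T i * i.out.1.mat (φ g)) * P' := by
                rw [Matrix.mul_assoc, hPV']; simp only [Matrix.mul_assoc]
            _ = P * (i.out.1.mat g * T i) * P' := by rw [h]
            _ = V.mat g * (P * T i * P') := by
                rw [← Matrix.mul_assoc, hPV]; simp only [Matrix.mul_assoc]
        rw [Matrix.mul_assoc, haV, ← Matrix.mul_assoc, h2, Matrix.mul_assoc]
      obtain ⟨c, hc⟩ := FinRep.schur_scalar hV _ hcomm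
      have htr : (T' * a).trace = 0 := by
        have h := congrFun hF i
        rw [hL] at h
        rw [Matrix.trace_mul_comm, ha', Finset.sum_mul, Matrix.trace_sum]
        rw [Pi.zero_apply] at h
        rw [← h]
        refine Finset.sum_congr rfl fun x _ => ?_
        rw [Matrix.smul_mul, Matrix.trace_smul, smul_eq_mul]
        congr 1
        change (V.mat x⁻¹ * (P * T i * P')).trace = _
        rw [← Matrix.mul_assoc, Matrix.trace_mul_comm, ← Matrix.mul_assoc, ← Matrix.mul_assoc, hPV', Matrix.mul_assoc (i.out.1.mat x⁻¹), hP', Matrix.mul_one]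
      have hc0 : c = 0 := by
        rw [hc] at htr
        have hn : (V.1 : ℂ) ≠ 0 := by exact_mod_cast hV.1.ne'
        simpa [hn, hV.1.ne'] using htr
      rw [hc0, zero_smul] at hc
      apply hne0
      have : (P * S i * P') * T' = 1 := by
        calc P * S i * P' * (P * T i * P') = P * (S i * ((P' * P) * T i)) * P' := by
              simp only [Matrix.mul_assoc]
          _ = 1 := by
              rw [hP', Matrix.one_mul, hST]; rw [Matrix.mul_one]; exact hP
      calc a = (P * S i * P') * T' * a := by rw [this, Matrix.one_mul]
        _ = 0 := by rw [Matrix.mul_assoc, hc, Matrix.mul_zero]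
    funext q
    induction q using Quotient.inductionOn with
    | _ x => simpa using congrFun hz x⁻¹
  have hge : Fintype.card Q ≤ Fintype.card I := by
    have := LinearMap.finrank_le_finrank_of_injective hinj
    simpa using this
  rw [Nat.card_eq_fintype_card, Nat.card_eq_fintype_card]
  exact le_antisymm hge hle
end
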